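/- The quotient algebra A(𝓗^+)/𝓘 is commutative and is generated by the images of [ω_a], [J_a] (1 ≤ a ≤ ℓ) and [Λ_{ab}] (1 ≤ a ≠ b ≤ ℓ); moreover each Λ_{ab} (a ≠ b) lies in the center of A(𝓗^+). -/

import Mathlib

/-!
Common framework: vertex operator algebras over ℂ encoded via their modes,
weak/admissible/ordinary modules, twisted modules, Zhu's algebra data,
and the free bosonic (Heisenberg) vertex operator algebra `𝓗 = M(1)` of rank `ℓ`
together with its `θ`-fixed subalgebra `𝓗⁺`.
-/

open scoped BigOperators DirectSum TensorProduct

noncomputable section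

/-- Generalized binomial coefficient `(q choose n)` for `q : ℚ`. -/
def qchoose (q : ℚ) : ℕ → ℚ
  | 0 => 1
  | n + 1 => qchoose q n * (q - n) / (n + 1)

/-- Generalized binomial coefficient of an integer, as a complex number. -/
def zchoose (m : ℤ) (n : ℕ) : ℂ := ((qchoose (m : ℚ) n : ℚ) : ℂ)

/-- A vertex operator algebra over `ℂ`, encoded through its modes:
`Y u n : Module.End ℂ V` is the `n`-th mode `u_n` of the vertex operator `Y(u,z)`.
The axioms are: truncation, the vacuum and creation axioms, the (component form of
the) Jacobi/Borcherds identity, a lower-truncated `ℤ`-grading by `L(0)`-eigenvalues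
with finite dimensional homogeneous pieces compatible with the modes, the Virasoro
relations for the conformal vector and the `L(-1)`-derivative (translation) axiom. -/
structure VOA (V : Type) [AddCommGroup V] [Module ℂ V] : Type where
  Y : V →ₗ[ℂ] ℤ → Module.End ℂ V
  one : V
  omega : V
  wt : ℤ → Submodule ℂ V
  centralCharge : ℂ
  internal : DirectSum.IsInternal wt
  one_wt : one ∈ wt 0
  omega_wt : omega ∈ wt 2
  one_ne_zero : one ≠ 0
  fdim : ∀ n : ℤ, FiniteDimensional ℂ (wt n)
  bounded_below : ∃ N : ℤ, ∀ n : ℤ, n < N → wt n = ⊥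
  trunc : ∀ u v : V, ∃ N : ℤ, ∀ n : ℤ, N ≤ n → Y u n v = 0
  vacuum_act : ∀ n : ℤ, Y one n = if n = -1 then (1 : Module.End ℂ V) else 0
  create : ∀ u : V, Y u (-1) one = u
  create_ge : ∀ (u : V) (n : ℤ), 0 ≤ n → Y u n one = 0
  mode_wt : ∀ (k : ℤ) (u : V), u ∈ wt k → ∀ (m n : ℤ) (v : V), v ∈ wt m →
    Y u n v ∈ wt (m + k - n - 1)
  L0_diag : ∀ (n : ℤ) (v : V), v ∈ wt n → Y omega 1 v = (n : ℂ) • v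
  translation : ∀ (u : V) (n : ℤ), Y (Y omega 0 u) n = (-(n : ℂ)) • Y u (n - 1)
  virasoro : ∀ m n : ℤ,
    Y omega (m + 1) * Y omega (n + 1) - Y omega (n + 1) * Y omega (m + 1)
      = ((m : ℂ) - (n : ℂ)) • Y omega (m + n + 1)
        + (if m + n = 0 then (((m ^ 3 - m : ℤ) : ℂ) / 12) * centralCharge else 0)
            • (1 : Module.End ℂ V)
  borcherds : ∀ (u v w : V) (p m n : ℤ),
    ∑ᶠ i : ℕ, zchoose m i • Y (Y u (p + i) v) (m + n - i) w
      = ∑ᶠ i : ℕ, ((-1 : ℂ) ^ i * zchoose p i) •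
          (Y u (m + p - i) (Y v (n + i) w)
            - ((-1 : ℂ) ^ p) • Y v (n + p - i) (Y u (m + i) w))

variable {V : Type} [AddCommGroup V] [Module ℂ V]

/-- Simplicity of a vertex operator algebra: the only subspaces invariant under
all modes are `0` and the whole space. -/
def VOA.Simple (A : VOA V) : Prop :=
  ∀ U : Submodule ℂ V, (∀ (u : V) (n : ℤ) (v : V), v ∈ U → A.Y u n v ∈ U) → U = ⊥ ∨ U = ⊤

/-- The decomposition of a vertex operator algebra into its homogeneous pieces. -/
noncomputable def VOA.decompose (A : VOA V) : V ≃ₗ[ℂ] ⨁ n : ℤ, A.wt n :=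
  (LinearEquiv.ofBijective (DirectSum.coeLinearMap A.wt) A.internal).symm

/-- The homogeneous component of weight `n` of a vector. -/
noncomputable def VOA.hcomp (A : VOA V) (n : ℤ) (u : V) : V := (A.decompose u n : V)

/-- Zhu's product `u * v` for `u` (treated as) homogeneous of weight `k`:
`u*v = ∑_{i≥0} (k choose i) u_{i-1} v`. -/
noncomputable def VOA.mulAux (A : VOA V) (k : ℤ) (u v : V) : V :=
  ∑ᶠ i : ℕ, zchoose k i • A.Y u ((i : ℤ) - 1) v

/-- Zhu's circle product `u ∘ v` for `u` (treated as) homogeneous of weight `k`: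
`u∘v = ∑_{i≥0} (k choose i) u_{i-2} v`. -/
noncomputable def VOA.circAux (A : VOA V) (k : ℤ) (u v : V) : V :=
  ∑ᶠ i : ℕ, zchoose k i • A.Y u ((i : ℤ) - 2) v

/-- Zhu's product `u * v`, extended bilinearly via homogeneous components of `u`. -/
noncomputable def VOA.star (A : VOA V) (u v : V) : V :=
  ∑ᶠ k : ℤ, A.mulAux k (A.hcomp k u) v

/-- The subspace `O(V)` spanned by all circle products `u ∘ v` with `u` homogeneous;
Zhu's algebra is `A(V) = V/O(V)` with product induced by `VOA.star`. -/
def VOA.Osub (A : VOA V) : Submodule ℂ V :=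
  Submodule.span ℂ {w | ∃ (k : ℤ) (u v : V), u ∈ A.wt k ∧ w = A.circAux k u v}

/-- A weak module for a vertex operator algebra, given by modes satisfying
truncation, the vacuum axiom and the Borcherds identity. -/
structure WkMod (A : VOA V) (M : Type) [AddCommGroup M] [Module ℂ M] : Type where
  act : V →ₗ[ℂ] ℤ → Module.End ℂ M
  trunc : ∀ (u : V) (w : M), ∃ N : ℤ, ∀ n : ℤ, N ≤ n → act u n w = 0
  vacuum_act : ∀ n : ℤ, act A.one n = if n = -1 then (1 : Module.End ℂ M) else 0
  borcherds : ∀ (u v : V) (w : M) (p m n : ℤ),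
    ∑ᶠ i : ℕ, zchoose m i • act (A.Y u (p + i) v) (m + n - i) w
      = ∑ᶠ i : ℕ, ((-1 : ℂ) ^ i * zchoose p i) •
          (act u (m + p - i) (act v (n + i) w)
            - ((-1 : ℂ) ^ p) • act v (n + p - i) (act u (m + i) w))

/-- An admissible (`ℕ`-gradable) module for a vertex operator algebra:
a weak module with an `ℕ`-grading with nonzero top level, compatible with weights. -/
structure AdmMod (A : VOA V) (M : Type) [AddCommGroup M] [Module ℂ M]
    extends WkMod A M : Type where
  gr : ℕ → Submodule ℂ M
  grInternal : DirectSum.IsInternal gr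
  top_ne_bot : gr 0 ≠ ⊥
  gr_mode : ∀ (k : ℤ) (u : V), u ∈ A.wt k → ∀ (m : ℤ) (n : ℕ) (w : M), w ∈ gr n →
    act u m w ∈
      if 0 ≤ (n : ℤ) + k - m - 1 then gr ((n : ℤ) + k - m - 1).toNat else ⊥

/-- An ordinary module for a vertex operator algebra: a weak module on which `L(0)`
acts semisimply with finite dimensional eigenspaces whose weights are truncated from
below in each coset `λ + ℤ`. -/
structure OrdMod (A : VOA V) (M : Type) [AddCommGroup M] [Module ℂ M]
    extends WkMod A M : Type where
  wtm : ℂ → Submodule ℂ M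
  indep : iSupIndep wtm
  spans : ⨆ c : ℂ, wtm c = ⊤
  L0_diag : ∀ (c : ℂ) (w : M), w ∈ wtm c → act A.omega 1 w = c • w
  fdim : ∀ c : ℂ, FiniteDimensional ℂ (wtm c)
  bounded_below : ∀ c : ℂ, ∃ N : ℤ, ∀ m : ℤ, m < N → wtm (c + m) = ⊥

/-- Irreducibility of a weak module. -/
def WkMod.Irreducible {A : VOA V} {M : Type} [AddCommGroup M] [Module ℂ M]
    (P : WkMod A M) : Prop :=
  (∃ w : M, w ≠ 0) ∧
    ∀ U : Submodule ℂ M, (∀ (u : V) (n : ℤ) (w : M), w ∈ U → P.act u n w ∈ U) →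
      U = ⊥ ∨ U = ⊤

/-- Isomorphism of two weak modules over the same vertex operator algebra. -/
def ModIso (A : VOA V) {M N : Type} [AddCommGroup M] [Module ℂ M]
    [AddCommGroup N] [Module ℂ N] (P : WkMod A M) (Q : WkMod A N) : Prop :=
  ∃ f : M ≃ₗ[ℂ] N, ∀ (u : V) (n : ℤ) (w : M), f (P.act u n w) = Q.act u n (f w)

/-- The action of the zero-mode `o(u) = u_{wt u - 1}` (extended linearly from
homogeneous vectors) on a weak module; it preserves the top level of an
admissible module. -/
noncomputable def WkMod.oAct {A : VOA V} {M : Type} [AddCommGroup M] [Module ℂ M]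
    (Q : WkMod A M) (u : V) (w : M) : M :=
  ∑ᶠ k : ℤ, Q.act (A.hcomp k u) (k - 1) w

/-- Action of a word of creation operators `h_{a_1}(-n_1) ⋯ h_{a_k}(-n_k)`. -/
def wordAct {ℓ : ℕ} {M : Type} (f : Fin ℓ → ℤ → M → M) : List (Fin ℓ × ℕ+) → M → M
  | [], w => w
  | (a, n) :: L, w => f a (-((n : ℕ) : ℤ)) (wordAct f L w)

/-- Action of a word of twisted creation operators
`h_{a_1}(-n_1+1/2) ⋯ h_{a_k}(-n_k+1/2)` (indices doubled). -/
def twWordAct {ℓ : ℕ} {M : Type} (f : Fin ℓ → ℤ → M → M) : List (Fin ℓ × ℕ+) → M → M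
  | [], w => w
  | (a, n) :: L, w => f a (-(2 * ((n : ℕ) : ℤ) - 1)) (twWordAct f L w)

/-- `A` is the rank `ℓ` free bosonic (Heisenberg) vertex operator algebra
`𝓗 = M(1)`, with generators `hgen a = h_a(-1)𝟏` for an orthonormal basis
`h_1, …, h_ℓ` of `𝔥`: the generators have weight one, their modes satisfy the
Heisenberg commutation relations `[h_a(m), h_b(n)] = m δ_{ab} δ_{m+n,0}`, the
conformal vector is `ω = (1/2) ∑_a h_a(-1)²𝟏`, and `V` is spanned by the vectors
`h_{a_1}(-n_1) ⋯ h_{a_k}(-n_k)𝟏`. -/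
structure IsHeisenberg {ℓ : ℕ} (A : VOA V) (hgen : Fin ℓ → V) : Prop where
  wt_one : ∀ a, hgen a ∈ A.wt 1
  heis_comm : ∀ (a b : Fin ℓ) (m n : ℤ),
    A.Y (hgen a) m * A.Y (hgen b) n - A.Y (hgen b) n * A.Y (hgen a) m
      = (if a = b ∧ m + n = 0 then (m : ℂ) else 0) • (1 : Module.End ℂ V)
  omega_eq : A.omega
      = (1 / 2 : ℂ) • ∑ a : Fin ℓ, A.Y (hgen a) (-1) (A.Y (hgen a) (-1) A.one)
  span_words : Submodule.span ℂ
      {v : V | ∃ L : List (Fin ℓ × ℕ+),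
        v = wordAct (fun a k w => A.Y (hgen a) k w) L A.one} = ⊤

/-- `θ` is the automorphism of the free bosonic vertex operator algebra induced
by `-1` on `𝔥`. -/
structure IsThetaAut {ℓ : ℕ} (A : VOA V) (hgen : Fin ℓ → V) (θ : V ≃ₗ[ℂ] V) : Prop where
  map_one : θ A.one = A.one
  map_omega : θ A.omega = A.omega
  map_Y : ∀ (u : V) (n : ℤ) (v : V), θ (A.Y u n v) = A.Y (θ u) n (θ v)
  map_gen : ∀ a, θ (hgen a) = -hgen a
  map_wt : ∀ (k : ℤ) (v : V), v ∈ A.wt k → θ v ∈ A.wt k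

/-- `B` (with underlying space `W`, embedded in `V` by `ι`) is the fixed point
vertex operator subalgebra `V^θ` of the involution `θ`. -/
structure IsFixedSubVOA {W : Type} [AddCommGroup W] [Module ℂ W]
    (A : VOA V) (θ : V ≃ₗ[ℂ] V) (B : VOA W) (ι : W →ₗ[ℂ] V) : Prop where
  inj : Function.Injective ι
  range_eq : LinearMap.range ι
      = Module.End.eigenspace (θ.toLinearMap : Module.End ℂ V) 1
  map_one : ι B.one = A.one
  map_omega : ι B.omega = A.omega
  map_Y : ∀ (u : W) (n : ℤ) (v : W), ι (B.Y u n v) = A.Y (ι u) n (ι v)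
  map_wt : ∀ (k : ℤ) (w : W), w ∈ B.wt k ↔ ι w ∈ A.wt k

/-- `P` is (isomorphic to) the Fock module `M(1,λ)` over the rank `ℓ` Heisenberg
vertex operator algebra: it has a nonzero vector `v₀` with `h_a(n)v₀ = 0` for
`n ≥ 1`, `h_a(0)v₀ = λ_a v₀`, which generates `M` under the creation operators. -/
def IsFockModule {ℓ : ℕ} {M : Type} [AddCommGroup M] [Module ℂ M]
    (A : VOA V) (hgen : Fin ℓ → V) (P : WkMod A M) (lam : Fin ℓ → ℂ) : Prop :=
  ∃ v0 : M, v0 ≠ 0 ∧ (∀ (a : Fin ℓ) (n : ℤ), 1 ≤ n → P.act (hgen a) n v0 = 0) ∧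
    (∀ a : Fin ℓ, P.act (hgen a) 0 v0 = lam a • v0) ∧
    Submodule.span ℂ {w : M | ∃ L : List (Fin ℓ × ℕ+),
      w = wordAct (fun a k x => P.act (hgen a) k x) L v0} = ⊤

/-- A weak `θ`-twisted module (for an involution `θ`): the modes are indexed by
`(1/2)ℤ`, encoded here by doubling (so `act u k` is the mode `u_{k/2}`); on the
eigenspace `θ = (-1)^r` only modes with `k ≡ r (mod 2)` act, and the component
form of the twisted Jacobi identity holds. -/
structure TwMod (A : VOA V) (θ : V ≃ₗ[ℂ] V) (M : Type) [AddCommGroup M]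
    [Module ℂ M] : Type where
  act : V →ₗ[ℂ] ℤ → Module.End ℂ M
  trunc : ∀ (u : V) (w : M), ∃ N : ℤ, ∀ n : ℤ, N ≤ n → act u n w = 0
  vacuum_act : ∀ n : ℤ, act A.one n = if n = -2 then (1 : Module.End ℂ M) else 0
  moding : ∀ (u : V) (r : ℤ), θ u = ((-1 : ℂ) ^ r) • u →
    ∀ k : ℤ, (k - r) % 2 ≠ 0 → act u k = 0
  borcherds : ∀ (u v : V) (r s : ℤ), θ u = ((-1 : ℂ) ^ r) • u →
    θ v = ((-1 : ℂ) ^ s) • v → ∀ (w : M) (p K N : ℤ),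
    ∑ᶠ i : ℕ, ((qchoose ((K : ℚ) / 2) i : ℚ) : ℂ) • act (A.Y u (p + i) v) (K + N - 2 * i) w
      = ∑ᶠ i : ℕ, ((-1 : ℂ) ^ i * zchoose p i) •
          (act u (K + 2 * p - 2 * i) (act v (N + 2 * i) w)
            - ((-1 : ℂ) ^ p) • act v (N + 2 * p - 2 * i) (act u (K + 2 * i) w))

/-- Irreducibility of a twisted module. -/
def TwMod.Irreducible {A : VOA V} {θ : V ≃ₗ[ℂ] V} {M : Type} [AddCommGroup M]
    [Module ℂ M] (T : TwMod A θ M) : Prop :=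
  (∃ w : M, w ≠ 0) ∧
    ∀ U : Submodule ℂ M, (∀ (u : V) (k : ℤ) (w : M), w ∈ U → T.act u k w ∈ U) →
      U = ⊥ ∨ U = ⊤

/-- `T` is (isomorphic to) the canonical irreducible `θ`-twisted module
`𝓗(θ) = S(𝔥 ⊗ t^{-1/2}ℂ[t^{-1/2}])` of the rank `ℓ` free bosonic vertex operator
algebra: it has a nonzero vector killed by all modes `h_a(k/2)`, `k ≥ 1`, which
generates it under the twisted creation operators. -/
def IsCanonicalTwMod {ℓ : ℕ} {M : Type} [AddCommGroup M] [Module ℂ M]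
    (A : VOA V) (hgen : Fin ℓ → V) {θ : V ≃ₗ[ℂ] V} (T : TwMod A θ M) : Prop :=
  ∃ v0 : M, v0 ≠ 0 ∧ (∀ (a : Fin ℓ) (k : ℤ), 1 ≤ k → T.act (hgen a) k v0 = 0) ∧
    Submodule.span ℂ {w : M | ∃ L : List (Fin ℓ × ℕ+),
      w = twWordAct (fun a k x => T.act (hgen a) k x) L v0} = ⊤

/-- `σ` is the canonical involution of the twisted module `𝓗(θ)` (acting by
`(-1)^k` on monomials of length `k`): it is an involution compatible with `θ`
through the twisted action and fixing the lowest weight vectors. -/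
def TwInvolution {ℓ : ℕ} {M : Type} [AddCommGroup M] [Module ℂ M]
    (A : VOA V) (hgen : Fin ℓ → V) {θ : V ≃ₗ[ℂ] V} (T : TwMod A θ M)
    (σ : M ≃ₗ[ℂ] M) : Prop :=
  (∀ w : M, σ (σ w) = w) ∧
  (∀ (u : V) (k : ℤ) (w : M), σ (T.act u k w) = T.act (θ u) k (σ w)) ∧
  (∀ v0 : M, (∀ (a : Fin ℓ) (k : ℤ), 1 ≤ k → T.act (hgen a) k v0 = 0) → σ v0 = v0)

/-- The weak `B = V^θ`-module `Q` "is" the eigenspace `V^{(ε)}` of `θ` on `V`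
(e.g. `𝓗⁺` itself for `ε = 1` and `𝓗⁻` for `ε = -1`), with action obtained by
restricting the vertex operators of `V`. -/
def IsEigenPartModule {W N : Type} [AddCommGroup W] [Module ℂ W]
    [AddCommGroup N] [Module ℂ N] (A : VOA V) (θ : V ≃ₗ[ℂ] V) {B : VOA W}
    (ι : W →ₗ[ℂ] V) (ε : ℂ) (Q : WkMod B N) : Prop :=
  ∃ j : N →ₗ[ℂ] V, Function.Injective j ∧
    LinearMap.range j = Module.End.eigenspace (θ.toLinearMap : Module.End ℂ V) ε ∧
    ∀ (u : W) (n : ℤ) (w : N), j (Q.act u n w) = A.Y (ι u) n (j w)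

/-- The weak `B = V^θ`-module `Q` "is" the eigenspace `𝓗(θ)^{(ε)}` of the
involution `σ` on the twisted module `𝓗(θ)`, with the restricted twisted action
(`u ∈ V^θ` acts by its integral modes). -/
def IsTwEigenPartModule {W MT N : Type} [AddCommGroup W] [Module ℂ W]
    [AddCommGroup MT] [Module ℂ MT] [AddCommGroup N] [Module ℂ N]
    (A : VOA V) {θ : V ≃ₗ[ℂ] V} {B : VOA W} (ι : W →ₗ[ℂ] V)
    (T : TwMod A θ MT) (σ : MT ≃ₗ[ℂ] MT) (ε : ℂ) (Q : WkMod B N) : Prop :=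
  ∃ j : N →ₗ[ℂ] MT, Function.Injective j ∧
    LinearMap.range j = Module.End.eigenspace (σ.toLinearMap : Module.End ℂ MT) ε ∧
    ∀ (u : W) (n : ℤ) (w : N), j (Q.act u n w) = T.act (ι u) (2 * n) (j w)

/-- The weak `B = 𝓗⁺`-module `Q` "is" the restriction to `𝓗⁺` of the Fock module
`M(1,λ)`. -/
def IsFockRestriction {ℓ : ℕ} {W N : Type} [AddCommGroup W] [Module ℂ W]
    [AddCommGroup N] [Module ℂ N] (A : VOA V) (hgen : Fin ℓ → V) {B : VOA W}
    (ι : W →ₗ[ℂ] V) (lam : Fin ℓ → ℂ) (Q : WkMod B N) : Prop :=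
  ∃ P : WkMod A N, IsFockModule A hgen P lam ∧
    ∀ (u : W) (n : ℤ), Q.act u n = P.act (ι u) n

/-- A realization of Zhu's algebra `A(V) = V/O(V)` of a vertex operator algebra
as an abstract associative `ℂ`-algebra `R`. -/
structure ZhuRealization (A : VOA V) (R : Type) [Ring R] [Algebra ℂ R] : Type where
  π : V →ₗ[ℂ] R
  surj : Function.Surjective π
  ker_eq : LinearMap.ker π = A.Osub
  map_star : ∀ u v : V, π (A.star u v) = π u * π v
  map_one : π A.one = 1

/-- The `R = A(V)`-module `M` "is" the top level `N(0)` of the admissible module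
`N`, where `[u] ∈ A(V)` acts on the top level by the zero-mode `o(u)`. -/
def IsTopLevelOf {R : Type} [Ring R] [Algebra ℂ R] {A : VOA V}
    (Z : ZhuRealization A R) {N : Type} [AddCommGroup N] [Module ℂ N]
    (Qa : AdmMod A N) (M : Type) [AddCommGroup M] [Module R M] : Prop :=
  ∃ f : M →+ N, Function.Injective f ∧ (∀ m : M, f m ∈ Qa.gr 0) ∧
    (∀ w ∈ Qa.gr 0, ∃ m : M, f m = w) ∧
    ∀ (u : V) (m : M), f (Z.π u • m) = Qa.toWkMod.oAct u (f m)

/-- Iterated Zhu product of a list of elements (an empty product is `[𝟏]`). -/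
noncomputable def starList (A : VOA V) : List V → V
  | [] => A.one
  | x :: L => A.star x (starList A L)

/-- The linear span of all Zhu-monomials in a set of generators; modulo `O(V)`
this is the subalgebra of `A(V)` generated by the images of the generators. -/
def genMonomials (A : VOA V) (gens : Set V) : Submodule ℂ V :=
  Submodule.span ℂ {w : V | ∃ L : List V, (∀ g ∈ L, g ∈ gens) ∧ w = starList A L}

/-- The subspace `𝓦^α ⊆ 𝓗` spanned by the monomials
`h_{a_1}(-n_1) ⋯ h_{a_k}(-n_k)𝟏` whose number of letters from `𝓗_c` is odd
exactly for `c ∈ α`; thus `wordSpanV A hgen ∅ = 𝓦 = 𝓗₁⁺ ⊗ ⋯ ⊗ 𝓗_ℓ⁺`. -/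
def wordSpanV {ℓ : ℕ} (A : VOA V) (hgen : Fin ℓ → V) (α : Finset (Fin ℓ)) :
    Submodule ℂ V :=
  Submodule.span ℂ {v : V | ∃ L : List (Fin ℓ × ℕ+),
    (∀ c : Fin ℓ, c ∈ α ↔ ¬ Even ((L.map Prod.fst).count c)) ∧
    v = wordAct (fun a k w => A.Y (hgen a) k w) L A.one}

/-- The element `S_{ab}(m,n) = h_a(-m)h_b(-n)𝟏` of `𝓗`. -/
def SV {ℓ : ℕ} (A : VOA V) (hgen : Fin ℓ → V) (a b : Fin ℓ) (m n : ℤ) : V :=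
  A.Y (hgen a) (-m) (A.Y (hgen b) (-n) A.one)

/-- The element `ω_a = (1/2) h_a(-1)²𝟏` of `𝓗⁺`. -/
def omegaV {ℓ : ℕ} (A : VOA V) (hgen : Fin ℓ → V) (a : Fin ℓ) : V :=
  (1 / 2 : ℂ) • SV A hgen a a 1 1

/-- The element `J_a = h_a(-1)⁴𝟏 - 2h_a(-3)h_a(-1)𝟏 + (3/2)h_a(-2)²𝟏` of `𝓗⁺`. -/
def JV {ℓ : ℕ} (A : VOA V) (hgen : Fin ℓ → V) (a : Fin ℓ) : V :=
  A.Y (hgen a) (-1) (A.Y (hgen a) (-1) (A.Y (hgen a) (-1) (A.Y (hgen a) (-1) A.one)))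
    - (2 : ℂ) • SV A hgen a a 3 1 + (3 / 2 : ℂ) • SV A hgen a a 2 2

variable {W : Type} [AddCommGroup W] [Module ℂ W]

/-- `E^u_{ab}` (for `a ≠ b`), as a combination of the `S_{ab}(1,m)`. -/
def EuW {ℓ : ℕ} (s : Fin ℓ → Fin ℓ → ℤ → ℤ → W) (a b : Fin ℓ) : W :=
  (5 : ℂ) • s a b 1 2 + (25 : ℂ) • s a b 1 3 + (36 : ℂ) • s a b 1 4 + (16 : ℂ) • s a b 1 5

/-- `E^t_{ab}` (for `a ≠ b`), as a combination of the `S_{ab}(1,m)`. -/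
def EtW {ℓ : ℕ} (s : Fin ℓ → Fin ℓ → ℤ → ℤ → W) (a b : Fin ℓ) : W :=
  (-16 : ℂ) • ((3 : ℂ) • s a b 1 2 + (14 : ℂ) • s a b 1 3 + (19 : ℂ) • s a b 1 4
    + (8 : ℂ) • s a b 1 5)

/-- `Λ_{ab}` (for `a ≠ b`), as a combination of the `S_{ab}(1,m)`. -/
def LamW {ℓ : ℕ} (s : Fin ℓ → Fin ℓ → ℤ → ℤ → W) (a b : Fin ℓ) : W :=
  (45 : ℂ) • s a b 1 2 + (190 : ℂ) • s a b 1 3 + (240 : ℂ) • s a b 1 4 + (96 : ℂ) • s a b 1 5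

/-- The full setting of the paper: `A = 𝓗` is the rank `ℓ` free bosonic vertex
operator algebra with Heisenberg generators `hgen`, `θ` is its `-1` involution,
and `B = 𝓗⁺` is the fixed point vertex operator subalgebra, embedded by `ι`. -/
structure HeisenbergPlusSetting (ℓ : ℕ) (V W : Type) [AddCommGroup V] [Module ℂ V]
    [AddCommGroup W] [Module ℂ W] : Type where
  A : VOA V
  hgen : Fin ℓ → V
  heis : IsHeisenberg A hgen
  θ : V ≃ₗ[ℂ] V
  thetaAut : IsThetaAut A hgen θ
  B : VOA W
  ι : W →ₗ[ℂ] V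
  fixedSub : IsFixedSubVOA A θ B ι

/-- Bundled weak module over a vertex operator algebra. -/
structure ARep (A : VOA V) : Type 1 where
  carrier : Type
  [acg : AddCommGroup carrier]
  [mod : Module ℂ carrier]
  str : WkMod A carrier

attribute [instance] ARep.acg ARep.mod

/-- Bundled admissible module over a vertex operator algebra. -/
structure BRep (A : VOA V) : Type 1 where
  carrier : Type
  [acg : AddCommGroup carrier]
  [mod : Module ℂ carrier]
  adm : AdmMod A carrier

attribute [instance] BRep.acg BRep.mod

/-- Bundled twisted module over a vertex operator algebra with involution. -/
structure TwRep (A : VOA V) (θ : V ≃ₗ[ℂ] V) : Type 1 where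
  carrier : Type
  [acg : AddCommGroup carrier]
  [mod : Module ℂ carrier]
  str : TwMod A θ carrier

attribute [instance] TwRep.acg TwRep.mod

end


namespace ZhuAux
open LaurentPolynomial

abbrev LP := LaurentPolynomial ℂ

noncomputable def ofT {E : Type} [AddCommGroup E] [Module ℂ E] (f : ℤ → E) : LP →ₗ[ℂ] E :=
  (Finsupp.linearCombination ℂ f).comp (AddMonoidAlgebra.coeffLinearEquiv ℂ).toLinearMap

lemma ofT_T {E : Type} [AddCommGroup E] [Module ℂ E] (f : ℤ → E) (n : ℤ) :
    ofT f (T n) = f n := by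
  change Finsupp.linearCombination ℂ f (Finsupp.single n 1) = _
  rw [Finsupp.linearCombination_single, one_smul]

lemma lp_ind {p : LP → Prop} (f : LP) (hadd : ∀ f g, p f → p g → p (f + g))
    (hsmul : ∀ (c : ℂ) f, p f → p (c • f)) (hT : ∀ n, p (T n)) : p f := by
  induction f using LaurentPolynomial.induction_on' with
  | add f g hf hg => exact hadd _ _ hf hg
  | C_mul_T n a => rw [← smul_eq_C_mul]; exact hsmul _ _ (hT n)

lemma zc_zero (m : ℤ) : zchoose m 0 = 1 := by simp [zchoose, qchoose]

lemma zc_succ (m : ℤ) (n : ℕ) :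
    zchoose m (n + 1) = zchoose m n * ((m : ℂ) - n) / (n + 1) := by
  simp [zchoose, qchoose]

lemma zc_one (m : ℤ) : zchoose m 1 = m := by
  rw [show (1:ℕ) = 0 + 1 from rfl, zc_succ, zc_zero]; simp

lemma zc_succ' (m : ℤ) (n : ℕ) :
    ((n : ℂ) + 1) * zchoose m (n + 1) = zchoose m n * ((m : ℂ) - n) := by
  have : (n : ℂ) + 1 ≠ 0 := by exact_mod_cast Nat.succ_ne_zero n
  rw [zc_succ]; field_simp

/-- Pascal -/
lemma zc_pascal (m : ℤ) (n : ℕ) :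
    zchoose (m + 1) (n + 1) = zchoose m (n + 1) + zchoose m n := by
  induction n with
  | zero => simp [zc_succ, zc_zero]
  | succ n ih =>
    have h1 : (n : ℂ) + 1 ≠ 0 := by exact_mod_cast Nat.succ_ne_zero n
    have h2 : (n : ℂ) + 1 + 1 ≠ 0 := by exact_mod_cast Nat.succ_ne_zero (n+1)
    rw [zc_succ (m+1) (n+1), ih, zc_succ m (n+1), zc_succ m n]
    push_cast
    field_simp
    ring

lemma zc_nat (k i : ℕ) : zchoose (k : ℤ) i = (k.choose i : ℂ) := by
  induction k generalizing i with
  | zero =>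
    cases i with
    | zero => simp [zc_zero]
    | succ i =>
      induction i with
      | zero => simp [zc_one]
      | succ i ih => rw [zc_succ, ih]; simp
  | succ k ih =>
    cases i with
    | zero => simp [zc_zero]
    | succ i =>
      push_cast
      rw [zc_pascal, ih, ih, Nat.choose_succ_succ]; push_cast; ring

lemma zc_zero_succ (i : ℕ) : zchoose 0 (i+1) = 0 := by
  have := zc_nat 0 (i+1); simpa using this

lemma zc_neg_one (i : ℕ) : zchoose (-1) i = (-1) ^ i := by
  induction i with
  | zero => simp [zc_zero]
  | succ i ih =>
    have h1 : (i : ℂ) + 1 ≠ 0 := by exact_mod_cast Nat.succ_ne_zero i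
    rw [zc_succ, ih]; push_cast; field_simp; ring

/-- reflection: `C(-W, i) = (-1)^i C(W+i-1, i)`. -/
lemma zc_neg (i : ℕ) (w : ℤ) : zchoose (-w) i = (-1) ^ i * zchoose (w + i - 1) i := by
  induction i generalizing w with
  | zero => simp [zc_zero]
  | succ i ih =>
    have e1 : w + ((i + 1 : ℕ) : ℤ) - 1 = (w + i - 1) + 1 := by push_cast; ring
    have h1 : (i : ℂ) + 1 ≠ 0 := by exact_mod_cast Nat.succ_ne_zero i
    rw [e1, zc_pascal, zc_succ, ih, zc_succ]
    push_cast
    field_simp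
    ring

/-- `C(-w, j+1) = -w/(j+1) C(-w-1, j)` -/
lemma zc_shift (j : ℕ) (w : ℤ) :
    ((j : ℂ) + 1) * zchoose (-w) (j + 1) = -(w : ℂ) * zchoose (-(w + 1)) j := by
  induction j generalizing w with
  | zero => simp [zc_one, zc_zero]
  | succ j ih =>
    have h1 : (j : ℂ) + 1 ≠ 0 := by exact_mod_cast Nat.succ_ne_zero j
    have := ih w
    have h2 := zc_succ' (-w) (j+1)
    have h3 := zc_succ' (-(w+1)) j
    push_cast at *
    have : ((j : ℂ) + 1) * ((↑j + 1 + 1) * zchoose (-w) (j + 1 + 1)) =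
       ((j : ℂ) + 1) * (-(w : ℂ) * zchoose (-(w + 1)) (j + 1)) := by
      rw [h2]; linear_combination (-(w:ℂ) - (j+1)) * this + (w:ℂ) * h3
    exact mul_left_cancel₀ h1 this

noncomputable def D (j : ℕ) : LP →ₗ[ℂ] LP := ofT (fun p => zchoose p j • T (p - j))

lemma D_T (j : ℕ) (p : ℤ) : D j (T p) = zchoose p j • T (p - j) := ofT_T _ _

lemma D_zero (f : LP) : D 0 f = f := by
  induction f using lp_ind with
  | hadd f g hf hg => simp [hf, hg]
  | hsmul c f hf => simp [hf]
  | hT n => simp [D_T, zc_zero]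

lemma D_T_mul (j : ℕ) (f : LP) : D (j+1) (T 1 * f) = T 1 * D (j+1) f + D j f := by
  induction f using lp_ind with
  | hadd f g hf hg => simp only [map_add, mul_add, hf, hg]; abel
  | hsmul c f hf => simp only [mul_smul_comm, map_smul, hf, smul_add]
  | hT n =>
    rw [← T_add, D_T, D_T, D_T, add_comm 1 n, zc_pascal, mul_smul_comm, ← T_add, add_smul]
    congr 3 <;> (push_cast; ring)

noncomputable def P (k : ℕ) (m : ℤ) : LP := (1 + T 1) ^ k * T m

lemma P_zero (m : ℤ) : P 0 m = T m := by simp [P]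

lemma P_succ (k : ℕ) (m : ℤ) : P (k+1) m = P k m + P k (m+1) := by
  simp only [P]; rw [add_comm m 1, T_add]; ring

lemma P_succ' (k : ℕ) (m : ℤ) : P (k+1) m = (1 + T 1) * P k m := by
  simp only [P]; ring

lemma P_mul (k l : ℕ) (m n : ℤ) : P k m * P l n = P (k+l) (m+n) := by
  simp only [P, T_add]; ring

lemma D_succ_mul (j : ℕ) (f : LP) : D (j+1) ((1 + T 1) * f) = (1 + T 1) * D (j+1) f + D j f := by
  rw [add_mul, one_mul, map_add, D_T_mul]; ring

lemma D_one_P (k : ℕ) (m : ℤ) :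
    D 1 (P (k+1) m) = ((k : ℂ) + 1) • P k m + (m : ℂ) • P (k+1) (m-1) := by
  induction k with
  | zero =>
    rw [P_succ', P_zero, D_succ_mul, D_zero, D_T, zc_one, P_succ', P_zero]
    simp; abel
  | succ k ih =>
    rw [P_succ', D_succ_mul, D_zero, ih, mul_add, mul_smul_comm, mul_smul_comm, ← P_succ', ← P_succ']
    push_cast
    module

lemma D_P_mem (j k : ℕ) (m : ℤ) :
    D j (P k m) ∈ Submodule.span ℂ
      {g | ∃ i : ℕ, i ≤ j ∧ i ≤ k ∧ g = P (k - i) (m - ((j : ℤ) - i))} := by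
  induction k generalizing j with
  | zero =>
    rw [P_zero, D_T]
    exact Submodule.smul_mem _ _ (Submodule.subset_span ⟨0, by omega, by omega, by simp [P_zero]⟩)
  | succ k ih =>
    cases j with
    | zero =>
      rw [D_zero]
      exact Submodule.subset_span ⟨0, by omega, by omega, by simp⟩
    | succ j =>
      rw [P_succ', D_succ_mul]
      refine Submodule.add_mem _ ?_ ?_
      · have := ih (j+1)
        have h2 := Submodule.mem_map_of_mem (f := LinearMap.mulLeft ℂ (1 + T 1 : LP)) this
        rw [LinearMap.mulLeft_apply] at h2
        refine (Submodule.map_span_le _ _ _).2 ?_ h2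
        rintro _ ⟨i, hi, hik, rfl⟩
        refine Submodule.subset_span ⟨i, by omega, by omega, ?_⟩
        rw [LinearMap.mulLeft_apply, ← P_succ']
        congr 1; omega
      · refine (Submodule.span_le.2 ?_) (ih j)
        rintro _ ⟨i, hi, hik, rfl⟩
        refine Submodule.subset_span ⟨i+1, by omega, by omega, ?_⟩
        congr 1
        · omega
        · push_cast; ring

/-- expand `P` -/
lemma P_expand (k : ℕ) (m : ℤ) :
    P k m = ∑ i ∈ Finset.range (k+1), (k.choose i : ℂ) • T (m + i) := by
  rw [P, add_comm, add_pow, Finset.sum_mul]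
  refine Finset.sum_congr rfl fun i _ => ?_
  have : (T 1 : LP) ^ i = T i := by rw [T_pow]; simp
  rw [this, one_pow, mul_one, smul_eq_C_mul, add_comm m, T_add]
  simp only [map_natCast]
  ring

/-- the collapse identity. -/
lemma P_collapse (k l : ℕ) :
    ∑ j ∈ Finset.range (k+1), ((k.choose j : ℂ) * (-1)^j) • P (k + l - j) ((j:ℤ) - 1) = P l (-1) := by
  have h : ∀ j ∈ Finset.range (k+1), ((k.choose j : ℂ) * (-1)^j) • P (k + l - j) ((j:ℤ) - 1)
      = ((-T 1) ^ j * (1 + T 1) ^ (k - j) * (k.choose j : LP)) * P l (-1) := by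
    intro j hj
    have hj : j ≤ k := by simpa [Nat.lt_succ_iff] using hj
    have : (T 1 : LP) ^ j = T j := by rw [T_pow]; simp
    rw [smul_eq_C_mul, P, P, show k + l - j = (k - j) + l by omega, pow_add, sub_eq_add_neg, T_add, ← this, neg_pow (T 1 : LP)]
    simp only [map_mul, map_natCast, map_pow, map_neg, map_one]
    ring
  rw [Finset.sum_congr rfl h, ← Finset.sum_mul, ← add_pow]
  simp

end ZhuAux


namespace ZhuAux
open LaurentPolynomial

section
variable {V : Type} [AddCommGroup V] [Module ℂ V] (A : VOA V)

noncomputable def M (u : V) : LP →ₗ[ℂ] Module.End ℂ V := ofT (A.Y u)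

lemma M_T (u : V) (n : ℤ) : M A u (T n) = A.Y u n := ofT_T _ _

lemma M_add (u v : V) (f : LP) : M A (u + v) f = M A u f + M A v f := by
  induction f using lp_ind with
  | hadd f g hf hg => simp only [map_add, hf, hg]; abel
  | hsmul c f hf => simp only [map_smul, hf, smul_add]
  | hT n => simp [M_T]

lemma M_smul (c : ℂ) (u : V) (f : LP) : M A (c • u) f = c • M A u f := by
  induction f using lp_ind with
  | hadd f g hf hg => simp only [map_add, hf, hg, smul_add]
  | hsmul c f hf => simp only [map_smul, hf]; rw [smul_comm]
  | hT n => simp [M_T]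

lemma M_zero (f : LP) : M A (0 : V) f = 0 := by
  have := M_smul A (0:ℂ) 0 f
  simpa using this

lemma fin_aux (k : ℕ) (u x : V) (m : ℤ) :
    ∑ᶠ i : ℕ, zchoose k i • A.Y u (m + i) x = M A u (P k m) x := by
  rw [P_expand, map_sum, LinearMap.sum_apply, finsum_eq_sum_of_support_subset (s := Finset.range (k+1))]
  · refine Finset.sum_congr rfl fun i _ => ?_
    rw [map_smul, M_T, LinearMap.smul_apply, zc_nat]
  · intro i hi
    simp only [Finset.coe_range, Set.mem_Iio]
    by_contra h
    apply hi
    simp only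
    rw [zc_nat, Nat.choose_eq_zero_of_lt (by omega)]
    simp

lemma mulAux_eq (k : ℕ) (u x : V) : A.mulAux k u x = M A u (P k (-1)) x := by
  rw [← fin_aux, VOA.mulAux]
  refine finsum_congr fun i => ?_
  rw [add_comm, ← sub_eq_add_neg]

lemma circAux_eq (k : ℕ) (u x : V) : A.circAux k u x = M A u (P k (-2)) x := by
  rw [← fin_aux, VOA.circAux]
  refine finsum_congr fun i => ?_
  rw [add_comm, ← sub_eq_add_neg]

lemma mode_comm (u v x : V) (p q : ℤ) (N : ℕ) (hN : ∀ j : ℕ, N ≤ j → A.Y u j v = 0) :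
    A.Y u p (A.Y v q x) - A.Y v q (A.Y u p x)
      = ∑ j ∈ Finset.range N, zchoose p j • A.Y (A.Y u j v) (p + q - j) x := by
  have h := A.borcherds u v x 0 p q
  rw [finsum_eq_sum_of_support_subset (s := Finset.range N)] at h
  · rw [finsum_eq_single _ 0] at h
    · simp only [zc_zero] at h
      simp only [zero_add, pow_zero, zpow_zero, one_mul, one_smul, Nat.cast_zero, add_zero,
        sub_zero] at h
      exact h.symm
    · intro i hi
      obtain ⟨j, rfl⟩ := Nat.exists_eq_succ_of_ne_zero hi
      rw [Nat.succ_eq_add_one, zc_zero_succ]; simp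
  · intro j hj
    simp only [Finset.coe_range, Set.mem_Iio]
    by_contra hc
    apply hj
    simp only [zero_add]
    rw [hN j (by omega)]; simp

lemma trunc_nat (u v : V) : ∃ N : ℕ, ∀ j : ℕ, N ≤ j → A.Y u j v = 0 := by
  obtain ⟨N, hN⟩ := A.trunc u v
  exact ⟨N.toNat, fun j hj => hN _ (by omega)⟩

lemma M_comm (u v x : V) (f g : LP) (N : ℕ) (hN : ∀ j : ℕ, N ≤ j → A.Y u j v = 0) :
    M A u f (M A v g x) - M A v g (M A u f x)
      = ∑ j ∈ Finset.range N, M A (A.Y u j v) (D j f * g) x := by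
  induction f using lp_ind with
  | hadd f f' hf hg =>
    simp only [map_add, LinearMap.add_apply, add_mul, Finset.sum_add_distrib, ← hf, ← hg]; abel
  | hsmul c f hf => simp only [map_smul, LinearMap.smul_apply, smul_mul_assoc, ← Finset.smul_sum, ← hf, smul_sub]
  | hT p =>
    induction g using lp_ind with
    | hadd f f' hf hg =>
      simp only [map_add, LinearMap.add_apply, mul_add, Finset.sum_add_distrib, ← hf, ← hg]; abel
    | hsmul c f hf => simp only [map_smul, LinearMap.smul_apply, mul_smul_comm, ← Finset.smul_sum, ← hf, smul_sub]
    | hT q =>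
      rw [M_T, M_T, mode_comm A u v x p q N hN]
      refine Finset.sum_congr rfl fun j _ => ?_
      rw [D_T, smul_mul_assoc, ← T_add, map_smul, M_T, LinearMap.smul_apply]
      rw [show p - (j:ℤ) + q = p + q - j by ring]

lemma M_transl (u : V) (f : LP) : M A (A.Y A.omega 0 u) f = - M A u (D 1 f) := by
  induction f using lp_ind with
  | hadd f g hf hg => simp only [map_add, hf, hg]; abel
  | hsmul c f hf => simp only [map_smul, hf, smul_neg]
  | hT n => rw [M_T, A.translation, D_T, map_smul, M_T, zc_one]; simp

lemma omega0_wt (k : ℤ) (u : V) (hu : u ∈ A.wt k) : A.Y A.omega 0 u ∈ A.wt (k+1) := by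
  have := A.mode_wt 2 A.omega A.omega_wt k 0 u hu
  convert this using 2; ring

lemma Z0 (m : ℕ) : ∀ (k : ℕ) (u : V), u ∈ A.wt k → ∀ x,
    M A u (P k (-2 - m)) x ∈ A.Osub := by
  induction m with
  | zero =>
    intro k u hu x
    refine Submodule.subset_span ⟨k, u, x, hu, ?_⟩
    rw [circAux_eq]; simp
  | succ m ih =>
    intro k u hu x
    have h1 := ih (k+1) _ (by exact_mod_cast omega0_wt A k u hu) x
    rw [M_transl, D_one_P, P_succ, map_add, map_smul, map_smul, map_add] at h1
    have h2 := ih k u hu x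
    have e : (-2 - (m : ℤ) - 1) + 1 = -2 - m := by ring
    have e' : -2 - ((m + 1 : ℕ) : ℤ) = -2 - m - 1 := by push_cast; ring
    rw [e] at h1
    rw [e']
    have hne : ((m : ℂ) + 2) ≠ 0 := by exact_mod_cast (by omega : m + 2 ≠ 0)
    have key : M A u (P k (-2 - (m:ℤ) - 1)) x = ((m : ℂ) + 2)⁻¹ •
      ((-(((k : ℂ) + 1) • M A u (P k (-2 - m)) + ((-2 - (m:ℤ) : ℤ) : ℂ) •
        (M A u (P k (-2 - (m:ℤ) - 1)) + M A u (P k (-2 - m))))) x +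
        ((k : ℂ) + 1 - (m + 2)) • M A u (P k (-2 - m)) x) := by
      rw [eq_inv_smul_iff₀ hne]
      simp only [LinearMap.neg_apply, LinearMap.add_apply, LinearMap.smul_apply]
      push_cast
      module
    rw [key]
    exact Submodule.smul_mem _ _ (Submodule.add_mem _ h1 (Submodule.smul_mem _ _ h2))

lemma Z1 (n : ℕ) : ∀ (m k : ℕ), n ≤ m → ∀ (u : V), u ∈ A.wt k → ∀ x,
    M A u (P (k + n) (-2 - m)) x ∈ A.Osub := by
  induction n with
  | zero => intro m k _ u hu x; exact Z0 A m k u hu x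
  | succ n ih =>
    intro m k hnm u hu x
    obtain ⟨m', rfl⟩ : ∃ m', m = m' + 1 := ⟨m - 1, by omega⟩
    rw [← add_assoc, P_succ, map_add, LinearMap.add_apply]
    refine Submodule.add_mem _ (ih _ k (by omega) u hu x) ?_
    have := ih m' k (by omega) u hu x
    rwa [show -2 - ((m' + 1 : ℕ) : ℤ) + 1 = -2 - m' by push_cast; ring]

variable (hneg : ∀ n : ℤ, n < 0 → A.wt n = ⊥)
include hneg

/-- general commutator bound. -/
lemma comm_mem (k l : ℕ) (u v x : V) (hu : u ∈ A.wt k) (hv : v ∈ A.wt l) (a b : ℕ) (m m' : ℤ)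
    (h1 : (k : ℤ) + l ≤ a + b + 1) (h2 : (a : ℤ) + b + 1 - k - l ≤ -2 - m - m') :
    M A u (P a m) (M A v (P b m') x) - M A v (P b m') (M A u (P a m) x) ∈ A.Osub := by
  obtain ⟨N, hN⟩ := trunc_nat A u v
  rw [M_comm A u v x _ _ N hN]
  refine Submodule.sum_mem _ fun j _ => ?_
  have hw := A.mode_wt k u hu l j v hv
  by_cases hw0 : (l : ℤ) + k - j - 1 < 0
  · rw [hneg _ hw0, Submodule.mem_bot] at hw
    rw [hw, M_zero]; simp
  · set w := ((l : ℤ) + k - j - 1).toNat with hwd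
    have hw' : A.Y u j v ∈ A.wt (w : ℤ) := by
      convert hw using 2; omega
    let S : Submodule ℂ LP := A.Osub.comap
      (((LinearMap.applyₗ x).comp (M A (A.Y u j v))).comp (LinearMap.mulRight ℂ (P b m')))
    have : Submodule.span ℂ {g | ∃ i : ℕ, i ≤ j ∧ i ≤ a ∧ g = P (a - i) (m - ((j : ℤ) - i))} ≤ S := by
      rw [Submodule.span_le]
      rintro _ ⟨i, hij, hia, rfl⟩
      change M A (A.Y u j v) (P (a - i) (m - ((j : ℤ) - i)) * P b m') x ∈ A.Osub
      rw [P_mul]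
      have := Z1 A (a - i + b - w) (-2 - (m - ((j : ℤ) - i) + m')).toNat w (by omega) _ hw' x
      rwa [show w + (a - i + b - w) = a - i + b by omega,
        show -2 - (((-2 - (m - ((j : ℤ) - i) + m')).toNat : ℕ) : ℤ) = m - ((j : ℤ) - i) + m' by omega]
        at this
    exact this (D_P_mem j a m)

end

end ZhuAux


namespace ZhuAux
open LaurentPolynomial

section
variable {V : Type} [AddCommGroup V] [Module ℂ V] (A : VOA V)

lemma decompose_of (k : ℤ) (u : V) (hu : u ∈ A.wt k) :
    A.decompose u = DirectSum.lof ℂ ℤ (fun n => A.wt n) k ⟨u, hu⟩ := by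
  rw [VOA.decompose, LinearEquiv.symm_apply_eq]
  exact (DirectSum.coeLinearMap_lof A.wt k ⟨u, hu⟩).symm

lemma hcomp_self (k : ℤ) (u : V) (hu : u ∈ A.wt k) : A.hcomp k u = u := by
  rw [VOA.hcomp, decompose_of A k u hu]
  simp [DirectSum.lof_eq_of]

lemma hcomp_ne (k j : ℤ) (h : j ≠ k) (u : V) (hu : u ∈ A.wt k) : A.hcomp j u = 0 := by
  rw [VOA.hcomp, decompose_of A k u hu, DirectSum.lof_eq_of, DirectSum.of_eq_of_ne _ _ _ h]
  simp

lemma hcomp_add (k : ℤ) (u v : V) : A.hcomp k (u + v) = A.hcomp k u + A.hcomp k v := by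
  simp [VOA.hcomp]

lemma hcomp_smul (k : ℤ) (c : ℂ) (u : V) : A.hcomp k (c • u) = c • A.hcomp k u := by
  simp [VOA.hcomp, DirectSum.smul_apply]

lemma hcomp_mem (k : ℤ) (u : V) : A.hcomp k u ∈ A.wt k := (A.decompose u k).2

lemma hcomp_fin (u : V) : {k | A.hcomp k u ≠ 0}.Finite := by
  classical
  refine (DFinsupp.support (A.decompose u)).finite_toSet.subset ?_
  intro k hk
  simp only [Finset.mem_coe, DFinsupp.mem_support_iff]
  intro h
  apply hk
  simp [VOA.hcomp, h]

lemma wt_ind {p : V → Prop} (u : V) (h0 : p 0) (hadd : ∀ u v, p u → p v → p (u + v))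
    (hw : ∀ k, ∀ u ∈ A.wt k, p u) : p u := by
  have : u ∈ ⨆ k, A.wt k := by rw [A.internal.submodule_iSup_eq_top]; trivial
  exact Submodule.iSup_induction (p := A.wt) (motive := p) this hw h0 hadd

lemma mulAux_zero (k : ℤ) (v : V) : A.mulAux k 0 v = 0 := by
  simp [VOA.mulAux]

variable (hneg : ∀ n : ℤ, n < 0 → A.wt n = ⊥)
include hneg

lemma star_eq (u v : V) :
    A.star u v = ∑ᶠ k : ℤ, M A (A.hcomp k u) (P k.toNat (-1)) v := by
  refine finsum_congr fun k => ?_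
  by_cases hk : k < 0
  · have := hcomp_mem A k u
    rw [hneg k hk, Submodule.mem_bot] at this
    rw [this, mulAux_zero, M_zero]; rfl
  · obtain ⟨n, rfl⟩ : ∃ n : ℕ, k = n := ⟨k.toNat, by omega⟩
    rw [mulAux_eq]; rfl

lemma supp_fin (u v : V) :
    (Function.support fun k : ℤ => M A (A.hcomp k u) (P k.toNat (-1)) v).Finite := by
  refine (hcomp_fin A u).subset ?_
  intro k hk h
  apply hk
  change M A (A.hcomp k u) (P k.toNat (-1)) v = 0
  rw [h, M_zero]; rfl

lemma star_hom (k : ℕ) (u v : V) (hu : u ∈ A.wt k) : A.star u v = M A u (P k (-1)) v := by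
  rw [star_eq A hneg, finsum_eq_single _ (k : ℤ), hcomp_self A k u hu]
  · rfl
  · intro j hj
    rw [hcomp_ne A k j hj u hu, M_zero]; rfl

lemma star_add_left (u u' v : V) : A.star (u + u') v = A.star u v + A.star u' v := by
  simp only [star_eq A hneg]
  rw [← finsum_add_distrib (supp_fin A hneg u v) (supp_fin A hneg u' v)]
  refine finsum_congr fun k => ?_
  rw [hcomp_add, M_add]; rfl

lemma star_smul_left (c : ℂ) (u v : V) : A.star (c • u) v = c • A.star u v := by
  simp only [star_eq A hneg]
  rw [smul_finsum]
  refine finsum_congr fun k => ?_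
  rw [hcomp_smul, M_smul]; rfl

lemma star_add_right (u v v' : V) : A.star u (v + v') = A.star u v + A.star u v' := by
  simp only [star_eq A hneg]
  rw [← finsum_add_distrib (supp_fin A hneg u v) (supp_fin A hneg u v')]
  refine finsum_congr fun k => ?_
  rw [map_add]

lemma star_smul_right (c : ℂ) (u v : V) : A.star u (c • v) = c • A.star u v := by
  simp only [star_eq A hneg]
  rw [smul_finsum]
  refine finsum_congr fun k => ?_
  rw [map_smul]

noncomputable def starL : V →ₗ[ℂ] V →ₗ[ℂ] V :=
  LinearMap.mk₂ ℂ A.star (star_add_left A hneg) (star_smul_left A hneg)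
    (star_add_right A hneg) (star_smul_right A hneg)

omit hneg in
lemma omega0_create (x : V) : A.Y A.omega 0 x = A.Y x (-2) A.one := by
  have := A.translation x (-1)
  have h2 := congrArg (fun f : Module.End ℂ V => f A.one) this
  simp only [LinearMap.smul_apply] at h2
  rw [A.create] at h2
  rw [h2]; norm_num

omit hneg in
lemma omega0_mod (w : ℕ) (x : V) (hx : x ∈ A.wt w) : A.Y A.omega 0 x + (w : ℂ) • x ∈ A.Osub := by
  have : A.circAux w x A.one ∈ A.Osub := Submodule.subset_span ⟨w, x, A.one, hx, rfl⟩
  rw [circAux_eq, ← fin_aux, finsum_eq_sum_of_support_subset (s := Finset.range 2)] at this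
  · rw [Finset.sum_range_succ, Finset.sum_range_one, zc_zero, zc_one] at this
    rw [omega0_create]
    convert this using 2
    · simp
    · norm_num [A.create]
  · intro i hi
    simp only [Finset.coe_range, Set.mem_Iio]
    by_contra h
    apply hi
    simp only
    rw [A.create_ge _ _ (by omega)]; simp

omit hneg in
lemma create_mod (j : ℕ) : ∀ (w : ℕ) (x : V), x ∈ A.wt w →
    A.Y x (-1 - j) A.one - zchoose (-(w:ℤ)) j • x ∈ A.Osub := by
  induction j with
  | zero => intro w x hx; simp [A.create, zc_zero]
  | succ j ih =>
    intro w x hx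
    have h1 := ih (w+1) _ (by exact_mod_cast omega0_wt A w x hx)
    have h2 := omega0_mod A w x hx
    have e : A.Y (A.Y A.omega 0 x) (-1 - j) A.one = ((j : ℂ) + 1) • A.Y x (-1 - ((j+1 : ℕ):ℤ)) A.one := by
      rw [A.translation]
      rw [LinearMap.smul_apply, show (-1 - (j:ℤ) - 1) = -1 - ((j+1 : ℕ):ℤ) by push_cast; ring]
      congr 1; push_cast; ring
    have hne : ((j : ℂ) + 1) ≠ 0 := by exact_mod_cast Nat.succ_ne_zero j
    have sh := zc_shift j (w : ℤ)
    have key : A.Y x (-1 - ((j+1 : ℕ):ℤ)) A.one - zchoose (-(w:ℤ)) (j+1) • x =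
      ((j : ℂ) + 1)⁻¹ • ((A.Y (A.Y A.omega 0 x) (-1 - j) A.one - zchoose (-((w+1 : ℕ):ℤ)) j • A.Y A.omega 0 x)
        + zchoose (-((w+1 : ℕ):ℤ)) j • (A.Y A.omega 0 x + (w : ℂ) • x)) := by
      rw [eq_inv_smul_iff₀ hne, e, smul_sub, smul_smul, sh]
      push_cast
      module
    rw [key]
    exact Submodule.smul_mem _ _ (Submodule.add_mem _ h1 (Submodule.smul_mem _ _ h2))

omit hneg in
lemma skew (u v : V) (p : ℤ) (N : ℕ) (hN : ∀ i : ℕ, N ≤ i → A.Y u (p+i) v = 0) :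
    A.Y v p u = (-1 : ℂ)^(p+1) • ∑ i ∈ Finset.range N,
      (-1 : ℂ)^i • A.Y (A.Y u (p + i) v) (-1 - i) A.one := by
  have h := A.borcherds u v A.one p (-1) 0
  rw [finsum_eq_sum_of_support_subset (s := Finset.range N), finsum_eq_single _ 0] at h
  · simp only [zc_zero, A.create_ge v _ le_rfl] at h
    simp only [zc_neg_one, add_zero, Nat.cast_zero, A.create, pow_zero, one_mul, one_smul, map_zero,
      zero_sub, sub_zero] at h
    rw [A.create_ge v 0 le_rfl] at h
    rw [h, zero_add, map_zero, zero_sub, smul_neg, smul_smul, ← zpow_add₀ (by norm_num)]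
    rw [show p + 1 + p = 2 * p + 1 by ring, zpow_add₀ (by norm_num), zpow_mul]
    simp
  · intro i hi
    rw [A.create_ge v _ (by omega), A.create_ge u _ (by omega)]; simp
  · intro j hj
    simp only [Finset.coe_range, Set.mem_Iio]
    by_contra hc
    apply hj
    simp only
    rw [hN j (by omega)]; simp

omit hneg in
lemma trunc_nat' (u v : V) (p : ℤ) : ∃ N : ℕ, ∀ j : ℕ, N ≤ j → A.Y u (p + j) v = 0 := by
  obtain ⟨N, hN⟩ := A.trunc u v
  exact ⟨(N - p).toNat, fun j hj => hN _ (by omega)⟩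

lemma skew_mod (k l s : ℕ) (a b : V) (ha : a ∈ A.wt k) (hb : b ∈ A.wt l) (p : ℤ)
    (hs : (s : ℤ) = k + l - p - 2) :
    A.Y a p b - (-1 : ℂ)^(p+1) • M A b (P s p) a ∈ A.Osub := by
  obtain ⟨N, hN⟩ := trunc_nat' A b a p
  rw [skew A b a p N hN, ← fin_aux, finsum_eq_sum_of_support_subset (s := Finset.range N),
    ← smul_sub, ← Finset.sum_sub_distrib]
  · refine Submodule.smul_mem _ _ (Submodule.sum_mem _ fun i _ => ?_)
    have hw := A.mode_wt l b hb k (p+i) a ha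
    by_cases hw0 : (k : ℤ) + l - (p + i) - 1 < 0
    · rw [hneg _ hw0, Submodule.mem_bot] at hw
      rw [hw]; simp
    · set w := ((k : ℤ) + l - (p+i) - 1).toNat with hwd
      have hww : (w : ℤ) = (k : ℤ) + l - (p+i) - 1 := by omega
      rw [← hww] at hw
      have h1 := create_mod A i w _ hw
      have e : zchoose (s : ℤ) i = (-1)^i * zchoose (-(w:ℤ)) i := by
        rw [zc_neg, ← mul_assoc, ← mul_pow, show (w : ℤ) + i - 1 = s by omega]; norm_num
      rw [e, mul_smul, ← smul_sub]
      exact Submodule.smul_mem _ _ h1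
  · intro j hj
    simp only [Finset.coe_range, Set.mem_Iio]
    by_contra hc
    apply hj
    simp only
    rw [hN j (by omega)]; simp

lemma star_mod_hom (k l : ℕ) (a b : V) (ha : a ∈ A.wt k) (hb : b ∈ A.wt ((l + 1 : ℕ) : ℤ)) :
    A.star a b - M A b (P l (-1)) a ∈ A.Osub := by
  rw [star_hom A hneg k a b ha, P_expand, ← P_collapse k l, map_sum, map_sum, LinearMap.sum_apply,
    LinearMap.sum_apply, ← Finset.sum_sub_distrib]
  refine Submodule.sum_mem _ fun j hj => ?_
  have hj : j ≤ k := by simpa [Nat.lt_succ_iff] using hj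
  have := skew_mod A hneg k (l+1) (k + l - j) a b ha hb (-1 + j) (by push_cast; omega)
  rw [map_smul, map_smul, LinearMap.smul_apply, LinearMap.smul_apply, M_T, mul_smul, ← smul_sub]
  refine Submodule.smul_mem _ _ ?_
  rw [show -1 + (j:ℤ) + 1 = j by ring, zpow_natCast] at this
  rwa [show (j:ℤ) - 1 = -1 + j by ring]

lemma star_mod (l : ℕ) (a b : V) (hb : b ∈ A.wt ((l + 1 : ℕ) : ℤ)) :
    A.star a b - M A b (P l (-1)) a ∈ A.Osub := by
  induction a using wt_ind A with
  | h0 =>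
    have := star_smul_left A hneg 0 0 b
    rw [zero_smul, zero_smul] at this
    simp [this]
  | hadd u v hu hv =>
    rw [star_add_left A hneg, map_add, add_sub_add_comm]
    exact Submodule.add_mem _ hu hv
  | hw k u hu =>
    by_cases hk : k < 0
    · rw [hneg k hk, Submodule.mem_bot] at hu
      have := star_smul_left A hneg 0 0 b
      rw [zero_smul, zero_smul] at this
      simp [hu, this]
    · obtain ⟨n, rfl⟩ : ∃ n : ℕ, k = n := ⟨k.toNat, by omega⟩
      exact star_mod_hom A hneg n l u b hu hb

lemma star_one (a : V) : A.star a A.one = a := by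
  induction a using wt_ind A with
  | h0 =>
    have := star_smul_left A hneg 0 0 A.one
    rwa [zero_smul, zero_smul] at this
  | hadd u v hu hv =>
    rw [star_add_left A hneg, hu, hv]
  | hw k u hu =>
    by_cases hk : k < 0
    · rw [hneg k hk, Submodule.mem_bot] at hu
      have := star_smul_left A hneg 0 0 A.one
      rw [zero_smul, zero_smul] at this
      simp [hu, this]
    · obtain ⟨n, rfl⟩ : ∃ n : ℕ, k = n := ⟨k.toNat, by omega⟩
      rw [star_hom A hneg n _ _ hu, ← fin_aux, finsum_eq_single _ 0]
      · simp [zc_zero, A.create]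
      · intro i hi
        rw [A.create_ge _ _ (by omega)]; simp

lemma one_star (a : V) : A.star A.one a = a := by
  rw [star_hom A hneg 0 _ _ (by exact_mod_cast A.one_wt), P_zero, M_T, A.vacuum_act]; simp

omit hneg in
lemma O_ind (f : V →ₗ[ℂ] V) (h : ∀ (k : ℤ) (u v : V), u ∈ A.wt k → f (A.circAux k u v) ∈ A.Osub)
    (z : V) (hz : z ∈ A.Osub) : f z ∈ A.Osub := by
  have : A.Osub ≤ A.Osub.comap f := by
    conv_lhs => rw [VOA.Osub]
    rw [Submodule.span_le]
    rintro _ ⟨k, u, v, hu, rfl⟩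
    exact h k u v hu
  exact this hz

lemma circ_neg (k : ℤ) (hk : k < 0) (u v : V) (hu : u ∈ A.wt k) : A.circAux k u v = 0 := by
  rw [hneg k hk, Submodule.mem_bot] at hu
  simp [hu, VOA.circAux]

lemma O_op (k : ℕ) (u : V) (hu : u ∈ A.wt k) (a : ℕ) (h1 : (k : ℤ) ≤ a + 1) (h2 : a ≤ k)
    (z : V) (hz : z ∈ A.Osub) : M A u (P a (-1)) z ∈ A.Osub := by
  refine O_ind A (M A u (P a (-1))) ?_ z hz
  intro l v y hv
  by_cases hl : l < 0
  · rw [circ_neg A hneg l hl v y hv]; simp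
  · obtain ⟨n, rfl⟩ : ∃ n : ℕ, l = n := ⟨l.toNat, by omega⟩
    have h := comm_mem A hneg k n u v y hu hv a n (-1) (-2) (by omega) (by omega)
    rw [circAux_eq]
    have h3 : M A v (P n (-2)) (M A u (P a (-1)) y) ∈ A.Osub := by
      rw [← circAux_eq]; exact Submodule.subset_span ⟨n, v, _, hv, rfl⟩
    simpa using Submodule.add_mem _ h h3

lemma star_O_right (a z : V) (hz : z ∈ A.Osub) : A.star a z ∈ A.Osub := by
  induction a using wt_ind A with
  | h0 =>
    have := star_smul_left A hneg 0 0 z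
    rw [zero_smul, zero_smul] at this
    simp [this]
  | hadd u v hu hv => rw [star_add_left A hneg]; exact Submodule.add_mem _ hu hv
  | hw k u hu =>
    by_cases hk : k < 0
    · rw [hneg k hk, Submodule.mem_bot] at hu
      have := star_smul_left A hneg 0 0 z
      rw [zero_smul, zero_smul] at this
      simp [hu, this]
    · obtain ⟨n, rfl⟩ : ∃ n : ℕ, k = n := ⟨k.toNat, by omega⟩
      rw [star_hom A hneg n _ _ hu]
      exact O_op A hneg n u hu n (by omega) le_rfl z hz

variable (h0 : ∀ u ∈ A.wt 0, ∃ c : ℂ, u = c • A.one)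
include h0

lemma wt_ind' {p : V → Prop} (u : V) (hadd : ∀ u v, p u → p v → p (u + v))
    (hone : ∀ c : ℂ, p (c • A.one))
    (hw : ∀ k : ℕ, ∀ u ∈ A.wt ((k+1 : ℕ) : ℤ), p u) : p u := by
  induction u using wt_ind A with
  | h0 => simpa using hone 0
  | hadd u v hu hv => exact hadd u v hu hv
  | hw k u hu =>
    by_cases hk : k < 0
    · rw [hneg k hk, Submodule.mem_bot] at hu
      subst hu; simpa using hone 0
    · by_cases hk0 : k = 0
      · subst hk0; obtain ⟨c, rfl⟩ := h0 u hu; exact hone c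
      · obtain ⟨n, rfl⟩ : ∃ n : ℕ, k = ((n+1 : ℕ) : ℤ) := ⟨k.toNat - 1, by omega⟩
        exact hw n u hu

lemma star_O_left (z b : V) (hz : z ∈ A.Osub) : A.star z b ∈ A.Osub := by
  induction b using wt_ind' A hneg h0 with
  | hadd u v hu hv => rw [star_add_right A hneg]; exact Submodule.add_mem _ hu hv
  | hone c => rw [star_smul_right A hneg, star_one A hneg]; exact Submodule.smul_mem _ _ hz
  | hw k u hu =>
    have h1 := star_mod A hneg k z u hu
    have h2 := O_op A hneg (k+1) u hu k (by push_cast; omega) (by omega) z hz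
    simpa using Submodule.add_mem _ h1 h2

lemma star_assoc_mod (a b c : V) :
    A.star (A.star a b) c - A.star a (A.star b c) ∈ A.Osub := by
  induction c using wt_ind' A hneg h0 with
  | hadd u v hu hv =>
    rw [star_add_right A hneg, star_add_right A hneg, star_add_right A hneg, add_sub_add_comm]
    exact Submodule.add_mem _ hu hv
  | hone c => simp [star_smul_right A hneg, star_one A hneg]
  | hw l c hc =>
    have h1 := star_mod A hneg l (A.star a b) c hc
    have h2 := star_O_right A hneg a _ (star_mod A hneg l b c hc)
    have h3 : M A c (P l (-1)) (A.star a b) - A.star a (M A c (P l (-1)) b) ∈ A.Osub := by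
      induction a using wt_ind' A hneg h0 with
      | hadd u v hu hv =>
        have e := Submodule.add_mem _ (hu (star_mod A hneg l _ c hc) (star_O_right A hneg u _ (star_mod A hneg l b c hc)))
          (hv (star_mod A hneg l _ c hc) (star_O_right A hneg v _ (star_mod A hneg l b c hc)))
        rw [star_add_left A hneg, star_add_left A hneg, map_add, add_sub_add_comm]
        exact e
      | hone c => simp [star_smul_left A hneg, one_star A hneg]
      | hw k a ha =>
        rw [star_hom A hneg _ _ _ ha, star_hom A hneg _ _ _ ha]
        have := comm_mem A hneg (k+1) (l+1) a c b ha hc (k+1) l (-1) (-1) (by push_cast; omega) (by push_cast; omega)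
        rw [← neg_sub]
        exact Submodule.neg_mem _ this
    have e : A.star a (A.star b c) = A.star a (A.star b c - M A c (P l (-1)) b) + A.star a (M A c (P l (-1)) b) := by
      rw [← star_add_right A hneg]; simp
    have := Submodule.sub_mem _ (Submodule.add_mem _ h1 h3) h2
    rw [e]
    convert this using 1
    abel

/-- The Zhu algebra, as a type. -/
def Q (_ : ∀ n : ℤ, n < 0 → A.wt n = ⊥) (_ : ∀ u ∈ A.wt 0, ∃ c : ℂ, u = c • A.one) : Type :=
  V ⧸ A.Osub

noncomputable instance : AddCommGroup (Q A hneg h0) := inferInstanceAs (AddCommGroup (V ⧸ A.Osub))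
noncomputable instance : Module ℂ (Q A hneg h0) := inferInstanceAs (Module ℂ (V ⧸ A.Osub))

noncomputable def toQ : V →ₗ[ℂ] Q A hneg h0 := A.Osub.mkQ

lemma toQ_surj : Function.Surjective (toQ A hneg h0) := Submodule.mkQ_surjective _

lemma toQ_eq (u v : V) : toQ A hneg h0 u = toQ A hneg h0 v ↔ u - v ∈ A.Osub :=
  Submodule.Quotient.eq A.Osub

noncomputable def mulQ : Q A hneg h0 →ₗ[ℂ] Q A hneg h0 →ₗ[ℂ] Q A hneg h0 :=
  Submodule.liftQ A.Osub
    (LinearMap.flip (Submodule.liftQ A.Osub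
      (LinearMap.flip ((starL A hneg).compr₂ (toQ A hneg h0)))
      (by
        intro z hz
        rw [LinearMap.mem_ker]
        ext a
        change toQ A hneg h0 (A.star a z) = 0
        rw [← map_zero (toQ A hneg h0), toQ_eq, sub_zero]
        exact star_O_right A hneg a z hz)))
    (by
      intro z hz
      rw [LinearMap.mem_ker]
      ext a
      obtain ⟨a, rfl⟩ := toQ_surj A hneg h0 a
      change toQ A hneg h0 (A.star z a) = 0
      rw [← map_zero (toQ A hneg h0), toQ_eq, sub_zero]
      exact star_O_left A hneg h0 z a hz)

lemma mulQ_toQ (u v : V) : mulQ A hneg h0 (toQ A hneg h0 u) (toQ A hneg h0 v)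
    = toQ A hneg h0 (A.star u v) := rfl

noncomputable instance : Ring (Q A hneg h0) :=
  { (inferInstance : AddCommGroup (Q A hneg h0)) with
    mul := fun x y => mulQ A hneg h0 x y
    one := toQ A hneg h0 A.one
    left_distrib := fun x y z => map_add (mulQ A hneg h0 x) y z
    right_distrib := fun x y z => by
      change mulQ A hneg h0 (x+y) z = mulQ A hneg h0 x z + mulQ A hneg h0 y z
      rw [map_add]; rfl
    zero_mul := fun x => by
      change mulQ A hneg h0 0 x = 0
      rw [map_zero]; rfl
    mul_zero := fun x => map_zero (mulQ A hneg h0 x)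
    mul_assoc := fun x y z => by
      obtain ⟨x, rfl⟩ := toQ_surj A hneg h0 x
      obtain ⟨y, rfl⟩ := toQ_surj A hneg h0 y
      obtain ⟨z, rfl⟩ := toQ_surj A hneg h0 z
      change mulQ A hneg h0 (mulQ A hneg h0 _ _) _ = mulQ A hneg h0 _ (mulQ A hneg h0 _ _)
      simp only [mulQ_toQ]
      rw [toQ_eq]
      exact star_assoc_mod A hneg h0 x y z
    one_mul := fun x => by
      obtain ⟨x, rfl⟩ := toQ_surj A hneg h0 x
      change mulQ A hneg h0 (toQ A hneg h0 A.one) _ = _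
      rw [mulQ_toQ, one_star A hneg]
    mul_one := fun x => by
      obtain ⟨x, rfl⟩ := toQ_surj A hneg h0 x
      change mulQ A hneg h0 _ (toQ A hneg h0 A.one) = _
      rw [mulQ_toQ, star_one A hneg] }

noncomputable instance : Algebra ℂ (Q A hneg h0) :=
  Algebra.ofModule
    (fun r x y => by
      change mulQ A hneg h0 (r • x) y = r • mulQ A hneg h0 x y
      rw [map_smul]; rfl)
    (fun r x y => map_smul (mulQ A hneg h0 x) r y)

theorem exists_zhu : ∃ (R : Type) (_ : Ring R) (_ : Algebra ℂ R), Nonempty (ZhuRealization A R) :=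
  ⟨Q A hneg h0, inferInstance, inferInstance, ⟨{
    π := toQ A hneg h0
    surj := toQ_surj A hneg h0
    ker_eq := Submodule.ker_mkQ _
    map_star := fun _ _ => rfl
    map_one := rfl }⟩⟩

end

end ZhuAux


namespace ZhuAux

/-- abstract word data -/
structure WData (ℓ : ℕ) (V R : Type) [AddCommGroup V] [Module ℂ V] [Ring R] [Algebra ℂ R] where
  H : Fin ℓ → ℕ → Module.End ℂ V
  one : V
  comm : ∀ a m b n x, H a m (H b n x) = H b n (H a m x)
  Lo : Fin ℓ → Fin ℓ → Module.End ℂ V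
  Do : Fin ℓ → Fin ℓ → Module.End ℂ V
  Lo_one : ∀ a b, Lo a b one = H a 0 (H b 0 one)
  Do_one : ∀ a b, Do a b one = 0
  Lo_H : ∀ a b c n x, Lo a b (H c n x) = H c n (Lo a b x)
    + (if c = a then ((n : ℂ) + 1) • (H b (n+2) x + (2:ℂ) • H b (n+1) x + H b n x) else 0)
    + (if c = b then ((n : ℂ) + 1) • (H a (n+2) x + (2:ℂ) • H a (n+1) x + H a n x) else 0)
  Do_H : ∀ a b c n x, Do a b (H c n x) = H c n (Do a b x)
    + (if c = a then ((n : ℂ) + 1) • (H b (n+1) x + H b n x) else 0)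
    + (if c = b then ((n : ℂ) + 1) • (H a (n+1) x + H a n x) else 0)
  q : V →ₗ[ℂ] R
  q_one : q one = 1
  q_surj : Function.Surjective q
  mulL : ∀ a b x, q (H a 0 (H b 0 one)) * q x = q (Lo a b x)
  brD : ∀ a b x, q (H a 0 (H b 0 one)) * q x - q x * q (H a 0 (H b 0 one)) = q (Do a b x)
  tot : ∀ x, q (∑ c, Do c c x) = 0
  odd : ∀ a n, q (H a n one) = 0
  span : Submodule.span ℂ {v | ∃ L : List (Fin ℓ × ℕ), v = L.foldr (fun p x => H p.1 p.2 x) one} = ⊤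

abbrev Lam := ℕ →₀ ℂ

noncomputable def e (n : ℕ) : Lam := Finsupp.single n 1

noncomputable def DL : Lam →ₗ[ℂ] Lam :=
  Finsupp.linearCombination ℂ (fun n : ℕ => ((n : ℂ) + 1) • (e (n+1) + e n))

noncomputable def SL : Lam →ₗ[ℂ] Lam :=
  Finsupp.linearCombination ℂ (fun n : ℕ => ((n : ℂ) + 1) • (e (n+2) + (2:ℂ) • e (n+1) + e n))

lemma DL_e (n : ℕ) : DL (e n) = ((n : ℂ) + 1) • (e (n+1) + e n) := by
  simp [DL, e]

lemma SL_e (n : ℕ) : SL (e n) = ((n : ℂ) + 1) • (e (n+2) + (2:ℂ) • e (n+1) + e n) := by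
  simp [SL, e]

lemma lam_ind {p : Lam → Prop} (f : Lam) (hadd : ∀ f g, p f → p g → p (f + g))
    (hsmul : ∀ (c : ℂ) f, p f → p (c • f)) (he : ∀ n, p (e n)) : p f := by
  induction f using Finsupp.induction_linear with
  | zero => simpa using hsmul 0 _ (he 0)
  | add f g hf hg => exact hadd _ _ hf hg
  | single n c =>
    have : Finsupp.single n c = c • e n := by simp [e]
    rw [this]; exact hsmul _ _ (he n)

/-- generation of `Lam` from `e 0` under `DL`. -/
lemma lam_Dind {p : Lam → Prop} (f : Lam) (hadd : ∀ f g, p f → p g → p (f + g))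
    (hsmul : ∀ (c : ℂ) f, p f → p (c • f)) (h0 : p (e 0)) (hD : ∀ f, p f → p (DL f)) : p f := by
  induction f using lam_ind with
  | hadd f g hf hg => exact hadd _ _ hf hg
  | hsmul c f hf => exact hsmul _ _ hf
  | he n =>
    induction n with
    | zero => exact h0
    | succ n ih =>
      have hne : ((n : ℂ) + 1) ≠ 0 := by exact_mod_cast Nat.succ_ne_zero n
      have : e (n+1) = ((n : ℂ) + 1)⁻¹ • DL (e n) + (-1 : ℂ) • e n := by
        rw [DL_e, smul_smul, inv_mul_cancel₀ hne]; module
      rw [this]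
      exact hadd _ _ (hsmul _ _ (hD _ ih)) (hsmul _ _ ih)

open Polynomial

noncomputable def lt : ℂ[X] →ₗ[ℂ] Lam :=
  (LinearMap.applyₗ (e 0)).comp (aeval DL : ℂ[X] →ₐ[ℂ] Module.End ℂ Lam).toLinearMap

lemma lt_one : lt 1 = e 0 := by simp [lt]
lemma lt_X_mul (f : ℂ[X]) : lt (X * f) = DL (lt f) := by simp [lt]

lemma lt_e (n : ℕ) : ∃ f, lt f = e n := by
  have : ∀ g : Lam, ∃ f, lt f = g := by
    intro g
    induction g using lam_Dind with
    | hadd f g hf hg =>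
      obtain ⟨f', rfl⟩ := hf; obtain ⟨g', rfl⟩ := hg; exact ⟨f' + g', map_add _ _ _⟩
    | hsmul c f hf => obtain ⟨f', rfl⟩ := hf; exact ⟨c • f', map_smul _ _ _⟩
    | h0 => exact ⟨1, lt_one⟩
    | hD f hf => obtain ⟨f', rfl⟩ := hf; exact ⟨X * f', lt_X_mul _⟩
  exact this _

lemma poly_ind {p : ℂ[X] → Prop} (f : ℂ[X]) (hadd : ∀ f g, p f → p g → p (f + g))
    (hsmul : ∀ (c : ℂ) f, p f → p (c • f)) (h0 : p 1) (hX : ∀ f, p f → p (X * f)) : p f := by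
  induction f using Polynomial.induction_on' with
  | add f g hf hg => exact hadd _ _ hf hg
  | monomial n c =>
    have : (monomial n c : ℂ[X]) = c • X ^ n := by rw [smul_X_eq_monomial]
    rw [this]; apply hsmul
    clear this
    induction n with
    | zero => simpa using h0
    | succ n ih => rw [pow_succ']; exact hX _ ih

lemma lt_X1 : lt X = e 1 + e 0 := by
  rw [← mul_one X, lt_X_mul, lt_one, DL_e]; simp
lemma lt_X2 : lt (X^2) = (2:ℂ) • e 2 + (3:ℂ) • e 1 + e 0 := by
  rw [pow_two, lt_X_mul, lt_X1, map_add, DL_e, DL_e]; push_cast; module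
lemma lt_X3 : lt (X^3) = (6:ℂ) • e 3 + (12:ℂ) • e 2 + (7:ℂ) • e 1 + e 0 := by
  rw [pow_succ', lt_X_mul, lt_X2]; simp only [map_add, map_smul, DL_e]; push_cast; module
lemma lt_X4 : lt (X^4) = (24:ℂ) • e 4 + (60:ℂ) • e 3 + (50:ℂ) • e 2 + (15:ℂ) • e 1 + e 0 := by
  rw [pow_succ', lt_X_mul, lt_X3]; simp only [map_add, map_smul, DL_e]; push_cast; module
lemma lt_X5 : lt (X^5) = (120:ℂ) • e 5 + (360:ℂ) • e 4 + (390:ℂ) • e 3 + (180:ℂ) • e 2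
    + (31:ℂ) • e 1 + e 0 := by
  rw [pow_succ', lt_X_mul, lt_X4]; simp only [map_add, map_smul, DL_e]; push_cast; module

/-- summation polynomials -/
noncomputable def s0 : ℂ[X] := (1/2 : ℂ) • (X^2 + X)
noncomputable def s1 : ℂ[X] := (1/6 : ℂ) • ((2:ℂ) • X^3 + (3:ℂ) • X^2 + X)
noncomputable def s2 : ℂ[X] := (1/4 : ℂ) • (X^4 + (2:ℂ) • X^3 + X^2)
noncomputable def s3 : ℂ[X] := (1/30 : ℂ) • ((6:ℂ) • X^5 + (15:ℂ) • X^4 + (10:ℂ) • X^3 - X)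

lemma SL_0 : SL (lt 1) = lt s0 := by
  simp only [s0, map_smul, map_add, lt_one, lt_X1, lt_X2, SL_e]; push_cast; module
lemma SL_1 : SL (lt X) = lt s1 := by
  simp only [s1, map_smul, map_add, lt_X3, lt_X1, lt_X2, SL_e]; push_cast; module
lemma SL_2 : SL (lt (X^2)) = lt s2 := by
  simp only [s2, map_smul, map_add, lt_X3, lt_X4, lt_X2, SL_e]; push_cast; module
lemma SL_3 : SL (lt (X^3)) = lt s3 := by
  simp only [s3, map_smul, map_add, map_sub, lt_X3, lt_X4, lt_X5, lt_X1, SL_e]; push_cast; module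

namespace WData
variable {ℓ : ℕ} {V R : Type} [AddCommGroup V] [Module ℂ V] [Ring R] [Algebra ℂ R]
  (w : WData ℓ V R)

noncomputable def op (a : Fin ℓ) : Lam →ₗ[ℂ] Module.End ℂ V := Finsupp.linearCombination ℂ (w.H a)

lemma op_e (a n) : w.op a (e n) = w.H a n := by simp [op, e]

lemma op_comm (a b : Fin ℓ) (f g : Lam) (x : V) :
    w.op a f (w.op b g x) = w.op b g (w.op a f x) := by
  induction f using lam_ind with
  | hadd f f' hf hf' => simp only [map_add, LinearMap.add_apply, hf, hf']
  | hsmul c f hf => simp only [map_smul, LinearMap.smul_apply, hf]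
  | he n =>
    induction g using lam_ind with
    | hadd f f' hf hf' => simp only [map_add, LinearMap.add_apply, hf, hf']
    | hsmul c f hf => simp only [map_smul, LinearMap.smul_apply, hf]
    | he m => simp only [op_e, w.comm]

lemma Lo_op (a b c : Fin ℓ) (f : Lam) (x : V) : w.Lo a b (w.op c f x) = w.op c f (w.Lo a b x)
    + (if c = a then w.op b (SL f) x else 0) + (if c = b then w.op a (SL f) x else 0) := by
  induction f using lam_ind with
  | hadd f f' hf hf' =>
    simp only [map_add, LinearMap.add_apply, hf, hf']; split_ifs <;> abel
  | hsmul c f hf =>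
    simp only [map_smul, LinearMap.smul_apply, hf, smul_add]; split_ifs <;> simp
  | he n =>
    simp only [op_e, w.Lo_H, SL_e, map_smul, map_add, LinearMap.smul_apply, LinearMap.add_apply]

lemma Do_op (a b c : Fin ℓ) (f : Lam) (x : V) : w.Do a b (w.op c f x) = w.op c f (w.Do a b x)
    + (if c = a then w.op b (DL f) x else 0) + (if c = b then w.op a (DL f) x else 0) := by
  induction f using lam_ind with
  | hadd f f' hf hf' =>
    simp only [map_add, LinearMap.add_apply, hf, hf']; split_ifs <;> abel
  | hsmul c f hf =>
    simp only [map_smul, LinearMap.smul_apply, hf, smul_add]; split_ifs <;> simp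
  | he n =>
    simp only [op_e, w.Do_H, DL_e, map_smul, map_add, LinearMap.smul_apply, LinearMap.add_apply]

/-- two letter words -/
noncomputable def sg (a : Fin ℓ) (f : Lam) (b : Fin ℓ) (g : Lam) : R := w.q (w.op a f (w.op b g w.one))

noncomputable def XX (a b : Fin ℓ) : R := w.sg a (e 0) b (e 0)

lemma XX_def (a b) : w.XX a b = w.q (w.H a 0 (w.H b 0 w.one)) := by simp [XX, sg, op_e]

lemma X_mul (a b x) : w.XX a b * w.q x = w.q (w.Lo a b x) := by rw [XX_def, w.mulL]
lemma X_br (a b x) : w.XX a b * w.q x - w.q x * w.XX a b = w.q (w.Do a b x) := by rw [XX_def, w.brD]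

lemma Lo_one' (a b) : w.Lo a b w.one = w.op a (e 0) (w.op b (e 0) w.one) := by
  rw [w.Lo_one, op_e, op_e]

lemma sg_swap (a f b g) : w.sg a f b g = w.sg b g a f := by rw [sg, sg, op_comm]

lemma tot_word2 (a f b g) : w.sg a (DL f) b g + w.sg a f b (DL g) = 0 := by
  have h := w.tot (w.op a f (w.op b g w.one))
  simp only [Do_op, Do_one, map_add, map_zero, Finset.sum_add_distrib, map_sum] at h
  simp only [apply_ite (w.op a f), apply_ite w.q, map_zero] at h
  simp only [Finset.sum_ite_eq, Finset.mem_univ, if_true, Finset.sum_const_zero, zero_add] at h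
  have h2 : (2:ℂ) • (w.sg a (DL f) b g + w.sg a f b (DL g)) = 0 := by
    rw [two_smul, ← h]; simp only [sg]; abel
  exact (smul_eq_zero.1 h2).resolve_left two_ne_zero

end WData
end ZhuAux


namespace ZhuAux
open Polynomial
namespace WData
variable {ℓ : ℕ} {V R : Type} [AddCommGroup V] [Module ℂ V] [Ring R] [Algebra ℂ R]
  (w : WData ℓ V R)

lemma sg_add_left (a f f' b g) : w.sg a (f + f') b g = w.sg a f b g + w.sg a f' b g := by
  simp [sg]
lemma sg_smul_left (a f b g) (c : ℂ) : w.sg a (c • f) b g = c • w.sg a f b g := by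
  simp [sg]
lemma sg_add_right (a f b g g') : w.sg a f b (g + g') = w.sg a f b g + w.sg a f b g' := by
  simp [sg]
lemma sg_smul_right (a f b g) (c : ℂ) : w.sg a f b (c • g) = c • w.sg a f b g := by
  simp [sg]

noncomputable def T (a b : Fin ℓ) : ℂ[X] →ₗ[ℂ] R where
  toFun f := w.sg a (lt f) b (e 0)
  map_add' f g := by rw [map_add, sg_add_left]
  map_smul' c f := by rw [map_smul, sg_smul_left]; rfl

lemma T_def (a b f) : w.T a b f = w.sg a (lt f) b (e 0) := rfl

lemma T_one (a b) : w.T a b 1 = w.XX a b := by rw [T_def, lt_one]; rfl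

lemma sg_T (a b : Fin ℓ) (f g : ℂ[X]) : w.sg a (lt f) b (lt g) = w.T a b (f * g.comp (-X)) := by
  induction g using poly_ind generalizing f with
  | hadd g g' hg hg' => rw [map_add, sg_add_right, hg, hg', add_comp, mul_add, map_add]
  | hsmul c g hg => rw [map_smul, sg_smul_right, hg, smul_comp, mul_smul_comm, map_smul]
  | h0 => simp [lt_one, T_def]
  | hX g hg =>
    have h := w.tot_word2 a (lt f) b (lt g)
    rw [lt_X_mul, eq_neg_of_add_eq_zero_right h, ← lt_X_mul, hg, ← map_neg, mul_comp, X_comp]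
    congr 1; ring

lemma T_swap (a b f) : w.T b a f = w.T a b (f.comp (-X)) := by
  rw [T_def, sg_swap, ← lt_one, sg_T, one_mul]

lemma T_odd (a f) (h : f.comp (-X) = -f) : w.T a a f = 0 := by
  have := w.T_swap a a f
  rw [h, map_neg] at this
  have h2 : (2:ℂ) • w.T a a f = 0 := by rw [two_smul]; nth_rewrite 1 [this]; simp
  exact (smul_eq_zero.1 h2).resolve_left two_ne_zero

/-- commutator with `X_{cd}`. -/
lemma T_br (c d a b : Fin ℓ) (f : ℂ[X]) : w.XX c d * w.T a b f - w.T a b f * w.XX c d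
    = (if a = c then w.T d b (X * f) else 0) + (if a = d then w.T c b (X * f) else 0)
     - (if b = c then w.T a d (X * f) else 0) - (if b = d then w.T a c (X * f) else 0) := by
  have hD : ∀ u v, w.sg u (lt f) v (DL (e 0)) = - w.T u v (X * f) := by
    intro u v
    rw [← lt_one, ← lt_X_mul, sg_T, mul_one, X_comp, mul_neg, map_neg, mul_comm]
  rw [T_def, sg, X_br]
  simp only [Do_op, Do_one, map_add, map_zero, zero_add]
  simp only [apply_ite (w.op a (lt f)), apply_ite w.q, map_zero]
  change (if b = c then w.sg a (lt f) d (DL (e 0)) else 0) + (if b = d then w.sg a (lt f) c (DL (e 0)) else 0)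
    + (if a = c then w.sg d (DL (lt f)) b (e 0) else 0) + (if a = d then w.sg c (DL (lt f)) b (e 0) else 0) = _
  rw [hD, hD, ← lt_X_mul, ← T_def, ← T_def]
  split_ifs <;> abel

noncomputable def W4 (a : Fin ℓ) (f : Lam) (b : Fin ℓ) (g : Lam) (c : Fin ℓ) (h : Lam)
   (d : Fin ℓ) (k : Lam) : R := w.q (w.op a f (w.op b g (w.op c h (w.op d k w.one))))

lemma W4_12 (a f b g c h d k) : w.W4 a f b g c h d k = w.W4 b g a f c h d k := by
  rw [W4, op_comm]; rfl
lemma W4_23 (a f b g c h d k) : w.W4 a f b g c h d k = w.W4 a f c h b g d k := by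
  rw [W4, op_comm w b c]; rfl
lemma W4_34 (a f b g c h d k) : w.W4 a f b g c h d k = w.W4 a f b g d k c h := by
  rw [W4, op_comm w c d]; rfl

lemma X_sg (c d a b : Fin ℓ) (f g : Lam) : w.XX c d * w.sg a f b g
    = w.W4 c (e 0) d (e 0) a f b g
     + (if a = c then w.sg d (SL f) b g else 0) + (if a = d then w.sg c (SL f) b g else 0)
     + (if b = c then w.sg a f d (SL g) else 0) + (if b = d then w.sg a f c (SL g) else 0) := by
  rw [sg, X_mul]
  simp only [Lo_op, Lo_one', map_add]
  simp only [apply_ite (w.op a f), apply_ite w.q, map_zero]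
  have : w.q (w.op a f (w.op b g (w.op c (e 0) (w.op d (e 0) w.one)))) = w.W4 c (e 0) d (e 0) a f b g := by
    change w.W4 a f b g c (e 0) d (e 0) = _
    rw [W4_23, W4_12, W4_34, W4_23]
  rw [this]
  simp only [sg]
  abel

lemma tot4 (a f b g c h d k) : w.W4 a (DL f) b g c h d k + w.W4 a f b (DL g) c h d k
    + w.W4 a f b g c (DL h) d k + w.W4 a f b g c h d (DL k) = 0 := by
  have hh := w.tot (w.op a f (w.op b g (w.op c h (w.op d k w.one))))
  simp only [Do_op, Do_one, map_add, map_zero, Finset.sum_add_distrib, map_sum] at hh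
  simp only [apply_ite (w.op a f), apply_ite (w.op b g), apply_ite (w.op c h), apply_ite w.q, map_zero] at hh
  simp only [Finset.sum_ite_eq, Finset.mem_univ, if_true, Finset.sum_const_zero, zero_add] at hh
  have h2 : (2:ℂ) • (w.W4 a (DL f) b g c h d k + w.W4 a f b (DL g) c h d k
    + w.W4 a f b g c (DL h) d k + w.W4 a f b g c h d (DL k)) = 0 := by
    rw [two_smul, ← hh]; simp only [W4]; abel
  exact (smul_eq_zero.1 h2).resolve_left two_ne_zero

lemma half_zero {x : R} (h : x = -x) : x = 0 := by
  have h2 : (2:ℂ) • x = 0 := by rw [two_smul]; nth_rewrite 1 [h]; simp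
  exact (smul_eq_zero.1 h2).resolve_left two_ne_zero

lemma two_cancel {x y : R} (h : (2:ℂ) • x = (2:ℂ) • y) : x = y :=
  smul_right_injective R (two_ne_zero' ℂ) h

lemma XX_swap (a b) : w.XX a b = w.XX b a := w.sg_swap _ _ _ _

lemma sg_neg_e (a b : Fin ℓ) : w.sg a (e 0) b (lt X) = - w.T a b X := by
  rw [← lt_one, sg_T, X_comp, one_mul, map_neg]

/-- general transport: if `F` and `G` are linear families with `[Y, F f] = c F (X f)`... -/
lemma transport (Y : R) (c : ℂ) (hc : c ≠ 0) (F G : ℂ[X] →ₗ[ℂ] R)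
    (hF : ∀ f, Y * F f - F f * Y = c • F (X * f)) (hG : ∀ f, Y * G f - G f * Y = c • G (X * f))
    (h : F 1 = G 1) (f : ℂ[X]) : F f = G f := by
  induction f using poly_ind with
  | hadd f g hf hg => rw [map_add, map_add, hf, hg]
  | hsmul c f hf => rw [map_smul, map_smul, hf]
  | h0 => exact h
  | hX f hf =>
    have h1 := hF f
    rw [hf, hG f] at h1
    exact (smul_right_injective R hc h1).symm

/-! R2 -/
lemma R2 (a b c d : Fin ℓ) (hab : a ≠ b) (hac : a ≠ c) (had : a ≠ d) (hbc : b ≠ c) (hbd : b ≠ d)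
    (hcd : c ≠ d) : w.XX c d * w.T a b X = 0 := by
  have key : ∀ a b c d : Fin ℓ, a ≠ c → a ≠ d → b ≠ c → b ≠ d →
      w.W4 c (e 0) d (e 0) a (lt X) b (e 0) = - w.W4 c (e 0) d (e 0) a (e 0) b (lt X) := by
    intro a b c d hac had hbc hbd
    have h1 := w.X_sg c d a b (lt X) (e 0)
    have h2 := w.X_sg c d a b (e 0) (lt X)
    simp only [if_neg hac, if_neg had, if_neg hbc, if_neg hbd, add_zero] at h1 h2
    rw [← h1, ← h2, sg_neg_e, ← T_def, mul_neg, neg_neg]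
  have h1 := w.X_sg c d a b (lt X) (e 0)
  simp only [if_neg hac, if_neg had, if_neg hbc, if_neg hbd, add_zero] at h1
  rw [T_def, h1]
  have k1 := key a b c d hac had hbc hbd
  have k2 := key b c a d hab.symm hbd hac.symm hcd
  have k3 := key a c b d hab had hbc.symm hcd
  apply half_zero
  have n1 : w.W4 c (e 0) d (e 0) a (e 0) b (lt X) = w.W4 a (e 0) d (e 0) b (lt X) c (e 0) := by
    simp only [W4, w.op_comm]
  have n2 : w.W4 a (e 0) d (e 0) b (e 0) c (lt X) = w.W4 b (e 0) d (e 0) a (e 0) c (lt X) := by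
    simp only [W4, w.op_comm]
  have n3 : w.W4 b (e 0) d (e 0) a (lt X) c (e 0) = w.W4 c (e 0) d (e 0) a (lt X) b (e 0) := by
    simp only [W4, w.op_comm]
  calc _ = -(w.W4 c (e 0) d (e 0) a (e 0) b (lt X)) := k1
    _ = _ := by rw [n1, k2, n2, ← neg_neg (w.W4 b (e 0) d (e 0) a (e 0) c (lt X)), ← k3, n3]; simp

end WData
end ZhuAux


namespace ZhuAux
open Polynomial
namespace WData
variable {ℓ : ℕ} {V R : Type} [AddCommGroup V] [Module ℂ V] [Ring R] [Algebra ℂ R]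
  (w : WData ℓ V R)

lemma br_aa {a b : Fin ℓ} (h : a ≠ b) (f : ℂ[X]) :
    w.XX a a * w.T a b f - w.T a b f * w.XX a a = (2:ℂ) • w.T a b (X * f) := by
  rw [T_br]; simp [h.symm, two_smul]

lemma br_bb {a b : Fin ℓ} (h : a ≠ b) (f : ℂ[X]) :
    w.XX b b * w.T a b f - w.T a b f * w.XX b b = (-2:ℂ) • w.T a b (X * f) := by
  rw [T_br]; simp [h, two_smul]; abel

lemma br_none {a b c d : Fin ℓ} (hac : a ≠ c) (had : a ≠ d) (hbc : b ≠ c) (hbd : b ≠ d) (f : ℂ[X]) :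
    w.XX c d * w.T a b f - w.T a b f * w.XX c d = 0 := by
  rw [T_br]; simp [hac, had, hbc, hbd]

lemma br_pair {a b : Fin ℓ} (h : a ≠ b) (f : ℂ[X]) :
    w.XX a b * w.T a b f - w.T a b f * w.XX a b = w.T b b (X * f) - w.T a a (X * f) := by
  rw [T_br]; simp [h, h.symm]

/-- extend such a product identity by `ad Y`. -/
lemma ext_left (Y Q : R) (c : ℂ) (hc : c ≠ 0) (a b a' b' : Fin ℓ) (g g' : ℂ[X])
    (hQ : Y * Q - Q * Y = 0)
    (h1 : ∀ f, Y * w.T a b f - w.T a b f * Y = c • w.T a b (X * f))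
    (h2 : ∀ f, Y * w.T a' b' f - w.T a' b' f * Y = c • w.T a' b' (X * f))
    (h : Q * w.T a b g = w.T a' b' g') (f : ℂ[X]) : Q * w.T a b (g * f) = w.T a' b' (g' * f) := by
  refine transport Y c hc (LinearMap.mulLeft ℂ Q ∘ₗ w.T a b ∘ₗ LinearMap.mulLeft ℂ g)
    (w.T a' b' ∘ₗ LinearMap.mulLeft ℂ g') ?_ ?_ ?_ f
  · intro f
    simp only [LinearMap.comp_apply, LinearMap.mulLeft_apply]
    have := h1 (g * f)
    rw [show g * (X * f) = X * (g * f) by ring, ← mul_smul_comm, ← this]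
    have e1 := sub_eq_zero.1 hQ
    rw [mul_sub, ← mul_assoc, e1]; noncomm_ring
  · intro f
    simp only [LinearMap.comp_apply, LinearMap.mulLeft_apply]
    rw [h2, show g' * (X * f) = X * (g' * f) by ring]
  · simpa using h

lemma ext_right (Y Q : R) (c : ℂ) (hc : c ≠ 0) (a b a' b' : Fin ℓ) (g g' : ℂ[X])
    (hQ : Y * Q - Q * Y = 0)
    (h1 : ∀ f, Y * w.T a b f - w.T a b f * Y = c • w.T a b (X * f))
    (h2 : ∀ f, Y * w.T a' b' f - w.T a' b' f * Y = c • w.T a' b' (X * f))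
    (h : w.T a b g * Q = w.T a' b' g') (f : ℂ[X]) : w.T a b (g * f) * Q = w.T a' b' (g' * f) := by
  refine transport Y c hc (LinearMap.mulRight ℂ Q ∘ₗ w.T a b ∘ₗ LinearMap.mulLeft ℂ g)
    (w.T a' b' ∘ₗ LinearMap.mulLeft ℂ g') ?_ ?_ ?_ f
  · intro f
    simp only [LinearMap.comp_apply, LinearMap.mulLeft_apply, LinearMap.mulRight_apply]
    have := h1 (g * f)
    rw [show g * (X * f) = X * (g * f) by ring, ← smul_mul_assoc, ← this]
    have e1 := sub_eq_zero.1 hQ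
    rw [sub_mul, mul_assoc _ Y Q, e1]; noncomm_ring
  · intro f
    simp only [LinearMap.comp_apply, LinearMap.mulLeft_apply]
    rw [h2, show g' * (X * f) = X * (g' * f) by ring]
  · simpa using h

lemma XX_comm_aa {a b : Fin ℓ} : w.XX a a * w.XX b b - w.XX b b * w.XX a a = 0 := by
  by_cases h : a = b
  · subst h; simp
  · rw [← w.T_one b b, br_none w (Ne.symm h) (Ne.symm h) (Ne.symm h) (Ne.symm h)]

lemma R2x {a b c d : Fin ℓ} (hab : a ≠ b) (hac : a ≠ c) (had : a ≠ d) (hbc : b ≠ c) (hbd : b ≠ d)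
    (hcd : c ≠ d) (f : ℂ[X]) : w.XX c d * w.T a b (X * f) = 0 := by
  have := w.ext_left (w.XX a a) (w.XX c d) 2 two_ne_zero a b a b X 0
    (by rw [← w.T_one c d, br_none w hac.symm hac.symm had.symm had.symm]) (w.br_aa hab) (w.br_aa hab)
    (by rw [w.R2 a b c d hab hac had hbc hbd hcd, map_zero]) f
  simpa using this

noncomputable def h1 : ℂ[X] := (1/6 : ℂ) • ((2:ℂ) • X^2 + (3:ℂ) • X + 1)
noncomputable def h2 : ℂ[X] := (1/6 : ℂ) • (1 - X^2)

lemma R3_basic {a b c : Fin ℓ} (hab : a ≠ b) (hac : a ≠ c) (hbc : b ≠ c) :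
    w.XX a b * w.T b c X = w.T a c (h1 * X) ∧ w.XX b b * w.T a c X = w.T a c (h2 * X) := by
  have A1 := w.X_sg a c b b (lt X) (e 0)
  have A2 := w.X_sg a b b c (lt X) (e 0)
  have A3 := w.X_sg a b b c (e 0) (lt X)
  have A4 := w.X_sg b b a c (lt X) (e 0)
  simp only [hab, hac, hbc, hab.symm, hac.symm, hbc.symm, if_true, if_false, add_zero, zero_add] at A1 A2 A3 A4
  rw [← T_def, w.T_odd b X (by simp), mul_zero] at A1
  rw [← T_def] at A2 A4
  rw [sg_neg_e, mul_neg] at A3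
  rw [SL_1, ← T_def] at A2
  rw [← lt_one, SL_0, sg_T, X_comp, lt_one] at A3
  have n1 : w.W4 a (e 0) b (e 0) b (lt X) c (e 0) = w.W4 a (e 0) c (e 0) b (lt X) b (e 0) := by
    simp only [W4, w.op_comm]
  have t := w.tot4 a (e 0) b (e 0) b (e 0) c (e 0)
  rw [← lt_one, ← lt_X_mul, mul_one, lt_one] at t
  have n2 : w.W4 a (e 0) b (lt X) b (e 0) c (e 0) = w.W4 a (e 0) b (e 0) b (lt X) c (e 0) := by
    simp only [W4, w.op_comm]
  have n3 : w.W4 a (lt X) b (e 0) b (e 0) c (e 0) = w.W4 b (e 0) b (e 0) a (lt X) c (e 0) := by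
    simp only [W4, w.op_comm]
  rw [n1, ← A1] at A2
  rw [n2, n1, ← A1, n3, ← A4] at t
  have B : w.XX a b * w.T b c X = w.T a c (h1 * X) := by
    rw [A2, zero_add]; congr 1; simp only [h1, s1, smul_eq_C_mul]; ring
  refine ⟨B, ?_⟩
  rw [B] at A3
  have : w.XX b b * w.T a c X = w.T a c (h1 * X) + w.T a c (s0 * (-X)) := by
    have t' := t
    rw [← sub_eq_iff_eq_add.2 A3] at t'
    have := eq_neg_of_add_eq_zero_left (show w.XX b b * w.T a c X +
      (-w.T a c (h1 * X) - w.T a c (s0 * -X)) = 0 by rw [← t']; abel)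
    rw [this]; abel
  rw [this, ← map_add]; congr 1
  simp only [h1, h2, s0, smul_eq_C_mul]
  have e1 : (C (1/6:ℂ) : ℂ[X]) * C 2 = C (1/3) := by rw [← C_mul]; norm_num
  have e2 : (C (1/6:ℂ) : ℂ[X]) * C 3 = C (1/2) := by rw [← C_mul]; norm_num
  have e3 : (C (1/3:ℂ) : ℂ[X]) = C (1/2) - C (1/6) := by rw [← C_sub]; norm_num
  linear_combination X^3 * e1 + X^2 * e2 + X^3 * e3

lemma R3a {a b c : Fin ℓ} (hab : a ≠ b) (hac : a ≠ c) (hbc : b ≠ c) (f : ℂ[X]) :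
    w.XX b b * w.T a c (X * f) = w.T a c (h2 * X * f) :=
  w.ext_left (w.XX a a) (w.XX b b) 2 two_ne_zero a c a c X (h2*X)
    w.XX_comm_aa (w.br_aa hac) (w.br_aa hac) (w.R3_basic hab hac hbc).2 f

lemma R3b {a b c : Fin ℓ} (hab : a ≠ b) (hac : a ≠ c) (hbc : b ≠ c) (f : ℂ[X]) :
    w.XX a b * w.T b c (X * f) = w.T a c (h1 * X * f) :=
  w.ext_left (w.XX c c) (w.XX a b) (-2) (by norm_num) b c a c X (h1*X)
    (by rw [← w.T_one a b, br_none w hac hac hbc hbc]) (w.br_bb hbc) (w.br_bb hac)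
    (w.R3_basic hab hac hbc).1 f

lemma R3c {a b c : Fin ℓ} (hab : a ≠ b) (hac : a ≠ c) (hbc : b ≠ c) (f g : ℂ[X]) :
    w.T a b g * w.T b c (X * f) = w.T a c (h1 * X * f * g) := by
  have := w.ext_right (w.XX a a) (w.T b c (X * f)) 2 two_ne_zero a b a c 1 (h1*X*f)
    (by rw [br_none w hab.symm hab.symm hac.symm hac.symm]) (w.br_aa hab) (w.br_aa hac)
    (by rw [T_one]; exact w.R3b hab hac hbc f) g
  rwa [one_mul] at this

end WData
end ZhuAux


namespace ZhuAux
open Polynomial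
namespace WData
variable {ℓ : ℕ} {V R : Type} [AddCommGroup V] [Module ℂ V] [Ring R] [Algebra ℂ R]
  (w : WData ℓ V R)

lemma R4gen {a b : Fin ℓ} (hab : a ≠ b) (f sf : ℂ[X]) (hf : f.comp (-X) = -f)
    (hs : SL (lt f) = lt sf) :
    w.XX b b * w.T a b f = w.T a b (sf - s0 * f - (2:ℂ) • sf.comp (-X)) := by
  have A1 := w.X_sg b b a b (lt 1) (lt f)
  have A2 := w.X_sg a b b b (lt f) (lt 1)
  simp only [hab, hab.symm, if_true, if_false, add_zero] at A1 A2
  rw [sg_T, hf, one_mul, map_neg, hs, sg_T, one_mul] at A1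
  rw [sg_T, one_comp, mul_one, w.T_odd b f hf, mul_zero, hs, SL_0, sg_T, one_comp, mul_one,
    w.sg_swap b _ a, sg_T, hf, lt_one] at A2
  have n : w.W4 b (e 0) b (e 0) a (lt 1) b (lt f) = w.W4 a (e 0) b (e 0) b (lt f) b (e 0) := by
    rw [lt_one]; simp only [W4, w.op_comm]
  rw [n] at A1
  simp only [map_sub, map_smul, mul_neg, map_neg] at *
  have A3 : w.W4 a (e 0) b (e 0) b (lt f) b (e 0) = - w.T a b sf + w.T a b (s0 * f) := by
    have : w.W4 a (e 0) b (e 0) b (lt f) b (e 0) = (w.W4 a (e 0) b (e 0) b (lt f) b (e 0) + w.T a b sf + -w.T a b (s0 * f))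
      - w.T a b sf + w.T a b (s0 * f) := by abel
    rw [this, ← A2]; abel
  rw [A3] at A1
  rw [← neg_neg (w.XX b b * w.T a b f), A1]; rw [two_smul]; abel

noncomputable def h3 : ℂ[X] := (1/2 : ℂ) • (X - 1)^2
noncomputable def h4 : ℂ[X] := (1/2 : ℂ) • (X + 1)^2
noncomputable def PP : ℂ[X] := X * (X^2 - 1) * (X^2 - C (1/4))

lemma R4a {a b : Fin ℓ} (hab : a ≠ b) (f : ℂ[X]) :
    w.XX b b * w.T a b (X * f) = w.T a b (h3 * X * f) := by
  refine w.ext_left (w.XX a a) (w.XX b b) 2 two_ne_zero a b a b X (h3*X)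
    w.XX_comm_aa (w.br_aa hab) (w.br_aa hab) ?_ f
  rw [w.R4gen hab X s1 (by simp) SL_1]
  congr 1
  apply Polynomial.funext; intro r
  simp [s1, s0, h3, eval_comp]; ring

lemma R4b {a b : Fin ℓ} (hab : a ≠ b) (f : ℂ[X]) :
    w.XX a a * w.T a b (X * f) = w.T a b (h4 * X * f) := by
  rw [w.T_swap b a, mul_comp, X_comp, show -X * f.comp (-X) = X * (- f.comp (-X)) by ring,
    w.R4a hab.symm, w.T_swap a b]
  congr 1
  apply Polynomial.funext; intro r
  simp [h3, h4, eval_comp]; left; left; ring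

lemma R5 {a b : Fin ℓ} (hab : a ≠ b) (f : ℂ[X]) : w.T a b (PP * f) = 0 := by
  have h0 : w.T a b PP = 0 := by
    have e1 := w.R4gen hab (X^3) s3 (by simp; ring) SL_3
    have e2 := w.R4a hab (X^2)
    rw [show X * X^2 = (X^3 : ℂ[X]) by ring, e1, ← sub_eq_zero, ← map_sub] at e2
    have : (s3 - s0 * X^3 - (2:ℂ) • s3.comp (-X)) - h3 * X * X^2 = (-(2/5):ℂ) • PP := by
      apply Polynomial.funext; intro r
      simp [s3, s0, h3, PP, eval_comp]; ring
    rw [this, map_smul] at e2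
    exact (smul_eq_zero.1 e2).resolve_left (by norm_num)
  have := w.ext_left (w.XX a a) 1 2 two_ne_zero a b a b PP 0 (by simp) (w.br_aa hab) (w.br_aa hab)
    (by rw [h0]; simp) f
  simpa using this

/-- eigen polynomials -/
structure Eig (z : ℂ) (p : ℂ[X]) : Prop where
  ne : z ≠ 0
  dvd : X ∣ p
  eig : PP ∣ (X - C z) * p

lemma Eig.T {z : ℂ} {p : ℂ[X]} (h : Eig z p) {a b : Fin ℓ} (hab : a ≠ b) (g : ℂ[X]) :
    w.T a b (g * p) = g.eval z • w.T a b p := by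
  have h1 : (X - C z) ∣ g - C (g.eval z) := X_sub_C_dvd_sub_C_eval
  obtain ⟨u, hu⟩ := h1
  obtain ⟨v, hv⟩ := h.eig
  have : g * p = PP * (v * u) + g.eval z • p := by
    rw [smul_eq_C_mul]; linear_combination p * hu + u * hv
  rw [this, map_add, w.R5 hab, zero_add, map_smul]

lemma Eig.neg {z : ℂ} {p : ℂ[X]} (h : Eig z p) : Eig (-z) (p.comp (-X)) := by
  refine ⟨neg_ne_zero.2 h.ne, ?_, ?_⟩
  · obtain ⟨v, rfl⟩ := h.dvd
    rw [mul_comp, X_comp]; exact ⟨-v.comp (-X), by ring⟩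
  · obtain ⟨v, hv⟩ := h.eig
    have := congrArg (fun q => q.comp (-X)) hv
    simp only [mul_comp, sub_comp, X_comp, C_comp] at this
    refine ⟨v.comp (-X), ?_⟩
    have hP : PP.comp (-X) = - PP := by simp [PP]
    rw [hP] at this
    rw [C_neg]; linear_combination -this

noncomputable def eu : ℂ[X] := (2/3:ℂ) • (X * (X+1) * (X^2 - C (1/4)))
noncomputable def et : ℂ[X] := (-16/3:ℂ) • (X * (X^2-1) * (X + C (1/2)))

lemma Eig_u : Eig 1 eu := by
  refine ⟨one_ne_zero, ⟨(2/3:ℂ) • ((X+1) * (X^2 - C (1/4))), ?_⟩, ⟨C (2/3), ?_⟩⟩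
  · simp only [eu, smul_eq_C_mul]; ring
  · simp only [eu, PP, smul_eq_C_mul, C_1]; ring

lemma Eig_t : Eig (1/2) et := by
  refine ⟨by norm_num, ⟨(-16/3:ℂ) • ((X^2-1) * (X + C (1/2))), ?_⟩, ⟨C (-16/3), ?_⟩⟩
  · simp only [et, smul_eq_C_mul]; ring
  · apply Polynomial.funext; intro r
    simp [et, PP]; ring

/-- decomposition of multiples of `X`. -/
lemma T_X_decomp {a b : Fin ℓ} (hab : a ≠ b) (f : ℂ[X]) :
    w.T a b (X * f) = f.eval 1 • w.T a b eu - f.eval (-1) • w.T a b (eu.comp (-X))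
      + (f.eval (1/2) / 4) • w.T a b et - (f.eval (-1/2)/4) • w.T a b (et.comp (-X)) := by
  have e1 : f.eval (-1) = f.eval (-(1:ℂ)) := by norm_num
  have e2 : f.eval (-1/2) = f.eval (-(1/2:ℂ)) := by norm_num
  have key : w.T a b X = w.T a b eu - w.T a b (eu.comp (-X)) + (1/4:ℂ) • w.T a b et
     - (1/4:ℂ) • w.T a b (et.comp (-X)) := by
    rw [← map_smul, ← map_smul, ← map_sub, ← map_add, ← map_sub]
    congr 1
    apply Polynomial.funext; intro r
    simp [et, eu, eval_comp]; ring
  have := w.ext_left (w.XX a a) 1 2 two_ne_zero a b a b X (eu - eu.comp (-X) + (1/4:ℂ) • et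
     - (1/4:ℂ) • et.comp (-X)) (by simp) (w.br_aa hab) (w.br_aa hab)
    (by rw [one_mul, key]; simp only [map_sub, map_add, map_smul]) f
  rw [one_mul] at this
  rw [this]
  rw [show (eu - eu.comp (-X) + (1/4:ℂ) • et - (1/4:ℂ) • et.comp (-X)) * f
    = f * eu - f * eu.comp (-X) + (1/4:ℂ) • (f * et) - (1/4:ℂ) • (f * et.comp (-X)) by
      simp only [smul_eq_C_mul]; ring]
  simp only [map_sub, map_add, map_smul]
  rw [Eig_u.T w hab, Eig_u.neg.T w hab, Eig_t.T w hab, Eig_t.neg.T w hab, e1, e2]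
  module

end WData
end ZhuAux


namespace ZhuAux
open Polynomial
namespace WData
variable {ℓ : ℕ} {V R : Type} [AddCommGroup V] [Module ℂ V] [Ring R] [Algebra ℂ R]
  (w : WData ℓ V R)

lemma T_even (a : Fin ℓ) (f g : ℂ[X]) (h : (f - g).comp (-X) = -(f - g)) : w.T a a f = w.T a a g := by
  have := w.T_odd a (f - g) h
  rwa [map_sub, sub_eq_zero] at this

lemma R6 {a b : Fin ℓ} (hab : a ≠ b) :
    w.XX a b * w.T a b X = (1/2:ℂ) • (w.T b b (X^2) - w.T a a (X^2)) := by
  have A1 := w.X_sg a b a b (lt X) (lt 1)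
  have A2 := w.X_sg b b a a (lt X) (lt 1)
  simp only [hab, hab.symm, if_true, if_false, add_zero] at A1 A2
  rw [sg_T, one_comp, mul_one, w.T_odd a X (by simp), mul_zero] at A2
  rw [sg_T, one_comp, mul_one, SL_1, sg_T, one_comp, mul_one, SL_0, sg_T, lt_one] at A1
  rw [lt_one] at A2
  have n : w.W4 a (e 0) b (e 0) a (lt X) b (e 0) = w.W4 b (e 0) b (e 0) a (lt X) a (e 0) := by
    simp only [W4, w.op_comm]
  rw [A1, n, ← A2, zero_add, smul_sub, ← map_smul, ← map_smul, sub_eq_add_neg, ← map_neg]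
  congr 1
  · apply T_even; apply Polynomial.funext; intro r; simp [s1]; ring
  · apply T_even; apply Polynomial.funext; intro r; simp [s0]; ring

lemma YY_comm (a b : Fin ℓ) : w.XX a a * w.T b b (X^2) - w.T b b (X^2) * w.XX a a = 0 := by
  rw [T_br]
  by_cases h : b = a
  · subst h; simp
  · simp [h]

noncomputable def GG : ℂ[X] := h3 * X * X - (2:ℂ) • s2.comp (-X) + s2 + s0 * X^2

lemma R7 {a b : Fin ℓ} (hab : a ≠ b) (f : ℂ[X]) :
    w.T a b f * w.T b b (X^2) = w.T a b (GG * f) := by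
  have key : w.XX a b * w.T b b (X^2) = w.T a b GG := by
    have A1 := w.X_sg b b a b (lt 1) (lt (X^2))
    have A2 := w.X_sg a b b b (lt (X^2)) (lt 1)
    simp only [hab, hab.symm, if_true, if_false, add_zero] at A1 A2
    rw [sg_T, one_mul, SL_2, sg_T, one_mul, show (X^2 : ℂ[X]).comp (-X) = X * X by simp; ring,
      w.R4a hab] at A1
    rw [sg_T, one_comp, mul_one, SL_2, SL_0, sg_T, one_comp, mul_one,
      w.sg_swap b _ a, sg_T, show (X^2 : ℂ[X]).comp (-X) = X^2 by simp] at A2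
    have n : w.W4 b (e 0) b (e 0) a (lt 1) b (lt (X^2)) = w.W4 a (e 0) b (e 0) b (lt (X^2)) b (lt 1) := by
      rw [lt_one]; simp only [W4, w.op_comm]
    rw [n] at A1
    rw [A2, GG, map_add, map_add, map_sub, map_smul, A1, two_smul]; abel
  have := w.ext_right (w.XX a a) (w.T b b (X^2)) 2 two_ne_zero a b a b 1 GG
    (w.YY_comm a b) (w.br_aa hab) (w.br_aa hab) (by rw [T_one, key]) f
  rwa [one_mul] at this

lemma R7' {a b : Fin ℓ} (hab : a ≠ b) (f : ℂ[X]) :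
    w.T a b f * w.T a a (X^2) = w.T a b (GG.comp (-X) * f) := by
  rw [w.T_swap b a, w.R7 hab.symm, w.T_swap a b, mul_comp, comp_assoc]; simp

lemma R4a' {a b : Fin ℓ} (hab : a ≠ b) (f : ℂ[X]) :
    w.T a b (X * f) * w.XX b b = w.T a b (h4 * X * f) := by
  have := w.br_bb hab (X * f)
  rw [w.R4a hab, sub_eq_iff_eq_add, ← sub_eq_iff_eq_add'] at this
  rw [← this, ← map_smul, ← map_sub]
  congr 1; apply Polynomial.funext; intro r; simp [h3, h4]; ring

lemma R4b' {a b : Fin ℓ} (hab : a ≠ b) (f : ℂ[X]) :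
    w.T a b (X * f) * w.XX a a = w.T a b (h3 * X * f) := by
  have := w.br_aa hab (X * f)
  rw [w.R4b hab, sub_eq_iff_eq_add, ← sub_eq_iff_eq_add'] at this
  rw [← this, ← map_smul, ← map_sub]
  congr 1; apply Polynomial.funext; intro r; simp [h3, h4]; ring

/-- middle move -/
lemma mid {a b : Fin ℓ} (hab : a ≠ b) (f g : ℂ[X]) :
    w.T a b (X * (X * f)) * w.T a b (X * g) = - (w.T a b (X * f) * w.T a b (X * (X * g))) := by
  have m1 : w.T a b (h3 * X * f) * w.T a b (X * g) = w.T a b (X * f) * w.T a b (h4 * X * g) := by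
    rw [← w.R4b' hab, ← w.R4b hab, mul_assoc]
  have m2 : w.T a b (h4 * X * f) * w.T a b (X * g) = w.T a b (X * f) * w.T a b (h3 * X * g) := by
    rw [← w.R4a' hab, ← w.R4a hab, mul_assoc]
  have e1 : ∀ f, w.T a b (X * (X * f)) = (1/2:ℂ) • (w.T a b (h4 * X * f) - w.T a b (h3 * X * f)) := by
    intro f
    rw [← map_sub, ← map_smul]; congr 1
    apply Polynomial.funext; intro r; simp [h3, h4]; ring
  rw [e1, e1, smul_mul_assoc, mul_smul_comm, sub_mul, mul_sub, m1, m2, ← smul_neg]; congr 1; abel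

noncomputable def rr : ℂ[X] := C 4 * X * (C (5/4) - X^2)

lemma T_rr {a b : Fin ℓ} (hab : a ≠ b) (f : ℂ[X]) : w.T a b (X * f) = w.T a b (X * (X * (rr * f))) := by
  rw [← sub_eq_zero, ← map_sub, ← w.R5 hab (C 4 * f)]
  congr 1
  apply Polynomial.funext; intro r; simp [rr, PP]; ring

lemma two_cancel' {x y : R} (h : (2:ℂ) • x + (2:ℂ) • y = 0) : y = -x := by
  rw [← smul_add] at h
  exact eq_neg_of_add_eq_zero_right ((smul_eq_zero.1 h).resolve_left two_ne_zero)

lemma comm_mul (Y A B A' B' : R) (hA : Y * A - A * Y = A') (hB : Y * B - B * Y = B') :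
    Y * (A * B) - (A * B) * Y = A' * B + A * B' := by
  rw [← hA, ← hB]; noncomm_ring

lemma Zl_aux {a b : Fin ℓ} (hab : a ≠ b) (f : ℂ[X]) :
    w.XX a a * (w.XX a b * w.T a b (X * f)) - (w.XX a b * w.T a b (X * f)) * w.XX a a = 0 ∧
    w.XX a b * w.T a b (X * (X * f)) = - (w.T a b X * w.T a b (X * f)) := by
  have st : ∀ f, w.XX a a * (w.XX a b * w.T a b (X * f)) - (w.XX a b * w.T a b (X * f)) * w.XX a a = 0 →
      w.XX a b * w.T a b (X * (X * f)) = - (w.T a b X * w.T a b (X * f)) := by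
    intro f h
    have c1 := w.br_aa hab 1
    rw [T_one, mul_one] at c1
    rw [comm_mul _ _ _ _ _ c1 (w.br_aa hab (X * f)), smul_mul_assoc, mul_smul_comm] at h
    exact two_cancel' h
  have main : w.XX a a * (w.XX a b * w.T a b (X * f)) - (w.XX a b * w.T a b (X * f)) * w.XX a a = 0 := by
    induction f using poly_ind with
    | hadd f g hf hg =>
      rw [mul_add, map_add, mul_add, mul_add, add_mul, add_sub_add_comm, hf, hg, add_zero]
    | hsmul c f hf =>
      rw [mul_smul_comm, map_smul, mul_smul_comm, mul_smul_comm, smul_mul_assoc, ← smul_sub, hf, smul_zero]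
    | h0 =>
      rw [mul_one, w.R6 hab, mul_smul_comm, smul_mul_assoc, ← smul_sub]
      have y1 := w.YY_comm a b
      have y2 := w.YY_comm a a
      rw [mul_sub, sub_mul, sub_sub_sub_comm, y1, y2]; simp
    | hX f hf =>
      rw [st f hf, mul_neg, neg_mul, neg_sub_neg, ← neg_sub, neg_eq_zero,
        comm_mul _ _ _ _ _ (w.br_aa hab X) (w.br_aa hab (X * f))]
      have := w.mid hab 1 f
      rw [mul_one] at this
      rw [smul_mul_assoc, mul_smul_comm, this]; simp
  exact ⟨main, st f main⟩

lemma Zl {a b : Fin ℓ} (hab : a ≠ b) (f : ℂ[X]) :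
    w.XX a b * w.T a b (X * f) = - (w.T a b X * w.T a b (X * (rr * f))) := by
  rw [w.T_rr hab, (w.Zl_aux hab _).2]

lemma Zr_aux {a b : Fin ℓ} (hab : a ≠ b) (f : ℂ[X]) :
    w.XX a a * (w.T a b (X * f) * w.XX a b) - (w.T a b (X * f) * w.XX a b) * w.XX a a = 0 ∧
    w.T a b (X * (X * f)) * w.XX a b = - (w.T a b (X * f) * w.T a b X) := by
  have st : ∀ f, w.XX a a * (w.T a b (X * f) * w.XX a b) - (w.T a b (X * f) * w.XX a b) * w.XX a a = 0 →
      w.T a b (X * (X * f)) * w.XX a b = - (w.T a b (X * f) * w.T a b X) := by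
    intro f h
    have c1 := w.br_aa hab 1
    rw [T_one, mul_one] at c1
    rw [comm_mul _ _ _ _ _ (w.br_aa hab (X * f)) c1, smul_mul_assoc, mul_smul_comm, add_comm] at h
    exact two_cancel' h
  have main : w.XX a a * (w.T a b (X * f) * w.XX a b) - (w.T a b (X * f) * w.XX a b) * w.XX a a = 0 := by
    induction f using poly_ind with
    | hadd f g hf hg =>
      rw [mul_add, map_add, add_mul, add_mul, mul_add, add_sub_add_comm, hf, hg, add_zero]
    | hsmul c f hf =>
      rw [mul_smul_comm, map_smul, smul_mul_assoc, smul_mul_assoc, mul_smul_comm, ← smul_sub, hf, smul_zero]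
    | h0 =>
      have y1 := w.YY_comm a b
      have y2 := w.YY_comm a a
      have y3 := w.br_pair hab X
      rw [w.R6 hab, sub_eq_iff_eq_add, ← sub_eq_iff_eq_add', ← pow_two] at y3
      rw [mul_one, ← y3]
      rw [sub_eq_zero] at y1 y2 ⊢
      simp only [mul_sub, sub_mul, smul_sub, mul_smul_comm, smul_mul_assoc, y1, y2]
    | hX f hf =>
      rw [st f hf, mul_neg, neg_mul, neg_sub_neg, ← neg_sub, neg_eq_zero,
        comm_mul _ _ _ _ _ (w.br_aa hab (X * f)) (w.br_aa hab X)]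
      have := w.mid hab f 1
      rw [mul_one] at this
      rw [smul_mul_assoc, mul_smul_comm, this]; simp
  exact ⟨main, st f main⟩

lemma Zr {a b : Fin ℓ} (hab : a ≠ b) (f : ℂ[X]) :
    w.T a b (X * f) * w.XX a b = - (w.T a b (X * (rr * f)) * w.T a b X) := by
  rw [w.T_rr hab, (w.Zr_aux hab _).2]

/-- iterated middle move -/
lemma mid' {a b : Fin ℓ} (hab : a ≠ b) (g f h : ℂ[X]) :
    w.T a b (X * (g * f)) * w.T a b (X * h) = w.T a b (X * f) * w.T a b (X * (g.comp (-X) * h)) := by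
  induction g using poly_ind generalizing f h with
  | hadd g g' hg hg' =>
    rw [add_mul, mul_add, map_add, add_mul, hg, hg', add_comp, add_mul, mul_add X, map_add, mul_add]
  | hsmul c g hg =>
    rw [smul_mul_assoc, mul_smul_comm, map_smul, smul_mul_assoc, hg, smul_comp, smul_mul_assoc,
      mul_smul_comm, map_smul, mul_smul_comm]
  | h0 => simp
  | hX g hg =>
    rw [mul_assoc, w.mid hab, hg, mul_comp, X_comp, ← mul_neg, ← map_neg]; congr 2; ring

lemma triple {a b : Fin ℓ} (hab : a ≠ b) (f g h : ℂ[X]) : ∃ k,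
    w.T a b (X * f) * w.T a b (X * g) * w.T a b (X * h) = w.T a b (X * k) := by
  have z1 : ∀ f, w.T a b (X * f) * w.T a b X * w.T a b (X * rr)
      = w.T a b (X * ((-1/2:ℂ) • ((GG - GG.comp (-X)) * f))) := by
    intro f
    have h1 := w.Zl hab 1
    rw [mul_one, mul_one, w.R6 hab] at h1
    have h2 : w.T a b X * w.T a b (X * rr) = (-1/2:ℂ) • (w.T b b (X^2) - w.T a a (X^2)) := by
      rw [← neg_neg (w.T a b X * w.T a b (X * rr)), ← h1]; module
    rw [mul_assoc, h2, mul_smul_comm, mul_sub, w.R7 hab, w.R7' hab, ← map_sub, ← map_smul]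
    congr 1; simp only [smul_eq_C_mul]; ring
  -- reduce
  have e0 : w.T a b (X * f) * w.T a b (X * g) * w.T a b (X * h)
     = w.T a b (X * (g.comp (-X) * f)) * w.T a b X * w.T a b (X * h) := by
    have := w.mid' hab (g.comp (-X)) f 1
    rw [comp_assoc] at this
    simp only [neg_comp, X_comp, neg_neg, comp_X, mul_one] at this
    rw [this]
  have e1 : ∀ F, w.T a b (X * F) * w.T a b X * w.T a b (X * h)
     = w.T a b (X * (h * F)) * w.T a b X * w.T a b X := by
    intro F
    have m1 := w.mid' hab (h.comp (-X)) 1 1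
    rw [comp_assoc] at m1
    simp only [neg_comp, X_comp, neg_neg, comp_X, mul_one] at m1
    have m2 := w.mid' hab h F 1
    rw [mul_one, mul_one] at m2
    rw [m2, mul_assoc, ← m1, mul_assoc]
  have e2 : ∀ F, w.T a b (X * F) * w.T a b X * w.T a b X
      = w.T a b (X * (X * F)) * w.T a b X * w.T a b (X * rr) := by
    intro F
    have m1 := w.mid' hab (rr.comp (-X)) 1 1
    rw [comp_assoc] at m1
    simp only [neg_comp, X_comp, neg_neg, comp_X, mul_one] at m1
    have m2 := w.mid' hab rr (X * F) 1
    rw [mul_one, mul_one] at m2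
    rw [mul_assoc (w.T a b (X * (X * F))), ← m1, ← mul_assoc, ← m2, w.T_rr hab F]
    congr 4; ring
  rw [e0, e1, e2, z1]
  exact ⟨_, rfl⟩

end WData
end ZhuAux


namespace ZhuAux
open Polynomial
namespace WData
variable {ℓ : ℕ} {V R : Type} [AddCommGroup V] [Module ℂ V] [Ring R] [Algebra ℂ R]
  (w : WData ℓ V R)

def J : Submodule ℂ R := Submodule.span ℂ
  ({x | ∃ a b f, a ≠ b ∧ x = w.T a b (X * f)} ∪
   {x | ∃ a b f g, a ≠ b ∧ x = w.T a b (X * f) * w.T a b (X * g)})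

lemma J1 {a b : Fin ℓ} (hab : a ≠ b) (f : ℂ[X]) : w.T a b (X * f) ∈ w.J :=
  Submodule.subset_span (Or.inl ⟨a, b, f, hab, rfl⟩)
lemma J2 {a b : Fin ℓ} (hab : a ≠ b) (f g : ℂ[X]) : w.T a b (X * f) * w.T a b (X * g) ∈ w.J :=
  Submodule.subset_span (Or.inr ⟨a, b, f, g, hab, rfl⟩)

def K (a b : Fin ℓ) : Submodule ℂ R := Submodule.span ℂ
  {x | (∃ f, x = w.T a b (X * f)) ∨ (∃ c f, c ≠ a ∧ c ≠ b ∧ x = w.T c b (X * f)) ∨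
    (∃ c f, c ≠ a ∧ c ≠ b ∧ x = w.T c a (X * f)) ∨
    (∃ f g, x = w.T a b (X * f) * w.T a b (X * g))}

lemma K1 {a b : Fin ℓ} (f : ℂ[X]) : w.T a b (X * f) ∈ w.K a b :=
  Submodule.subset_span (Or.inl ⟨f, rfl⟩)
lemma K2 {a b c : Fin ℓ} (h1 : c ≠ a) (h2 : c ≠ b) (f : ℂ[X]) : w.T c b (X * f) ∈ w.K a b :=
  Submodule.subset_span (Or.inr (Or.inl ⟨c, f, h1, h2, rfl⟩))
lemma K3 {a b c : Fin ℓ} (h1 : c ≠ a) (h2 : c ≠ b) (f : ℂ[X]) : w.T c a (X * f) ∈ w.K a b :=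
  Submodule.subset_span (Or.inr (Or.inr (Or.inl ⟨c, f, h1, h2, rfl⟩)))
lemma K4 {a b : Fin ℓ} (f g : ℂ[X]) : w.T a b (X * f) * w.T a b (X * g) ∈ w.K a b :=
  Submodule.subset_span (Or.inr (Or.inr (Or.inr ⟨f, g, rfl⟩)))

lemma T_swapX (a b : Fin ℓ) (f : ℂ[X]) : w.T b a (X * f) = w.T a b (X * (-f.comp (-X))) := by
  rw [T_swap]; congr 1; simp

lemma K3' {a b c : Fin ℓ} (h1 : c ≠ a) (h2 : c ≠ b) (f : ℂ[X]) : w.T a c (X * f) ∈ w.K a b := by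
  rw [T_swapX]; exact w.K3 h1 h2 _

lemma mul3 (u v f : ℂ[X]) : u * X * f * v = X * (u * f * v) := by ring
lemma mul2 (u f : ℂ[X]) : u * X * f = X * (u * f) := by ring

lemma K_le_J {a b : Fin ℓ} (hab : a ≠ b) : w.K a b ≤ w.J := by
  refine Submodule.span_le.2 ?_
  rintro x (⟨f, rfl⟩ | ⟨c, f, h1, h2, rfl⟩ | ⟨c, f, h1, h2, rfl⟩ | ⟨f, g, rfl⟩)
  · exact w.J1 hab f
  · exact w.J1 h2 f
  · exact w.J1 h1 f
  · exact w.J2 hab f g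

lemma K_mul {a b : Fin ℓ} (hab : a ≠ b) (g : ℂ[X]) {x : R} (hx : x ∈ w.K a b) :
    x * w.T a b (X * g) ∈ w.J := by
  induction hx using Submodule.span_induction with
  | zero => rw [zero_mul]; exact zero_mem _
  | add x y _ _ hx hy => rw [add_mul]; exact add_mem hx hy
  | smul c x _ hx => rw [smul_mul_assoc]; exact Submodule.smul_mem _ _ hx
  | mem x hx =>
    obtain (⟨f, rfl⟩ | ⟨c, f, h1, h2, rfl⟩ | ⟨c, f, h1, h2, rfl⟩ | ⟨f, h, rfl⟩) := hx
    · exact w.J2 hab _ _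
    · rw [w.T_swapX b a, w.R3c h2 h1 hab.symm, mul3]; exact w.J1 h1 _
    · rw [w.R3c h1 h2 hab, mul3]; exact w.J1 h2 _
    · obtain ⟨k, hk⟩ := w.triple hab f h g
      rw [hk]; exact w.J1 hab _

lemma mul_K {a b : Fin ℓ} (hab : a ≠ b) (g : ℂ[X]) {x : R} (hx : x ∈ w.K a b) :
    w.T a b (X * g) * x ∈ w.J := by
  induction hx using Submodule.span_induction with
  | zero => rw [mul_zero]; exact zero_mem _
  | add x y _ _ hx hy => rw [mul_add]; exact add_mem hx hy
  | smul c x _ hx => rw [mul_smul_comm]; exact Submodule.smul_mem _ _ hx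
  | mem x hx =>
    obtain (⟨f, rfl⟩ | ⟨c, f, h1, h2, rfl⟩ | ⟨c, f, h1, h2, rfl⟩ | ⟨f, h, rfl⟩) := hx
    · exact w.J2 hab _ _
    · rw [w.T_swapX b c, w.R3c hab h1.symm h2.symm, mul3]; exact w.J1 h1.symm _
    · rw [w.T_swapX b a, w.T_swapX a c, w.R3c hab.symm h2.symm h1.symm, mul3]; exact w.J1 h2.symm _
    · obtain ⟨k, hk⟩ := w.triple hab g f h
      rw [← mul_assoc, hk]; exact w.J1 hab _

lemma X_K_aux {a b : Fin ℓ} (hab : a ≠ b) (c d : Fin ℓ) (f : ℂ[X]) (hcd : c ≠ a → d ≠ a → True) :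
    w.XX c d * w.T a b (X * f) ∈ w.K a b := by
  by_cases hcd : c = d
  · subst hcd
    by_cases hca : c = a
    · subst hca; rw [w.R4b hab, mul2]; exact w.K1 _
    by_cases hcb : c = b
    · subst hcb; rw [w.R4a hab, mul2]; exact w.K1 _
    rw [w.R3a (Ne.symm hca) hab hcb, mul2]; exact w.K1 _
  have one : ∀ c d : Fin ℓ, c ≠ d → d = a → w.XX c d * w.T a b (X * f) ∈ w.K a b := by
    rintro c d h rfl
    by_cases hcb : c = b
    · subst hcb
      rw [XX_swap, w.Zl hab]
      refine neg_mem ?_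
      have := w.K4 (a := d) (b := c) 1 (rr * f)
      rwa [mul_one] at this
    · rw [w.R3b h hcb hab, mul2]; exact w.K2 h hcb _
  have two : ∀ c d : Fin ℓ, c ≠ d → d = b → c ≠ a → w.XX c d * w.T a b (X * f) ∈ w.K a b := by
    rintro c d h rfl hca
    rw [T_swapX, w.R3b h hca hab.symm, mul2]; exact w.K3 hca h _
  by_cases hca : c = a
  · rw [XX_swap]; exact one _ _ (Ne.symm hcd) hca
  by_cases hda : d = a
  · exact one _ _ hcd hda
  by_cases hcb : c = b
  · rw [XX_swap]; exact two _ _ (Ne.symm hcd) hcb hda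
  by_cases hdb : d = b
  · exact two _ _ hcd hdb hca
  rw [w.R2x hab (Ne.symm hca) (Ne.symm hda) (Ne.symm hcb) (Ne.symm hdb) hcd]
  exact zero_mem _

lemma X_K {a b : Fin ℓ} (hab : a ≠ b) (c d : Fin ℓ) (f : ℂ[X]) :
    w.XX c d * w.T a b (X * f) ∈ w.K a b := w.X_K_aux hab c d f (fun _ _ => trivial)

lemma K_X {a b : Fin ℓ} (hab : a ≠ b) (c d : Fin ℓ) (f : ℂ[X]) :
    w.T a b (X * f) * w.XX c d ∈ w.K a b := by
  have zr : w.T a b (X * f) * w.XX a b ∈ w.K a b := by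
    rw [w.Zr hab]
    refine neg_mem ?_
    have := w.K4 (a := a) (b := b) (rr * f) 1
    rwa [mul_one] at this
  by_cases h1 : c = a ∧ d = b
  · obtain ⟨rfl, rfl⟩ := h1; exact zr
  by_cases h2 : c = b ∧ d = a
  · obtain ⟨rfl, rfl⟩ := h2; rw [XX_swap]; exact zr
  have hb := w.T_br c d a b (X * f)
  rw [sub_eq_iff_eq_add, ← sub_eq_iff_eq_add'] at hb
  rw [← hb]
  have t1 : ∀ d, d ≠ b → w.T d b (X * (X * f)) ∈ w.K a b := by
    intro d hd
    by_cases h : d = a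
    · subst h; exact w.K1 _
    · exact w.K2 h hd _
  have t2 : ∀ d, d ≠ a → w.T a d (X * (X * f)) ∈ w.K a b := by
    intro d hd
    by_cases h : d = b
    · subst h; exact w.K1 _
    · exact w.K3' hd h _
  refine sub_mem (w.X_K hab c d f) (sub_mem (sub_mem (add_mem ?_ ?_) ?_) ?_)
  · split_ifs with h
    · exact t1 _ (fun h' => h1 ⟨h.symm, h'⟩)
    · exact zero_mem _
  · split_ifs with h
    · exact t1 _ (fun h' => h2 ⟨h', h.symm⟩)
    · exact zero_mem _
  · split_ifs with h
    · exact t2 _ (fun h' => h2 ⟨h.symm, h'⟩)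
    · exact zero_mem _
  · split_ifs with h
    · exact t2 _ (fun h' => h1 ⟨h', h.symm⟩)
    · exact zero_mem _

lemma X_J (c d : Fin ℓ) {x : R} (hx : x ∈ w.J) : w.XX c d * x ∈ w.J := by
  induction hx using Submodule.span_induction with
  | zero => rw [mul_zero]; exact zero_mem _
  | add x y _ _ hx hy => rw [mul_add]; exact add_mem hx hy
  | smul c x _ hx => rw [mul_smul_comm]; exact Submodule.smul_mem _ _ hx
  | mem x hx =>
    obtain (⟨a, b, f, hab, rfl⟩ | ⟨a, b, f, g, hab, rfl⟩) := hx
    · exact w.K_le_J hab (w.X_K hab c d f)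
    · rw [← mul_assoc]; exact w.K_mul hab g (w.X_K hab c d f)

lemma J_X (c d : Fin ℓ) {x : R} (hx : x ∈ w.J) : x * w.XX c d ∈ w.J := by
  induction hx using Submodule.span_induction with
  | zero => rw [zero_mul]; exact zero_mem _
  | add x y _ _ hx hy => rw [add_mul]; exact add_mem hx hy
  | smul c x _ hx => rw [smul_mul_assoc]; exact Submodule.smul_mem _ _ hx
  | mem x hx =>
    obtain (⟨a, b, f, hab, rfl⟩ | ⟨a, b, f, g, hab, rfl⟩) := hx
    · exact w.K_le_J hab (w.K_X hab c d f)
    · rw [mul_assoc]; exact w.mul_K hab f (w.K_X hab c d g)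

/-- span of the matrix units -/
def I0 (p : Fin ℓ → Fin ℓ) : Submodule ℂ R := Submodule.span ℂ
  ({x | ∃ a b, a ≠ b ∧ (x = w.T a b eu ∨ x = w.T a b et)} ∪
   {x | ∃ a, x = w.T a (p a) eu * w.T (p a) a eu ∨ x = w.T a (p a) et * w.T (p a) a et})

lemma I0_le (p : Fin ℓ → Fin ℓ) (hp : ∀ a, p a ≠ a) : w.J ≤ w.I0 p := by
  have u1 : ∀ {a b : Fin ℓ}, a ≠ b → w.T a b eu ∈ w.I0 p := fun {a b} h =>
    Submodule.subset_span (Or.inl ⟨a, b, h, Or.inl rfl⟩)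
  have t1 : ∀ {a b : Fin ℓ}, a ≠ b → w.T a b et ∈ w.I0 p := fun {a b} h =>
    Submodule.subset_span (Or.inl ⟨a, b, h, Or.inr rfl⟩)
  -- multiplication of matrix units
  have mulE : ∀ {z : ℂ} {q : ℂ[X]}, Eig z q → ∀ {a b c : Fin ℓ}, a ≠ b → a ≠ c → b ≠ c →
      w.T a b q * w.T b c q = (q.eval z * h1.eval z) • w.T a c q := by
    intro z q hq a b c hab hac hbc
    obtain ⟨q', hq'⟩ := hq.dvd
    have := w.R3c hab hac hbc q' q
    rw [← hq', show h1 * X * q' * q = (q * h1) * q by rw [hq']; ring, hq.T w hac, eval_mul] at this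
    exact this
  have diag : ∀ {z : ℂ} {q : ℂ[X]}, Eig z q → q.eval z * h1.eval z ≠ 0 → ∀ {a b c : Fin ℓ},
      a ≠ b → a ≠ c → w.T a b q * w.T b a q = w.T a c q * w.T c a q := by
    intro z q hq hne a b c hab hac
    by_cases hbc : b = c
    · subst hbc; rfl
    have m1 := mulE hq hac hab (Ne.symm hbc)
    have m2 := mulE hq (Ne.symm hbc) hac.symm hab.symm
    apply smul_right_injective R hne
    simp only []
    rw [← smul_mul_assoc, ← m1, ← mul_smul_comm, ← m2, mul_assoc]
  have nu : eu.eval 1 * h1.eval 1 ≠ 0 := by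
    simp [eu, h1]; norm_num
  have nt : et.eval (1/2) * h1.eval (1/2) ≠ 0 := by
    simp [et, h1]; norm_num
  have u2 : ∀ {a b : Fin ℓ}, a ≠ b → w.T a b eu * w.T b a eu ∈ w.I0 p := fun {a b} h => by
    rw [diag Eig_u nu h (hp a).symm]; exact Submodule.subset_span (Or.inr ⟨a, Or.inl rfl⟩)
  have t2 : ∀ {a b : Fin ℓ}, a ≠ b → w.T a b et * w.T b a et ∈ w.I0 p := fun {a b} h => by
    rw [diag Eig_t nt h (hp a).symm]; exact Submodule.subset_span (Or.inr ⟨a, Or.inr rfl⟩)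
  have orth : ∀ {z z' : ℂ} {q q' : ℂ[X]}, Eig z q → Eig z' q' → z + z' ≠ 0 → ∀ {a b : Fin ℓ}, a ≠ b →
      w.T a b q * w.T a b q' = 0 := by
    intro z z' q q' hq hq' hne a b hab
    obtain ⟨f, hf⟩ := hq.dvd
    obtain ⟨g, hg⟩ := hq'.dvd
    have := w.mid hab f g
    rw [← hf, ← hg, hq.T w hab, hq'.T w hab, eval_X, eval_X, smul_mul_assoc, mul_smul_comm,
      eq_neg_iff_add_eq_zero, ← add_smul] at this
    exact (smul_eq_zero.1 this).resolve_left hne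
  refine Submodule.span_le.2 ?_
  rintro x (⟨a, b, f, hab, rfl⟩ | ⟨a, b, f, g, hab, rfl⟩)
  · rw [SetLike.mem_coe, w.T_X_decomp hab, ← w.T_swap a b, ← w.T_swap a b]
    exact sub_mem (add_mem (sub_mem (Submodule.smul_mem _ _ (u1 hab)) (Submodule.smul_mem _ _ (u1 hab.symm)))
      (Submodule.smul_mem _ _ (t1 hab))) (Submodule.smul_mem _ _ (t1 hab.symm))
  · rw [SetLike.mem_coe, w.T_X_decomp hab, w.T_X_decomp hab g]
    have o11 := orth Eig_u Eig_u (by norm_num) hab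
    have o12 := w.T_swap a b eu
    have o13 := orth Eig_u Eig_t (by norm_num) hab
    have o14 := orth Eig_u Eig_t.neg (by norm_num) hab
    have o22 := orth Eig_u.neg Eig_u.neg (by norm_num) hab
    have o23 := orth Eig_u.neg Eig_t (by norm_num) hab
    have o24 := orth Eig_u.neg Eig_t.neg (by norm_num) hab
    have o31 := orth Eig_t Eig_u (by norm_num) hab
    have o32 := orth Eig_t Eig_u.neg (by norm_num) hab
    have o33 := orth Eig_t Eig_t (by norm_num) hab
    have o34 := w.T_swap a b et
    have o41 := orth Eig_t.neg Eig_u (by norm_num) hab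
    have o42 := orth Eig_t.neg Eig_u.neg (by norm_num) hab
    have o44 := orth Eig_t.neg Eig_t.neg (by norm_num) hab
    rw [← o12] at o22 o23 o24 o32 o42
    rw [← o34] at o14 o24 o41 o42 o44
    simp only [mul_add, add_mul, mul_sub, sub_mul, smul_mul_assoc, mul_smul_comm, o11, o13, o14, o22, o23,
      o24, o31, o32, o33, o41, o42, o44, smul_zero, sub_zero, zero_sub, add_zero, zero_add, ← o12, ← o34]
    have s1 := u2 hab
    have s2 := u2 hab.symm
    have s3 := t2 hab
    have s4 := t2 hab.symm
    have sm := fun (c : ℂ) {x} (h : x ∈ w.I0 p) => Submodule.smul_mem (w.I0 p) c h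
    first
    | (repeat' first | apply sub_mem | apply add_mem | apply neg_mem | apply sm) <;> assumption

lemma XX_comm_J (a b c d : Fin ℓ) : w.XX a b * w.XX c d - w.XX c d * w.XX a b ∈ w.J := by
  rw [← w.T_one c d, T_br]
  have t : ∀ u v : Fin ℓ, w.T u v (X * 1) ∈ w.J := by
    intro u v
    by_cases h : u = v
    · subst h; rw [mul_one, w.T_odd u X (by simp)]; exact zero_mem _
    · exact w.J1 h _
  refine sub_mem (sub_mem (add_mem ?_ ?_) ?_) ?_ <;> split_ifs <;> first | exact t _ _ | exact zero_mem _

noncomputable def lam : ℂ[X] := C 4 * ((X^2 - 1) * (X^2 - C (1/4)))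

lemma lam_comm {a b : Fin ℓ} (hab : a ≠ b) (c d : Fin ℓ) :
    w.XX c d * w.T a b lam - w.T a b lam * w.XX c d = 0 := by
  have t : ∀ u v : Fin ℓ, w.T u v (X * lam) = 0 := by
    intro u v
    by_cases h : u = v
    · subst h; exact w.T_odd u _ (by simp [lam])
    · rw [← w.R5 h (C 4)]; congr 1; simp only [lam, PP]; ring
  rw [T_br]; simp [t]

lemma lam_J {a b : Fin ℓ} (hab : a ≠ b) : w.T a b lam - w.XX a b ∈ w.J := by
  rw [← T_one, ← map_sub]
  have : lam - 1 = X * (C 4 * X^3 - C 5 * X) := by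
    apply Polynomial.funext; intro r; simp [lam]; ring
  rw [this]; exact w.J1 hab _

end WData
end ZhuAux


namespace ZhuAux
open Polynomial
namespace WData
variable {ℓ : ℕ} {V R : Type} [AddCommGroup V] [Module ℂ V] [Ring R] [Algebra ℂ R]
  (w : WData ℓ V R)

/-- spans of words of a given length -/
def Sp : ℕ → Submodule ℂ V
  | 0 => Submodule.span ℂ {w.one}
  | n + 1 => Submodule.span ℂ {v | ∃ a f x, x ∈ Sp n ∧ v = w.op a f x}

lemma Sp_one : w.one ∈ w.Sp 0 := Submodule.subset_span rfl
lemma Sp_op (a f) {n x} (hx : x ∈ w.Sp n) : w.op a f x ∈ w.Sp (n+1) :=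
  Submodule.subset_span ⟨a, f, x, hx, rfl⟩

lemma Sp_ind {n : ℕ} {p : V → Prop} (h0 : p 0) (hadd : ∀ x y, p x → p y → p (x + y))
    (hsmul : ∀ (c : ℂ) x, p x → p (c • x)) (hop : ∀ a f x, x ∈ w.Sp n → p (w.op a f x))
    {x : V} (hx : x ∈ w.Sp (n+1)) : p x := by
  rw [Sp] at hx
  induction hx using Submodule.span_induction with
  | zero => exact h0
  | add x y _ _ hx hy => exact hadd _ _ hx hy
  | smul c x _ hx => exact hsmul _ _ hx
  | mem x hx => obtain ⟨a, f, y, hy, rfl⟩ := hx; exact hop a f y hy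

lemma Do_Sp (a b) {n x} (hx : x ∈ w.Sp n) : w.Do a b x ∈ w.Sp n := by
  induction n generalizing x with
  | zero =>
    rw [Sp] at hx
    obtain ⟨c, rfl⟩ := Submodule.mem_span_singleton.1 hx
    rw [map_smul, Do_one, smul_zero]; exact zero_mem _
  | succ n ih =>
    refine w.Sp_ind (p := fun x => w.Do a b x ∈ w.Sp (n+1)) ?_ ?_ ?_ ?_ hx
    · rw [map_zero]; exact zero_mem _
    · intro x y hx hy; rw [map_add]; exact add_mem hx hy
    · intro c x hx; rw [map_smul]; exact Submodule.smul_mem _ _ hx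
    · intro c f x hx
      rw [Do_op]
      refine add_mem (add_mem (w.Sp_op _ _ (ih hx)) ?_) ?_
      · split_ifs; exacts [w.Sp_op _ _ hx, zero_mem _]
      · split_ifs; exacts [w.Sp_op _ _ hx, zero_mem _]

lemma Lo_Sp (a b) {n x} (hx : x ∈ w.Sp n) :
    w.Lo a b x - w.op a (e 0) (w.op b (e 0) x) ∈ w.Sp n := by
  induction n generalizing x with
  | zero =>
    rw [Sp] at hx
    obtain ⟨c, rfl⟩ := Submodule.mem_span_singleton.1 hx
    simp only [map_smul, Lo_one', sub_self]; exact zero_mem _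
  | succ n ih =>
    refine w.Sp_ind (p := fun x => w.Lo a b x - w.op a (e 0) (w.op b (e 0) x) ∈ w.Sp (n+1)) ?_ ?_ ?_ ?_ hx
    · simp only [map_zero, sub_zero]; exact zero_mem _
    · intro x y hx hy; simp only [map_add]; rw [add_sub_add_comm]; exact add_mem hx hy
    · intro c x hx; simp only [map_smul]; rw [← smul_sub]; exact Submodule.smul_mem _ _ hx
    · intro c f x hx
      rw [Lo_op, w.op_comm b c, w.op_comm a c, add_sub_right_comm, add_sub_right_comm, ← map_sub]
      refine add_mem (add_mem (w.Sp_op _ _ (ih hx)) ?_) ?_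
      · split_ifs; exacts [w.Sp_op _ _ hx, zero_mem _]
      · split_ifs; exacts [w.Sp_op _ _ hx, zero_mem _]

noncomputable def G : Subalgebra ℂ R := Algebra.adjoin ℂ {x | ∃ a b, x = w.XX a b}

lemma G_X (a b) : w.XX a b ∈ w.G := Algebra.subset_adjoin ⟨a, b, rfl⟩

lemma G_Do (a b) {x : V} (h : w.q x ∈ w.G) : w.q (w.Do a b x) ∈ w.G := by
  rw [← X_br]; exact sub_mem (mul_mem (w.G_X a b) h) (mul_mem h (w.G_X a b))

lemma G_half {x : R} (h : x + x ∈ w.G) : x ∈ w.G := by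
  have : x = (1/2:ℂ) • (x + x) := by module
  rw [this]; exact Subalgebra.smul_mem _ h _

section step
variable {m : ℕ} (hm : ∀ x ∈ w.Sp m, w.q x ∈ w.G)
include hm

lemma st1 (a b) {x} (hx : x ∈ w.Sp m) : w.q (w.op a (e 0) (w.op b (e 0) x)) ∈ w.G := by
  have h := hm _ (w.Lo_Sp a b hx)
  rw [map_sub, ← X_mul] at h
  have := sub_mem (mul_mem (w.G_X a b) (hm x hx)) h
  rwa [sub_sub_cancel] at this

lemma st2 {a b : Fin ℓ} (hab : a ≠ b) (f g : Lam) : ∀ {x}, x ∈ w.Sp m →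
    w.q (w.op a f (w.op b g x)) ∈ w.G := by
  have D1 : ∀ {a b : Fin ℓ}, a ≠ b → ∀ f g, (∀ {x}, x ∈ w.Sp m → w.q (w.op a f (w.op b g x)) ∈ w.G) →
      ∀ {x}, x ∈ w.Sp m → w.q (w.op a (DL f) (w.op b g x)) ∈ w.G := by
    intro a b hab f g H x hx
    have h := w.G_Do a a (H hx)
    simp only [Do_op, hab.symm, if_true, if_false, add_zero, map_add] at h
    have h2 := sub_mem h (H (w.Do_Sp a a hx))
    apply w.G_half
    convert h2 using 1; abel
  induction f using lam_Dind with
  | hadd f f' hf hf' =>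
    intro x hx
    rw [map_add, LinearMap.add_apply, map_add]; exact add_mem (hf hx) (hf' hx)
  | hsmul c f hf =>
    intro x hx
    rw [map_smul, LinearMap.smul_apply, map_smul]; exact Subalgebra.smul_mem _ (hf hx) _
  | hD f hf => exact D1 hab f g hf
  | h0 =>
    induction g using lam_Dind with
    | hadd f f' hf hf' =>
      intro x hx
      rw [map_add, LinearMap.add_apply, map_add, map_add]; exact add_mem (hf hx) (hf' hx)
    | hsmul c f hf =>
      intro x hx
      rw [map_smul, LinearMap.smul_apply, map_smul, map_smul]; exact Subalgebra.smul_mem _ (hf hx) _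
    | h0 => exact fun hx => w.st1 hm a b hx
    | hD g hg =>
      intro x hx
      rw [op_comm]
      refine D1 hab.symm g (e 0) ?_ hx
      intro x hx
      rw [op_comm]; exact hg hx

end step

lemma st3 {m : ℕ} (hm : ∀ x ∈ w.Sp (m+1), w.q x ∈ w.G) (p : Fin ℓ → Fin ℓ) (hp : ∀ a, p a ≠ a) :
    ∀ x ∈ w.Sp (m+3), w.q x ∈ w.G := by
  have lin : ∀ (L : V →ₗ[ℂ] V) {n}, (∀ a f x, x ∈ w.Sp n → w.q (L (w.op a f x)) ∈ w.G) →
      ∀ x ∈ w.Sp (n+1), w.q (L x) ∈ w.G := by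
    intro L n h x hx
    refine w.Sp_ind (p := fun x => w.q (L x) ∈ w.G) ?_ ?_ ?_ ?_ hx
    · simp
    · intro x y hx hy; rw [map_add, map_add]; exact add_mem hx hy
    · intro c x hx; rw [map_smul, map_smul]; exact Subalgebra.smul_mem _ hx _
    · exact h
  have same : ∀ (a : Fin ℓ) (f g h : Lam) (y : V), y ∈ w.Sp m →
      w.q (w.op a f (w.op a g (w.op a h y))) ∈ w.G := by
    intro a f g h y hy
    have hb := (hp a).symm
    generalize p a = b at hb
    have hx := w.Sp_op a h hy
    have D : ∀ f g, w.q (w.op a f (w.op a (DL g) (w.op a h y))) ∈ w.G := by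
      intro f g
      have h1 := w.G_Do a b (w.st2 hm hb f g hx)
      rw [Do_op, Do_op] at h1
      simp only [hb, hb.symm, if_true, if_false, add_zero, map_add] at h1
      have h2 := w.st2 hm hb f g (w.Do_Sp a b hx)
      have h3 : w.q (w.op b (DL f) (w.op b g (w.op a h y))) ∈ w.G := by
        rw [w.op_comm b a, w.op_comm b a]
        exact w.st2 hm hb h (DL f) (w.Sp_op b g hy)
      have := sub_mem (sub_mem h1 h2) h3
      convert this using 1; abel
    induction g using lam_Dind with
    | hadd f f' hf hf' => rw [map_add, LinearMap.add_apply, map_add, map_add]; exact add_mem hf hf'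
    | hsmul c f hf => rw [map_smul, LinearMap.smul_apply, map_smul, map_smul]; exact Subalgebra.smul_mem _ hf _
    | hD g hg => exact D f g
    | h0 =>
      induction f using lam_Dind with
      | hadd f f' hf hf' => rw [map_add, LinearMap.add_apply, map_add]; exact add_mem hf hf'
      | hsmul c f hf => rw [map_smul, LinearMap.smul_apply, map_smul]; exact Subalgebra.smul_mem _ hf _
      | hD g hg => rw [op_comm]; exact D _ _
      | h0 => exact w.st1 hm a a hx
  refine lin LinearMap.id ?_
  intro a f x hx
  refine lin (w.op a f) ?_ x hx
  intro b g x hx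
  by_cases hab : a = b
  · subst hab
    refine lin (w.op a f ∘ₗ w.op a g) ?_ x hx
    intro c h x hx
    by_cases hac : a = c
    · subst hac; exact same a f g h x hx
    · simp only [LinearMap.comp_apply]
      rw [w.op_comm a c]
      exact w.st2 hm hac f h (w.Sp_op a g hx)
  · exact w.st2 hm hab f g hx

lemma st0 (x) (hx : x ∈ w.Sp 0) : w.q x ∈ w.G := by
  rw [Sp] at hx
  obtain ⟨c, rfl⟩ := Submodule.mem_span_singleton.1 hx
  rw [map_smul, w.q_one]; exact Subalgebra.smul_mem _ (one_mem _) _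

lemma st1' (x) (hx : x ∈ w.Sp 1) : w.q x ∈ w.G := by
  refine w.Sp_ind (p := fun x => w.q x ∈ w.G) ?_ ?_ ?_ ?_ hx
  · simp
  · intro x y hx hy; rw [map_add]; exact add_mem hx hy
  · intro c x hx; rw [map_smul]; exact Subalgebra.smul_mem _ hx _
  · intro a f x hx
    rw [Sp] at hx
    obtain ⟨c, rfl⟩ := Submodule.mem_span_singleton.1 hx
    rw [map_smul, map_smul]; refine Subalgebra.smul_mem _ ?_ _
    induction f using lam_ind with
    | hadd f f' hf hf' => rw [map_add, LinearMap.add_apply, map_add]; exact add_mem hf hf'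
    | hsmul c f hf => rw [map_smul, LinearMap.smul_apply, map_smul]; exact Subalgebra.smul_mem _ hf _
    | he n => rw [op_e, w.odd]; exact zero_mem _

lemma sg_ne_mem {a b : Fin ℓ} (hab : a ≠ b) (f g) : w.sg a f b g ∈ w.G :=
  w.st2 w.st0 hab f g w.Sp_one

lemma tau_mem (p : Fin ℓ → Fin ℓ) (hp : ∀ a, p a ≠ a) (n : ℕ) :
    ∀ a, w.sg a (e n) a (e 0) ∈ w.G := by
  induction n using Nat.strong_induction_on with
  | _ n ih =>
  intro a
  rcases n with _ | _ | m
  · exact w.G_X a a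
  · have h := w.T_odd a X (by simp)
    rw [T_def, lt_X1, sg_add_left, add_eq_zero_iff_eq_neg] at h
    rw [zero_add, h]; exact neg_mem (w.G_X a a)
  · have hb := (hp a).symm
    generalize p a = b at hb
    have sm := fun (c : ℂ) {x : R} (h : x ∈ w.G) => Subalgebra.smul_mem w.G h c
    have i0 := ih m (by omega)
    have i1 := ih (m+1) (by omega)
    have hDR : ∀ f : Lam, w.sg a f a (DL (e 0)) = - w.sg a (DL f) a (e 0) :=
      fun f => eq_neg_of_add_eq_zero_right (w.tot_word2 a f a (e 0))
    have hDR2 : ∀ f : Lam, w.sg a f a (DL (DL (e 0))) = w.sg a (DL (DL f)) a (e 0) := by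
      intro f
      rw [eq_neg_of_add_eq_zero_right (w.tot_word2 a f a (DL (e 0))), hDR, neg_neg]
    -- difference
    have hd : w.sg b (e (m+2)) b (e 0) - w.sg a (e (m+2)) a (e 0) ∈ w.G := by
      have h1 := w.G_Do a b (w.sg_ne_mem hb (e (m+1)) (e 0))
      rw [Do_op, Do_op, Do_one] at h1
      simp only [hb, hb.symm, if_true, if_false, add_zero, map_add, map_zero, zero_add] at h1
      change w.sg a (e (m+1)) a (DL (e 0)) + w.sg b (DL (e (m+1))) b (e 0) ∈ w.G at h1
      rw [hDR, DL_e, sg_smul_left, sg_smul_left, sg_add_left, sg_add_left] at h1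
      have hne : (((m+1 : ℕ) : ℂ) + 1) ≠ 0 := by exact_mod_cast Nat.succ_ne_zero (m+1)
      have h2 := sub_mem (sm ((((m+1 : ℕ) : ℂ) + 1)⁻¹) h1) (sub_mem (i1 b) (i1 a))
      convert h2 using 1
      rw [smul_add, smul_neg, smul_smul, smul_smul, inv_mul_cancel₀ hne]
      simp only [one_smul]; abel
    have A1 := w.X_sg a b a b (e m) (e 0)
    have A2 := w.X_sg b b a a (e m) (e 0)
    simp only [hb, hb.symm, if_true, if_false, add_zero] at A1 A2
    have n1 : w.W4 a (e 0) b (e 0) a (e m) b (e 0) = w.W4 b (e 0) b (e 0) a (e m) a (e 0) := by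
      simp only [W4, w.op_comm]
    have hS0 : SL (e 0) = (1/2:ℂ) • (DL (DL (e 0)) + DL (e 0)) := by
      simp only [SL_e, DL_e, map_smul, map_add]; push_cast; module
    rw [n1, ← A2, hS0, sg_smul_right, sg_add_right, hDR, hDR2] at A1
    simp only [SL_e, DL_e, map_smul, map_add, sg_smul_left, sg_add_left] at A1
    have key := mul_mem (w.G_X a b) (w.sg_ne_mem hb (e m) (e 0))
    rw [A1] at key
    have k2 := mul_mem (w.G_X b b) (i0 a)
    have hne : ((m:ℂ) + 1) * (1 + (m + 2)/2) ≠ 0 := by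
      have : ((m:ℂ) + 1) * (1 + (m + 2)/2) = (((m+1)*(m+4) : ℕ) : ℂ)/2 := by push_cast; ring
      rw [this]
      refine div_ne_zero ?_ two_ne_zero
      exact_mod_cast (by positivity : (m+1)*(m+4) ≠ 0)
    have fin : (((m:ℂ) + 1) * (1 + (m + 2)/2)) • w.sg a (e (m+2)) a (e 0) ∈ w.G := by
      have := sub_mem (sub_mem (sub_mem (sub_mem key k2) (sm ((m:ℂ)+1) hd))
        (add_mem (sm (2*((m:ℂ)+1)) (i1 b)) (sm ((m:ℂ)+1) (i0 b))))
        (add_mem (sm ((m+1)*(m+1):ℂ) (i1 a)) (sm ((m+1)*m/2:ℂ) (i0 a)))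
      convert this using 1
      push_cast
      module
    have := sm ((((m:ℂ) + 1) * (1 + (m + 2)/2))⁻¹) fin
    rwa [smul_smul, inv_mul_cancel₀ hne, one_smul] at this

lemma st2' (p : Fin ℓ → Fin ℓ) (hp : ∀ a, p a ≠ a) (x) (hx : x ∈ w.Sp 2) : w.q x ∈ w.G := by
  have T_mem : ∀ a f, w.T a a f ∈ w.G := by
    intro a f
    rw [T_def]
    generalize lt f = g
    induction g using lam_ind with
    | hadd f f' hf hf' => rw [sg_add_left]; exact add_mem hf hf'
    | hsmul c f hf => rw [sg_smul_left]; exact Subalgebra.smul_mem _ hf _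
    | he n => exact w.tau_mem p hp n a
  have sgm : ∀ a f b g, w.sg a f b g ∈ w.G := by
    intro a f b g
    by_cases hab : a = b
    · subst hab
      induction f using lam_ind with
      | hadd f f' hf hf' => rw [sg_add_left]; exact add_mem hf hf'
      | hsmul c f hf => rw [sg_smul_left]; exact Subalgebra.smul_mem _ hf _
      | he n =>
        induction g using lam_ind with
        | hadd f f' hf hf' => rw [sg_add_right]; exact add_mem hf hf'
        | hsmul c f hf => rw [sg_smul_right]; exact Subalgebra.smul_mem _ hf _
        | he m =>
          obtain ⟨f, hf⟩ := lt_e n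
          obtain ⟨g, hg⟩ := lt_e m
          rw [← hf, ← hg, sg_T]; exact T_mem _ _
    · exact w.sg_ne_mem hab f g
  refine w.Sp_ind (p := fun x => w.q x ∈ w.G) ?_ ?_ ?_ ?_ hx
  · simp
  · intro x y hx hy; rw [map_add]; exact add_mem hx hy
  · intro c x hx; rw [map_smul]; exact Subalgebra.smul_mem _ hx _
  · intro a f x hx
    refine w.Sp_ind (p := fun x => w.q (w.op a f x) ∈ w.G) ?_ ?_ ?_ ?_ hx
    · simp
    · intro x y hx hy; rw [map_add, map_add]; exact add_mem hx hy
    · intro c x hx; rw [map_smul, map_smul]; exact Subalgebra.smul_mem _ hx _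
    · intro b g x hx
      rw [Sp] at hx
      obtain ⟨c, rfl⟩ := Submodule.mem_span_singleton.1 hx
      simp only [map_smul]
      exact Subalgebra.smul_mem _ (sgm a f b g) _

lemma G_top (p : Fin ℓ → Fin ℓ) (hp : ∀ a, p a ≠ a) (r : R) : r ∈ w.G := by
  have all : ∀ n, ∀ x ∈ w.Sp n, w.q x ∈ w.G := by
    intro n
    induction n using Nat.strong_induction_on with
    | _ n ih =>
    rcases n with _ | _ | _ | m
    · exact w.st0
    · exact w.st1'
    · exact w.st2' p hp
    · exact w.st3 (ih (m+1) (by omega)) p hp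
  obtain ⟨x, rfl⟩ := w.q_surj r
  have hx : x ∈ Submodule.span ℂ {v | ∃ L : List (Fin ℓ × ℕ), v = L.foldr (fun p x => w.H p.1 p.2 x) w.one} := by
    rw [w.span]; trivial
  induction hx using Submodule.span_induction with
  | zero => simp
  | add x y _ _ hx hy => rw [map_add]; exact add_mem hx hy
  | smul c x _ hx => rw [map_smul]; exact Subalgebra.smul_mem _ hx _
  | mem x hx =>
    obtain ⟨L, rfl⟩ := hx
    refine all L.length _ ?_
    induction L with
    | nil => exact w.Sp_one
    | cons p L ih =>
      rw [List.foldr_cons, ← op_e]; exact w.Sp_op _ _ ih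

/-- abstract main result -/
lemma main_comm (p : Fin ℓ → Fin ℓ) (hp : ∀ a, p a ≠ a) (x y : R) : x * y - y * x ∈ w.J := by
  have JL : ∀ r : R, ∀ j ∈ w.J, r * j ∈ w.J := by
    intro r
    have hr := w.G_top p hp r
    rw [G] at hr
    induction hr using Algebra.adjoin_induction with
    | mem x hx => obtain ⟨a, b, rfl⟩ := hx; exact fun j hj => w.X_J a b hj
    | algebraMap c => intro j hj; rw [← Algebra.smul_def]; exact Submodule.smul_mem _ _ hj
    | add x y _ _ hx hy => intro j hj; rw [add_mul]; exact add_mem (hx j hj) (hy j hj)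
    | mul x y _ _ hx hy => intro j hj; rw [mul_assoc]; exact hx _ (hy j hj)
  have JR : ∀ r : R, ∀ j ∈ w.J, j * r ∈ w.J := by
    intro r
    have hr := w.G_top p hp r
    rw [G] at hr
    induction hr using Algebra.adjoin_induction with
    | mem x hx => obtain ⟨a, b, rfl⟩ := hx; exact fun j hj => w.J_X a b hj
    | algebraMap c =>
      intro j hj; rw [← Algebra.commutes, ← Algebra.smul_def]; exact Submodule.smul_mem _ _ hj
    | add x y _ _ hx hy => intro j hj; rw [mul_add]; exact add_mem (hx j hj) (hy j hj)
    | mul x y _ _ hx hy => intro j hj; rw [← mul_assoc]; exact hy _ (hx j hj)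
  have s1 : ∀ a b, ∀ y, w.XX a b * y - y * w.XX a b ∈ w.J := by
    intro a b y
    have hr := w.G_top p hp y
    rw [G] at hr
    induction hr using Algebra.adjoin_induction with
    | mem x hx => obtain ⟨c, d, rfl⟩ := hx; exact w.XX_comm_J a b c d
    | algebraMap c => rw [← Algebra.commutes, sub_self]; exact zero_mem _
    | add x y _ _ hx hy => rw [mul_add, add_mul, add_sub_add_comm]; exact add_mem hx hy
    | mul x y _ _ hx hy =>
      rw [comm_mul _ _ _ _ _ rfl rfl]; exact add_mem (JR _ _ hx) (JL _ _ hy)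
  have hr := w.G_top p hp x
  rw [G] at hr
  induction hr using Algebra.adjoin_induction with
  | mem x hx => obtain ⟨a, b, rfl⟩ := hx; exact s1 a b y
  | algebraMap c => rw [← Algebra.commutes, sub_self]; exact zero_mem _
  | add x y _ _ hx hy => rw [mul_add, add_mul, add_sub_add_comm]; exact add_mem hx hy
  | mul u v _ _ hx hy =>
    have : u * v * y - y * (u * v) = u * (v * y - y * v) + (u * y - y * u) * v := by noncomm_ring
    rw [this]; exact add_mem (JL _ _ hy) (JR _ _ hx)

lemma main_central (p : Fin ℓ → Fin ℓ) (hp : ∀ a, p a ≠ a) {a b : Fin ℓ} (hab : a ≠ b) (x : R) :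
    w.T a b lam * x - x * w.T a b lam = 0 := by
  have hr := w.G_top p hp x
  rw [G] at hr
  induction hr using Algebra.adjoin_induction with
  | mem x hx =>
    obtain ⟨c, d, rfl⟩ := hx
    rw [← neg_sub, w.lam_comm hab, neg_zero]
  | algebraMap c => rw [← Algebra.commutes, sub_self]
  | add x y _ _ hx hy => rw [mul_add, add_mul, add_sub_add_comm, hx, hy, add_zero]
  | mul u v _ _ hx hy => rw [comm_mul _ _ _ _ _ hx hy]; simp

lemma main_gen (p : Fin ℓ → Fin ℓ) (hp : ∀ a, p a ≠ a) (S : Set R)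
    (h1 : ∀ a, (1/2:ℂ) • w.XX a a ∈ S) (h2 : ∀ a b, a ≠ b → w.T a b lam ∈ S) (x : R) :
    ∃ y ∈ Algebra.adjoin ℂ S, x - y ∈ w.J := by
  have JL : ∀ r : R, ∀ j ∈ w.J, r * j ∈ w.J := by
    intro r
    have hr := w.G_top p hp r
    rw [G] at hr
    induction hr using Algebra.adjoin_induction with
    | mem x hx => obtain ⟨a, b, rfl⟩ := hx; exact fun j hj => w.X_J a b hj
    | algebraMap c => intro j hj; rw [← Algebra.smul_def]; exact Submodule.smul_mem _ _ hj
    | add x y _ _ hx hy => intro j hj; rw [add_mul]; exact add_mem (hx j hj) (hy j hj)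
    | mul x y _ _ hx hy => intro j hj; rw [mul_assoc]; exact hx _ (hy j hj)
  have JR : ∀ r : R, ∀ j ∈ w.J, j * r ∈ w.J := by
    intro r
    have hr := w.G_top p hp r
    rw [G] at hr
    induction hr using Algebra.adjoin_induction with
    | mem x hx => obtain ⟨a, b, rfl⟩ := hx; exact fun j hj => w.J_X a b hj
    | algebraMap c =>
      intro j hj; rw [← Algebra.commutes, ← Algebra.smul_def]; exact Submodule.smul_mem _ _ hj
    | add x y _ _ hx hy => intro j hj; rw [mul_add]; exact add_mem (hx j hj) (hy j hj)
    | mul x y _ _ hx hy => intro j hj; rw [← mul_assoc]; exact hy _ (hx j hj)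
  have hr := w.G_top p hp x
  rw [G] at hr
  induction hr using Algebra.adjoin_induction with
  | mem x hx =>
    obtain ⟨a, b, rfl⟩ := hx
    by_cases hab : a = b
    · subst hab
      refine ⟨w.XX a a, ?_, by simp⟩
      have : w.XX a a = (2:ℂ) • (1/2:ℂ) • w.XX a a := by module
      rw [this]
      exact Subalgebra.smul_mem _ (Algebra.subset_adjoin (h1 a)) _
    · refine ⟨_, Algebra.subset_adjoin (h2 a b hab), ?_⟩
      rw [← neg_sub]; exact neg_mem (w.lam_J hab)
  | algebraMap c => exact ⟨_, Subalgebra.algebraMap_mem _ c, by simp⟩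
  | add x y _ _ hx hy =>
    obtain ⟨x', hx', hx⟩ := hx; obtain ⟨y', hy', hy⟩ := hy
    exact ⟨_, add_mem hx' hy', by rw [add_sub_add_comm]; exact add_mem hx hy⟩
  | mul x y _ _ hx hy =>
    obtain ⟨x', hx', hx⟩ := hx; obtain ⟨y', hy', hy⟩ := hy
    refine ⟨_, mul_mem hx' hy', ?_⟩
    have : x * y - x' * y' = (x - x') * y + x' * (y - y') := by noncomm_ring
    rw [this]; exact add_mem (JR _ _ hx) (JL _ _ hy)

end WData
end ZhuAux


namespace ZhuAux
variable {ℓ : ℕ} {V : Type} [AddCommGroup V] [Module ℂ V]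

lemma word_wt (A : VOA V) (hgen : Fin ℓ → V) (h : IsHeisenberg A hgen) (L : List (Fin ℓ × ℕ+)) :
    ∃ k : ℕ, wordAct (fun a k w => A.Y (hgen a) k w) L A.one ∈ A.wt k ∧ (L ≠ [] → 1 ≤ k) := by
  induction L with
  | nil => exact ⟨0, by simpa [wordAct] using A.one_wt, by simp⟩
  | cons x L ih =>
    obtain ⟨a, n⟩ := x
    obtain ⟨k, hk, -⟩ := ih
    refine ⟨k + n, ?_, fun _ => by have := n.pos; omega⟩
    have := A.mode_wt 1 (hgen a) (h.wt_one a) k (-((n:ℕ):ℤ)) _ hk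
    have e : (k:ℤ) + 1 - (-((n:ℕ):ℤ)) - 1 = ((k + (n:ℕ) : ℕ) : ℤ) := by push_cast; ring
    rw [e] at this
    exact this

lemma word_ind (A : VOA V) (hgen : Fin ℓ → V) (h : IsHeisenberg A hgen) {p : V → Prop} (x : V)
    (hz : p 0) (hadd : ∀ u v, p u → p v → p (u + v)) (hsm : ∀ (c : ℂ) u, p u → p (c • u))
    (hw : ∀ L, p (wordAct (fun a k w => A.Y (hgen a) k w) L A.one)) : p x := by
  have hx : x ∈ Submodule.span ℂ
      {v : V | ∃ L : List (Fin ℓ × ℕ+),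
        v = wordAct (fun a k w => A.Y (hgen a) k w) L A.one} := by rw [h.span_words]; trivial
  induction hx using Submodule.span_induction with
  | mem x hx => obtain ⟨L, rfl⟩ := hx; exact hw L
  | zero => exact hz
  | add x y _ _ hx hy => exact hadd _ _ hx hy
  | smul c x _ hx => exact hsm _ _ hx

lemma heis_neg (A : VOA V) (hgen : Fin ℓ → V) (h : IsHeisenberg A hgen) (n : ℤ) (hn : n < 0) :
    A.wt n = ⊥ := by
  rw [Submodule.eq_bot_iff]
  intro x hx
  rw [← hcomp_self A n x hx]
  clear hx
  induction x using word_ind A hgen h with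
  | hz => simpa using hcomp_smul A n 0 0
  | hadd u v hu hv => rw [hcomp_add, hu, hv, add_zero]
  | hsm c u hu => rw [hcomp_smul, hu, smul_zero]
  | hw L =>
    obtain ⟨k, hk, -⟩ := word_wt A hgen h L
    exact hcomp_ne A k n (by omega) _ hk

lemma heis_zero (A : VOA V) (hgen : Fin ℓ → V) (h : IsHeisenberg A hgen) (x : V) (hx : x ∈ A.wt 0) :
    ∃ c : ℂ, x = c • A.one := by
  rw [← hcomp_self A 0 x hx]
  clear hx
  induction x using word_ind A hgen h with
  | hz => exact ⟨0, by simpa using hcomp_smul A 0 0 0⟩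
  | hadd u v hu hv =>
    obtain ⟨c, hc⟩ := hu; obtain ⟨d, hd⟩ := hv
    exact ⟨c + d, by rw [hcomp_add, hc, hd, add_smul]⟩
  | hsm c u hu => obtain ⟨d, hd⟩ := hu; exact ⟨c * d, by rw [hcomp_smul, hd, mul_smul]⟩
  | hw L =>
    by_cases hL : L = []
    · subst hL; exact ⟨1, by rw [one_smul]; exact hcomp_self A 0 _ A.one_wt⟩
    · obtain ⟨k, hk, h1⟩ := word_wt A hgen h L
      have := h1 hL
      exact ⟨0, by rw [zero_smul]; exact hcomp_ne A k 0 (by omega) _ hk⟩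

variable {W : Type} [AddCommGroup W] [Module ℂ W] (S : HeisenbergPlusSetting ℓ V W)

lemma B_neg (n : ℤ) (hn : n < 0) : S.B.wt n = ⊥ := by
  rw [Submodule.eq_bot_iff]
  intro x hx
  have := (S.fixedSub.map_wt n x).1 hx
  rw [heis_neg S.A S.hgen S.heis n hn, Submodule.mem_bot] at this
  exact S.fixedSub.inj (by rw [this, map_zero])

lemma B_zero (x : W) (hx : x ∈ S.B.wt 0) : ∃ c : ℂ, x = c • S.B.one := by
  obtain ⟨c, hc⟩ := heis_zero S.A S.hgen S.heis _ ((S.fixedSub.map_wt 0 x).1 hx)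
  exact ⟨c, S.fixedSub.inj (by rw [hc, map_smul, S.fixedSub.map_one])⟩

lemma theta_cons (a : Fin ℓ) (n : ℤ) (x : V) :
    S.θ (S.A.Y (S.hgen a) n x) = - S.A.Y (S.hgen a) n (S.θ x) := by
  rw [S.thetaAut.map_Y, S.thetaAut.map_gen, map_neg]; rfl

lemma theta_sq (x : V) : S.θ (S.θ x) = x := by
  induction x using word_ind S.A S.hgen S.heis with
  | hz => simp
  | hadd u v hu hv => rw [map_add, map_add, hu, hv]
  | hsm c u hu => rw [map_smul, map_smul, hu]
  | hw L =>
    induction L with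
    | nil => simp [wordAct, S.thetaAut.map_one]
    | cons x L ih =>
      obtain ⟨a, n⟩ := x
      simp only [wordAct]
      rw [theta_cons, map_neg, theta_cons, neg_neg, ih]

lemma range_iff (x : V) : S.θ x = x ↔ ∃ y, S.ι y = x := by
  have := congrArg (fun P => x ∈ P) S.fixedSub.range_eq
  simp only [LinearMap.mem_range, Module.End.mem_eigenspace_iff, one_smul] at this
  rw [this]; rfl

lemma theta_iota (y : W) : S.θ (S.ι y) = S.ι y := (range_iff S _).2 ⟨y, rfl⟩

lemma ex_pr (x : V) : ∃ y, S.ι y = (1/2:ℂ) • (x + S.θ x) := by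
  rw [← range_iff, map_smul, map_add, theta_sq, add_comm]

noncomputable def prf (x : V) : W := (ex_pr S x).choose

lemma iota_prf (x : V) : S.ι (prf S x) = (1/2:ℂ) • (x + S.θ x) := (ex_pr S x).choose_spec

noncomputable def pr : V →ₗ[ℂ] W where
  toFun := prf S
  map_add' x y := S.fixedSub.inj (by
    simp only [map_add, iota_prf]
    module)
  map_smul' c x := S.fixedSub.inj (by
    simp only [map_smul, iota_prf, RingHom.id_apply]
    module)

lemma iota_pr (x : V) : S.ι (pr S x) = (1/2:ℂ) • (x + S.θ x) := iota_prf S x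

lemma pr_iota (y : W) : pr S (S.ι y) = y := S.fixedSub.inj (by
  rw [iota_pr, theta_iota]; module)

lemma pr_Y (u : W) (n : ℤ) (x : V) : pr S (S.A.Y (S.ι u) n x) = S.B.Y u n (pr S x) :=
  S.fixedSub.inj (by
    rw [iota_pr, S.fixedSub.map_Y, iota_pr, S.thetaAut.map_Y, theta_iota, map_smul, map_add])

/-- commutation of `h_c(m)` with the modes of a quadratic element -/
lemma h_u (a b c : Fin ℓ) (j : ℤ) (hj : 0 ≤ j) :
    S.A.Y (S.hgen c) j (SV S.A S.hgen a b 1 1) =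
      if j = 1 then (if c = a then S.hgen b else 0) + (if c = b then S.hgen a else 0) else 0 := by
  have key : ∀ (a b : Fin ℓ) (m n : ℤ) (x : V), S.A.Y (S.hgen a) m (S.A.Y (S.hgen b) n x) =
      S.A.Y (S.hgen b) n (S.A.Y (S.hgen a) m x) + (if a = b ∧ m + n = 0 then (m : ℂ) else 0) • x := by
    intro a b m n x
    have := congrArg (fun f => f x) (S.heis.heis_comm a b m n)
    simp only [LinearMap.sub_apply, Module.End.mul_apply, LinearMap.smul_apply,
      Module.End.one_apply] at this
    rw [← this]; abel
  rw [SV, key, key c b, S.A.create_ge _ _ hj, map_zero, S.A.create, map_add, map_smul, map_zero, zero_add,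
    S.A.create]
  by_cases h : j = 1
  · subst h; by_cases h1 : c = a <;> by_cases h2 : c = b <;> simp [h1, h2, add_comm]
  · have : ¬ (j + -1 = 0) := by omega
    simp [h, this]

lemma U_comm (a b c : Fin ℓ) (m n : ℤ) (x : V) :
    S.A.Y (SV S.A S.hgen a b 1 1) n (S.A.Y (S.hgen c) m x) =
      S.A.Y (S.hgen c) m (S.A.Y (SV S.A S.hgen a b 1 1) n x)
      + (if c = a then (-(m:ℂ)) • S.A.Y (S.hgen b) (m + n - 1) x else 0)
      + (if c = b then (-(m:ℂ)) • S.A.Y (S.hgen a) (m + n - 1) x else 0) := by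
  have := mode_comm S.A (S.hgen c) (SV S.A S.hgen a b 1 1) x m n 2 (by
    intro j hj
    rw [h_u S _ _ _ _ (by omega), if_neg (by omega)])
  rw [Finset.sum_range_succ, Finset.sum_range_one, h_u S _ _ _ _ (by omega), h_u S _ _ _ _ (by omega),
    zc_one, zc_zero] at this
  norm_num at this
  rw [sub_eq_iff_eq_add] at this
  rw [this]
  split_ifs <;> simp <;> abel

end ZhuAux


namespace ZhuAux
variable {ℓ : ℕ} {V : Type} [AddCommGroup V] [Module ℂ V]
variable {W : Type} [AddCommGroup W] [Module ℂ W] (S : HeisenbergPlusSetting ℓ V W)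

lemma P2_eq : P 2 (-1) = LaurentPolynomial.T (-1) + (2:ℂ) • LaurentPolynomial.T 0
    + LaurentPolynomial.T 1 := by
  rw [P_expand]; simp [Finset.sum_range_succ]

lemma P1_eq : P 1 (-1) = LaurentPolynomial.T (-1) + LaurentPolynomial.T 0 := by
  rw [P_expand]; simp [Finset.sum_range_succ]

lemma M_P2 (A : VOA V) (u x : V) : M A u (P 2 (-1)) x
    = A.Y u (-1) x + (2:ℂ) • A.Y u 0 x + A.Y u 1 x := by
  rw [P2_eq, map_add, map_add, map_smul, M_T, M_T, M_T]; rfl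

lemma M_P1 (A : VOA V) (u x : V) : M A u (P 1 (-1)) x
    = A.Y u (-1) x + A.Y u 0 x := by
  rw [P1_eq, map_add, M_T, M_T]; rfl

lemma SV_wt (a b : Fin ℓ) : SV S.A S.hgen a b 1 1 ∈ S.A.wt 2 := by
  have h1 := S.A.mode_wt 1 _ (S.heis.wt_one b) 0 (-1) _ S.A.one_wt
  have h2 := S.A.mode_wt 1 _ (S.heis.wt_one a) _ (-1) _ h1
  simpa [SV] using h2

lemma SV_ex (a b : Fin ℓ) : ∃ u : W, S.ι u = SV S.A S.hgen a b 1 1 ∧ u ∈ S.B.wt 2 := by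
  have : S.θ (SV S.A S.hgen a b 1 1) = SV S.A S.hgen a b 1 1 := by
    rw [SV, theta_cons, theta_cons, S.thetaAut.map_one, map_neg, neg_neg]
  obtain ⟨u, hu⟩ := (range_iff S _).1 this
  exact ⟨u, hu, (S.fixedSub.map_wt 2 u).2 (hu ▸ SV_wt S a b)⟩

noncomputable def LoV (a b : Fin ℓ) : Module.End ℂ V :=
  S.A.Y (SV S.A S.hgen a b 1 1) (-1) + (2:ℂ) • S.A.Y (SV S.A S.hgen a b 1 1) 0
    + S.A.Y (SV S.A S.hgen a b 1 1) 1

noncomputable def DoV (a b : Fin ℓ) : Module.End ℂ V :=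
  S.A.Y (SV S.A S.hgen a b 1 1) 0 + S.A.Y (SV S.A S.hgen a b 1 1) 1

noncomputable def HV (a : Fin ℓ) (n : ℕ) : Module.End ℂ V := S.A.Y (S.hgen a) (-((n:ℤ)+1))

lemma HV_SV (a b : Fin ℓ) : HV S a 0 (HV S b 0 S.A.one) = SV S.A S.hgen a b 1 1 := by
  simp [HV, SV]

variable {R : Type} [Ring R] [Algebra ℂ R] (Z : ZhuRealization S.B R)

lemma pi_eq {x y : W} (h : x - y ∈ S.B.Osub) : Z.π x = Z.π y := by
  rw [← Z.ker_eq, LinearMap.mem_ker, map_sub, sub_eq_zero] at h; exact h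

lemma q_mulL (a b : Fin ℓ) (x : V) :
    Z.π (pr S (SV S.A S.hgen a b 1 1)) * Z.π (pr S x) = Z.π (pr S (LoV S a b x)) := by
  obtain ⟨u, hu, hw⟩ := SV_ex S a b
  rw [LoV, ← hu, pr_iota, ← Z.map_star, star_hom S.B (B_neg S) 2 u _ hw, M_P2]
  simp only [LinearMap.add_apply, LinearMap.smul_apply, map_add, map_smul, pr_Y]

lemma q_brD (a b : Fin ℓ) (x : V) :
    Z.π (pr S (SV S.A S.hgen a b 1 1)) * Z.π (pr S x)
      - Z.π (pr S x) * Z.π (pr S (SV S.A S.hgen a b 1 1)) = Z.π (pr S (DoV S a b x)) := by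
  rw [q_mulL]
  obtain ⟨u, hu, hw⟩ := SV_ex S a b
  rw [LoV, DoV, ← hu, pr_iota, ← Z.map_star,
    pi_eq S Z (star_mod S.B (B_neg S) 1 (pr S x) u hw), M_P1]
  simp only [LinearMap.add_apply, LinearMap.smul_apply, map_add, map_smul, pr_Y]
  module

lemma q_tot (x : V) : Z.π (pr S (∑ c, DoV S c c x)) = 0 := by
  have h1 : ∑ c, DoV S c c x = (2:ℂ) • (S.A.Y S.A.omega 0 x + S.A.Y S.A.omega 1 x) := by
    have : (2:ℂ) • S.A.omega = ∑ c, SV S.A S.hgen c c 1 1 := by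
      rw [S.heis.omega_eq, smul_smul]; norm_num [SV]
    have h2 : ∀ n, (2:ℂ) • S.A.Y S.A.omega n x = ∑ c, S.A.Y (SV S.A S.hgen c c 1 1) n x := by
      intro n
      have h3 := congrArg (fun v => S.A.Y v n x) this
      simpa using h3
    rw [smul_add, h2, h2, ← Finset.sum_add_distrib]; rfl
  rw [h1, ← S.fixedSub.map_omega, map_smul, map_add, pr_Y, pr_Y, map_smul]
  generalize pr S x = y
  have : Z.π (S.B.Y S.B.omega 0 y + S.B.Y S.B.omega 1 y) = 0 := by
    induction y using wt_ind S.B with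
    | h0 => simp
    | hadd u v hu hv =>
      have h := congrArg₂ (· + ·) hu hv
      simp only [map_add, add_zero] at h ⊢
      rw [← h]; abel
    | hw k u hu =>
      by_cases hk : k < 0
      · rw [B_neg S k hk, Submodule.mem_bot] at hu; simp [hu]
      · obtain ⟨n, rfl⟩ := Int.eq_ofNat_of_zero_le (not_lt.1 hk)
        rw [S.B.L0_diag _ _ hu, ← LinearMap.mem_ker, Z.ker_eq]
        exact_mod_cast omega0_mod S.B n u hu
  rw [this, smul_zero]

lemma fold_word (L : List (Fin ℓ × ℕ+)) :
    wordAct (fun a k w => S.A.Y (S.hgen a) k w) L S.A.one =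
    (L.map (fun p => (p.1, (p.2 : ℕ) - 1))).foldr (fun p x => HV S p.1 p.2 x) S.A.one := by
  induction L with
  | nil => rfl
  | cons x L ih =>
    obtain ⟨a, n⟩ := x
    simp only [wordAct, List.map_cons, List.foldr_cons]
    rw [← ih, HV]
    have e : -((n:ℕ):ℤ) = -((((n:ℕ) - 1 : ℕ) : ℤ) + 1) := by
      have := n.pos
      omega
    rw [e]

noncomputable def wd : WData ℓ V R where
  H := HV S
  one := S.A.one
  comm a m b n x := by
    have := congrArg (fun f => f x) (S.heis.heis_comm a b (-((m:ℤ)+1)) (-((n:ℤ)+1)))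
    rw [if_neg (by omega)] at this
    rw [zero_smul] at this
    exact sub_eq_zero.1 this
  Lo := LoV S
  Do := DoV S
  Lo_one a b := by
    rw [HV_SV]
    simp only [LoV, LinearMap.add_apply, LinearMap.smul_apply]
    rw [S.A.create, S.A.create_ge _ _ le_rfl, S.A.create_ge _ _ zero_le_one]; simp
  Do_one a b := by
    simp only [DoV, LinearMap.add_apply]
    rw [S.A.create_ge _ _ le_rfl, S.A.create_ge _ _ zero_le_one]; simp
  Lo_H a b c n x := by
    simp only [LoV, HV, LinearMap.add_apply, LinearMap.smul_apply, U_comm]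
    have e1 : -((n:ℤ)+1) + -1 - 1 = -(((n+2:ℕ):ℤ)+1) := by push_cast; ring
    have e2 : -((n:ℤ)+1) + 0 - 1 = -(((n+1:ℕ):ℤ)+1) := by push_cast; ring
    have e3 : -((n:ℤ)+1) + 1 - 1 = -((n:ℤ)+1) := by ring
    rw [e1, e2, e3]
    simp only [map_add, map_smul]
    push_cast
    split_ifs <;> module
  Do_H a b c n x := by
    simp only [DoV, HV, LinearMap.add_apply, U_comm]
    have e2 : -((n:ℤ)+1) + 0 - 1 = -(((n+1:ℕ):ℤ)+1) := by push_cast; ring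
    have e3 : -((n:ℤ)+1) + 1 - 1 = -((n:ℤ)+1) := by ring
    rw [e2, e3]
    simp only [map_add]
    push_cast
    split_ifs <;> module
  q := Z.π.comp (pr S)
  q_one := by
    rw [LinearMap.comp_apply, ← S.fixedSub.map_one, pr_iota, Z.map_one]
  q_surj := by
    intro r
    obtain ⟨y, rfl⟩ := Z.surj r
    exact ⟨S.ι y, by rw [LinearMap.comp_apply, pr_iota]⟩
  mulL a b x := by rw [HV_SV]; exact q_mulL S Z a b x
  brD a b x := by rw [HV_SV]; exact q_brD S Z a b x
  tot x := q_tot S Z x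
  odd a n := by
    have : pr S (HV S a n S.A.one) = 0 := S.fixedSub.inj (by
      rw [iota_pr, HV, theta_cons, S.thetaAut.map_one]; simp)
    rw [LinearMap.comp_apply, this, map_zero]
  span := by
    rw [eq_top_iff, ← S.heis.span_words]
    apply Submodule.span_mono
    rintro v ⟨L, rfl⟩
    exact ⟨_, fold_word S L⟩

lemma pi_s (s : Fin ℓ → Fin ℓ → ℤ → ℤ → W)
    (hs : ∀ a b m n, S.ι (s a b m n) = SV S.A S.hgen a b m n) (a b : Fin ℓ) (n : ℕ) :
    Z.π (s a b 1 ((n:ℤ)+1)) = (wd S Z).sg a (e 0) b (e n) := by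
  rw [WData.sg, WData.op_e, WData.op_e]
  change _ = Z.π (pr S (HV S a 0 (HV S b n S.A.one)))
  have : HV S a 0 (HV S b n S.A.one) = SV S.A S.hgen a b 1 ((n:ℤ)+1) := by simp [HV, SV]
  rw [this, ← hs, pr_iota]

open Polynomial in
lemma sg_e0 (w : WData ℓ V R) (a b : Fin ℓ) (f : ℂ[X]) :
    w.sg a (e 0) b (lt (f.comp (-X))) = w.T a b f := by
  rw [WData.sg_swap, ← WData.T_def, WData.T_swap, comp_assoc]; simp

open Polynomial in
lemma lt_eu : lt (WData.eu.comp (-X)) = (5:ℂ) • e 1 + (25:ℂ) • e 2 + (36:ℂ) • e 3 + (16:ℂ) • e 4 := by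
  have : WData.eu.comp (-X) = (2/3:ℂ) • X^4 + (-2/3:ℂ) • X^3 + (-1/6:ℂ) • X^2 + (1/6:ℂ) • X := by
    simp only [WData.eu, mul_comp, add_comp, sub_comp, pow_comp, X_comp, C_comp, one_comp,
      smul_eq_C_mul]
    have h : (C (2/3) * C (1/4) : ℂ[X]) = C (1/6) := by rw [← C_mul]; norm_num
    have h1 : (C (-2/3) : ℂ[X]) = - C (2/3) := by rw [← C_neg]; norm_num
    have h2 : (C (-1/6) : ℂ[X]) = - C (1/6) := by rw [← C_neg]; norm_num
    rw [h1, h2]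
    linear_combination (X - X^2) * h
  rw [this]; simp only [map_add, map_smul, lt_X1, lt_X2, lt_X3, lt_X4]; module

open Polynomial in
lemma lt_et : lt (WData.et.comp (-X)) =
    (-16:ℂ) • ((3:ℂ) • e 1 + (14:ℂ) • e 2 + (19:ℂ) • e 3 + (8:ℂ) • e 4) := by
  have : WData.et.comp (-X) = (-16/3:ℂ) • X^4 + (8/3:ℂ) • X^3 + (16/3:ℂ) • X^2 + (-8/3:ℂ) • X := by
    simp only [WData.et, mul_comp, add_comp, sub_comp, pow_comp, X_comp, C_comp, one_comp,
      smul_eq_C_mul]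
    have h : (C (16/3) * C (1/2) : ℂ[X]) = C (8/3) := by rw [← C_mul]; norm_num
    have h1 : (C (-16/3) : ℂ[X]) = - C (16/3) := by rw [← C_neg]; norm_num
    have h2 : (C (-8/3) : ℂ[X]) = - C (8/3) := by rw [← C_neg]; norm_num
    rw [h1, h2]
    linear_combination (X^3 - X) * h
  rw [this]; simp only [map_add, map_smul, lt_X1, lt_X2, lt_X3, lt_X4]; module

open Polynomial in
lemma lt_lam : lt (WData.lam.comp (-X)) =
    (45:ℂ) • e 1 + (190:ℂ) • e 2 + (240:ℂ) • e 3 + (96:ℂ) • e 4 := by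
  have : WData.lam.comp (-X) = (4:ℂ) • X^4 + (-5:ℂ) • X^2 + (1:ℂ) • 1 := by
    simp only [WData.lam, mul_comp, sub_comp, pow_comp, X_comp, C_comp, one_comp,
      smul_eq_C_mul]
    have h : (C 4 * C (1/4) : ℂ[X]) = C 1 := by rw [← C_mul]; norm_num
    have h1 : (C (-5) : ℂ[X]) = - C 4 - C 1 := by rw [← C_neg, ← C_sub]; norm_num
    rw [h1]
    linear_combination (1 - X^2) * h
  rw [this]; simp only [map_add, map_smul, lt_X2, lt_X4, lt_one]; module

end ZhuAux


namespace ZhuAux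
variable {ℓ : ℕ} {V : Type} [AddCommGroup V] [Module ℂ V]
variable {W : Type} [AddCommGroup W] [Module ℂ W] (S : HeisenbergPlusSetting ℓ V W)
variable {R : Type} [Ring R] [Algebra ℂ R] (Z : ZhuRealization S.B R)

lemma pi_s4 (s : Fin ℓ → Fin ℓ → ℤ → ℤ → W)
    (hs : ∀ a b m n, S.ι (s a b m n) = SV S.A S.hgen a b m n) (a b : Fin ℓ) :
    Z.π (s a b 1 2) = (wd S Z).sg a (e 0) b (e 1) ∧ Z.π (s a b 1 3) = (wd S Z).sg a (e 0) b (e 2) ∧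
    Z.π (s a b 1 4) = (wd S Z).sg a (e 0) b (e 3) ∧ Z.π (s a b 1 5) = (wd S Z).sg a (e 0) b (e 4) := by
  have h := pi_s S Z s hs a b
  exact ⟨h 1, h 2, h 3, h 4⟩

lemma pi_Eu (s : Fin ℓ → Fin ℓ → ℤ → ℤ → W)
    (hs : ∀ a b m n, S.ι (s a b m n) = SV S.A S.hgen a b m n) (a b : Fin ℓ) :
    Z.π (EuW s a b) = (wd S Z).T a b WData.eu := by
  obtain ⟨h1, h2, h3, h4⟩ := pi_s4 S Z s hs a b
  rw [← sg_e0, lt_eu]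
  simp only [EuW, map_add, map_smul, h1, h2, h3, h4, WData.sg_add_right, WData.sg_smul_right]

lemma pi_Et (s : Fin ℓ → Fin ℓ → ℤ → ℤ → W)
    (hs : ∀ a b m n, S.ι (s a b m n) = SV S.A S.hgen a b m n) (a b : Fin ℓ) :
    Z.π (EtW s a b) = (wd S Z).T a b WData.et := by
  obtain ⟨h1, h2, h3, h4⟩ := pi_s4 S Z s hs a b
  rw [← sg_e0, lt_et]
  simp only [EtW, map_add, map_smul, h1, h2, h3, h4, WData.sg_add_right, WData.sg_smul_right]

lemma pi_Lam (s : Fin ℓ → Fin ℓ → ℤ → ℤ → W)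
    (hs : ∀ a b m n, S.ι (s a b m n) = SV S.A S.hgen a b m n) (a b : Fin ℓ) :
    Z.π (LamW s a b) = (wd S Z).T a b WData.lam := by
  obtain ⟨h1, h2, h3, h4⟩ := pi_s4 S Z s hs a b
  rw [← sg_e0, lt_lam]
  simp only [LamW, map_add, map_smul, h1, h2, h3, h4, WData.sg_add_right, WData.sg_smul_right]

lemma pi_ow (ow : Fin ℓ → W) (how : ∀ a, S.ι (ow a) = omegaV S.A S.hgen a) (a : Fin ℓ) :
    Z.π (ow a) = (1/2:ℂ) • (wd S Z).XX a a := by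
  rw [WData.XX_def]
  change _ = (1/2:ℂ) • Z.π (pr S (HV S a 0 (HV S a 0 S.A.one)))
  rw [HV_SV, ← map_smul, ← map_smul, ← pr_iota S (ow a), how]; rfl

lemma starList_pi (L : List W) : Z.π (starList S.B L) = (L.map Z.π).prod := by
  induction L with
  | nil => exact Z.map_one
  | cons x L ih => rw [starList, Z.map_star, ih, List.map_cons, List.prod_cons]

lemma adjoin_pi (gens : Set W) (y : R) (hy : y ∈ Algebra.adjoin ℂ (Z.π '' gens)) :
    ∃ y' ∈ genMonomials S.B gens, Z.π y' = y := by
  have hy' : y ∈ Subalgebra.toSubmodule (Algebra.adjoin ℂ (Z.π '' gens)) := hy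
  rw [Algebra.adjoin_eq_span] at hy'
  change y ∈ (genMonomials S.B gens).map Z.π
  refine (Submodule.span_le.2 ?_) hy'
  intro r hr
  obtain ⟨l, hl, rfl⟩ := Submonoid.exists_list_of_mem_closure hr
  have : ∃ L : List W, (∀ g ∈ L, g ∈ gens) ∧ l = L.map Z.π := by
    clear hr
    induction l with
    | nil => exact ⟨[], by simp, rfl⟩
    | cons x l ih =>
      obtain ⟨L, hL, rfl⟩ := ih (fun y hy => hl y (List.mem_cons_of_mem _ hy))
      obtain ⟨g, hg, rfl⟩ := hl _ List.mem_cons_self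
      exact ⟨g :: L, by simpa using ⟨hg, hL⟩, rfl⟩
  obtain ⟨L, hL, rfl⟩ := this
  exact ⟨starList S.B L, Submodule.subset_span ⟨L, hL, rfl⟩, starList_pi S Z L⟩

lemma mem_of_pi (I : Submodule ℂ W) (hO : S.B.Osub ≤ I) (x : W) (h : Z.π x ∈ I.map Z.π) : x ∈ I := by
  obtain ⟨z, hz, hzx⟩ := h
  have : x - z ∈ S.B.Osub := by rw [← Z.ker_eq, LinearMap.mem_ker, map_sub, hzx, sub_self]
  have := I.add_mem (hO this) hz
  rwa [sub_add_cancel] at this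

end ZhuAux

/-- Proposition 5.3.5 and Corollary 5.1. The quotient algebra
`A(𝓗⁺)/𝓘` (where `𝓘 = 𝓘^u ⊕ 𝓘^t` is the ideal spanned by all matrix elements
`E^u_{ab}`, `E^t_{ab}`) is commutative and generated by the images of `[ω_a]`,
`[J_a]` and `[Λ_{ab}]` (`a ≠ b`); moreover every `Λ_{ab}` (`a ≠ b`) lies in the
center of `A(𝓗⁺)`. -/
theorem statement18 (ℓ : ℕ) {V W : Type} [AddCommGroup V] [Module ℂ V]
    [AddCommGroup W] [Module ℂ W] (S : HeisenbergPlusSetting ℓ V W)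
    (s : Fin ℓ → Fin ℓ → ℤ → ℤ → W)
    (hs : ∀ a b m n, S.ι (s a b m n) = SV S.A S.hgen a b m n)
    (ow : Fin ℓ → W) (how : ∀ a, S.ι (ow a) = omegaV S.A S.hgen a)
    (Jw : Fin ℓ → W) (hJw : ∀ a, S.ι (Jw a) = JV S.A S.hgen a)
    (p : Fin ℓ → Fin ℓ) (hp : ∀ a, p a ≠ a) :
    let Eu : Fin ℓ → Fin ℓ → W := fun a b =>
      if a = b then S.B.star (EuW s a (p a)) (EuW s (p a) a) else EuW s a b
    let Et : Fin ℓ → Fin ℓ → W := fun a b =>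
      if a = b then S.B.star (EtW s a (p a)) (EtW s (p a) a) else EtW s a b
    let Isub : Submodule ℂ W :=
      Submodule.span ℂ ({z : W | ∃ a b : Fin ℓ, z = Eu a b}
        ∪ {z : W | ∃ a b : Fin ℓ, z = Et a b}) ⊔ S.B.Osub
    -- A(𝓗⁺)/𝓘 is commutative
    (∀ x y : W, S.B.star x y - S.B.star y x ∈ Isub) ∧
    -- A(𝓗⁺)/𝓘 is generated by the images of ω_a, J_a and Λ_{ab}
    (∀ x : W, ∃ y ∈ genMonomials S.B
        (Set.range ow ∪ Set.range Jw
          ∪ {z : W | ∃ a b : Fin ℓ, a ≠ b ∧ z = LamW s a b}),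
      x - y ∈ Isub) ∧
    -- each Λ_{ab} (a ≠ b) is central in A(𝓗⁺)
    (∀ (a b : Fin ℓ), a ≠ b → ∀ x : W,
      S.B.star (LamW s a b) x - S.B.star x (LamW s a b) ∈ S.B.Osub) := by
  intro Eu Et Isub
  obtain ⟨R, _, _, ⟨Z⟩⟩ := ZhuAux.exists_zhu S.B (ZhuAux.B_neg S) (ZhuAux.B_zero S)
  have hO : S.B.Osub ≤ Isub := le_sup_right
  have hEu : ∀ a b, Eu a b ∈ Isub := fun a b =>
    (le_sup_left : _ ≤ Isub) (Submodule.subset_span (Or.inl ⟨a, b, rfl⟩))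
  have hEt : ∀ a b, Et a b ∈ Isub := fun a b =>
    (le_sup_left : _ ≤ Isub) (Submodule.subset_span (Or.inr ⟨a, b, rfl⟩))
  have hI0 : (ZhuAux.wd S Z).I0 p ≤ Isub.map Z.π := by
    rw [ZhuAux.WData.I0, Submodule.span_le]
    rintro x (⟨a, b, hab, rfl | rfl⟩ | ⟨a, rfl | rfl⟩)
    · exact ⟨Eu a b, hEu a b, by simp only [Eu, if_neg hab]; exact ZhuAux.pi_Eu S Z s hs a b⟩
    · exact ⟨Et a b, hEt a b, by simp only [Et, if_neg hab]; exact ZhuAux.pi_Et S Z s hs a b⟩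
    · refine ⟨Eu a a, hEu a a, ?_⟩
      simp only [Eu, if_true]
      rw [Z.map_star, ZhuAux.pi_Eu S Z s hs, ZhuAux.pi_Eu S Z s hs]
    · refine ⟨Et a a, hEt a a, ?_⟩
      simp only [Et, if_true]
      rw [Z.map_star, ZhuAux.pi_Et S Z s hs, ZhuAux.pi_Et S Z s hs]
  have hJ : ∀ x : W, Z.π x ∈ (ZhuAux.wd S Z).J → x ∈ Isub := fun x hx =>
    ZhuAux.mem_of_pi S Z Isub hO x (hI0 ((ZhuAux.wd S Z).I0_le p hp hx))
  refine ⟨?_, ?_, ?_⟩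
  · intro x y
    apply hJ
    rw [map_sub, Z.map_star, Z.map_star]
    exact (ZhuAux.wd S Z).main_comm p hp _ _
  · intro x
    obtain ⟨y, hy, hxy⟩ := (ZhuAux.wd S Z).main_gen p hp
      (Z.π '' (Set.range ow ∪ Set.range Jw ∪ {z : W | ∃ a b : Fin ℓ, a ≠ b ∧ z = LamW s a b}))
      (fun a => ⟨ow a, Or.inl (Or.inl ⟨a, rfl⟩), ZhuAux.pi_ow S Z ow how a⟩)
      (fun a b hab => ⟨LamW s a b, Or.inr ⟨a, b, hab, rfl⟩, ZhuAux.pi_Lam S Z s hs a b⟩) (Z.π x)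
    obtain ⟨y', hy', rfl⟩ := ZhuAux.adjoin_pi S Z _ y hy
    exact ⟨y', hy', hJ _ (by rw [map_sub]; exact hxy)⟩
  · intro a b hab x
    rw [← Z.ker_eq, LinearMap.mem_ker, map_sub, Z.map_star, Z.map_star, ZhuAux.pi_Lam S Z s hs]
    exact (ZhuAux.wd S Z).main_central p hp hab _
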